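/- arXiv:2008.05837 — 2 statements merged into one kernel-verified Lean document; each statement's English description precedes it below -/
import Mathlib

section
/- Fix ε > 0, let q ≥ 1 be an integer, and let χ be a Dirichlet character modulo q. Let Θ_χ ≥ 1/2 be the supremum of the real parts of the zeros s of L(s,χ) with 0 < Re(s) < 1. Then for every X sufficiently large (in terms of χ and ε) there exists a real number x ∈ [X^{1−ε}, X] such that Re(ψ(x,χ)) − 1_{χ=χ₀}·x < −x^{Θ_χ − ε}. -/
open Filter Real Complex
open scoped Classical

/-- `ψ(x,χ) = ∑_{n ≤ x} χ(n) Λ(n)`. -/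
noncomputable def psiChi {q : ℕ} (χ : DirichletCharacter ℂ q) (x : ℝ) : ℂ :=
  ∑ n ∈ Finset.range (Nat.floor x + 1), χ n * (ArithmeticFunction.vonMangoldt n : ℂ)

/-- The analytically continued Dirichlet L-function `L(s,χ)`
(with junk value `1` for the modulus `0`). -/
noncomputable def Lfunc (q : ℕ) (χ : DirichletCharacter ℂ q) (s : ℂ) : ℂ :=
  if h : q = 0 then 1 else
    letI : NeZero q := ⟨h⟩
    DirichletCharacter.LFunction χ s

/-- `Θ_χ`: the supremum of the real parts of the zeros of `L(s,χ)` in the critical strip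
(at least `1/2`). -/
noncomputable def ThetaChi (q : ℕ) (χ : DirichletCharacter ℂ q) : ℝ :=
  sSup (insert (1 / 2 : ℝ)
    {σ : ℝ | ∃ s : ℂ, Lfunc q χ s = 0 ∧ 0 < s.re ∧ s.re < 1 ∧ s.re = σ})

open MeasureTheory Set in
lemma integrableOn_pow_mul_exp_neg (k : ℕ) {a : ℝ} (ha : 0 < a) :
    IntegrableOn (fun u : ℝ ↦ u ^ k * rexp (-(a * u))) (Ioi 0) := by
  have := integrableOn_rpow_mul_exp_neg_mul_rpow (p := 1) (s := k) (b := a)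
    (by have : (0 : ℝ) ≤ k := k.cast_nonneg
        linarith) one_pos ha
  simpa using this

open MeasureTheory Set in
lemma integral_pow_mul_exp_neg_Ioi (k : ℕ) {a : ℝ} (ha : 0 < a) :
    ∫ u in Ioi (0 : ℝ), u ^ k * rexp (-(a * u)) = k.factorial / a ^ (k + 1) := by
  have := Real.integral_rpow_mul_exp_neg_mul_Ioi (a := k + 1) (r := a) (by positivity) ha
  simp only [add_sub_cancel_right, Real.rpow_natCast, Real.Gamma_nat_eq_factorial] at this
  rw [this, one_div, Real.inv_rpow ha.le, ← Nat.cast_add_one, Real.rpow_natCast]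
  field_simp

open MeasureTheory Set in
lemma integrableOn_pow_mul_cexp {K : ℝ → ℝ} (hK : Measurable K) {B C : ℝ}
    (hKC : ∀ u, 0 < u → |K u| ≤ C * rexp (B * u)) (k : ℕ) {s : ℂ} (hs : B < s.re) :
    IntegrableOn (fun u : ℝ ↦ (K u : ℂ) * (u : ℂ) ^ k * cexp (-s * u)) (Ioi 0) := by
  refine ((integrableOn_pow_mul_exp_neg k (sub_pos.2 hs)).const_mul C).mono' ?_ ?_
  · refine Measurable.aestronglyMeasurable ?_
    fun_prop
  · refine (ae_restrict_iff' measurableSet_Ioi).2 (ae_of_all _ fun u hu ↦ ?_)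
    have hu : 0 < u := hu
    rw [norm_mul, norm_mul, norm_pow, Complex.norm_real, Complex.norm_real, Complex.norm_exp,
      Real.norm_eq_abs, Real.norm_eq_abs, abs_of_pos hu]
    have h1 : (-s * (u : ℂ)).re = -(s.re * u) := by simp
    rw [h1]
    calc |K u| * u ^ k * rexp (-(s.re * u))
        ≤ (C * rexp (B * u)) * u ^ k * rexp (-(s.re * u)) := by
          gcongr; exact hKC u hu
      _ = C * (u ^ k * rexp (-((s.re - B) * u))) := by
          rw [show -((s.re - B) * u) = B * u + -(s.re * u) by ring, Real.exp_add]; ring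

open MeasureTheory Set in
lemma hasDerivAt_integral_pow_mul_cexp {K : ℝ → ℝ} (hK : Measurable K) {B C : ℝ}
    (hKC : ∀ u, 0 < u → |K u| ≤ C * rexp (B * u)) (k : ℕ) {s : ℂ} (hs : B < s.re) :
    HasDerivAt (fun z : ℂ ↦ ∫ u in Ioi (0 : ℝ), (K u : ℂ) * (u : ℂ) ^ k * cexp (-z * u))
      (-∫ u in Ioi (0 : ℝ), (K u : ℂ) * (u : ℂ) ^ (k + 1) * cexp (-s * u)) s := by
  obtain ⟨a, ha, has⟩ := exists_between hs
  have key := hasDerivAt_integral_of_dominated_loc_of_deriv_le (𝕜 := ℂ)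
    (μ := volume.restrict (Ioi (0 : ℝ))) (s := {z : ℂ | a < z.re}) (x₀ := s)
    (F := fun z u ↦ (K u : ℂ) * (u : ℂ) ^ k * cexp (-z * u))
    (F' := fun z u ↦ -((K u : ℂ) * (u : ℂ) ^ (k + 1) * cexp (-z * u)))
    (bound := fun u ↦ ‖(K u : ℂ) * (u : ℂ) ^ (k + 1) * cexp (-(a : ℂ) * u)‖)
    ((isOpen_lt continuous_const Complex.continuous_re).mem_nhds has)
    (Eventually.of_forall fun z ↦ (by fun_prop : Measurable _).aestronglyMeasurable)
    (integrableOn_pow_mul_cexp hK hKC k hs)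
    (by fun_prop : Measurable _).aestronglyMeasurable
    ((ae_restrict_iff' measurableSet_Ioi).2 (ae_of_all _ fun u hu z hz ↦ ?_))
    (integrableOn_pow_mul_cexp hK hKC (k + 1) (by simpa using ha)).norm
    (ae_of_all _ fun u z _ ↦ ?_)
  · rw [← integral_neg]
    exact key.2
  · have hu : 0 < u := hu
    have hz : a < z.re := hz
    rw [norm_neg, norm_mul, norm_mul _ (cexp (-(a : ℂ) * u)), Complex.norm_exp, Complex.norm_exp]
    have h1 : (-z * (u : ℂ)).re ≤ (-(a : ℂ) * u).re := by
      simp only [neg_mul, Complex.neg_re, Complex.re_mul_ofReal, Complex.ofReal_re]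
      nlinarith
    gcongr
  · have h1 : HasDerivAt (fun z : ℂ ↦ -z * (u : ℂ)) (-1 * u) z :=
      (hasDerivAt_id z).neg.mul_const _
    have := (h1.cexp).const_mul ((K u : ℂ) * (u : ℂ) ^ k)
    have e : -((K u : ℂ) * (u : ℂ) ^ (k + 1) * cexp (-z * u)) =
        (K u : ℂ) * (u : ℂ) ^ k * (cexp (-z * u) * (-1 * u)) := by ring
    rw [e]
    exact this

open MeasureTheory Set in
lemma iteratedDeriv_integral_mul_cexp {K : ℝ → ℝ} (hK : Measurable K) {B C : ℝ}
    (hKC : ∀ u, 0 < u → |K u| ≤ C * rexp (B * u)) (k : ℕ) {s : ℂ} (hs : B < s.re) :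
    iteratedDeriv k (fun z : ℂ ↦ ∫ u in Ioi (0 : ℝ), (K u : ℂ) * cexp (-z * u)) s =
      (-1) ^ k * ∫ u in Ioi (0 : ℝ), (K u : ℂ) * (u : ℂ) ^ k * cexp (-s * u) := by
  induction k generalizing s with
  | zero => simp
  | succ k ih =>
    rw [iteratedDeriv_succ]
    have h : iteratedDeriv k (fun z : ℂ ↦ ∫ u in Ioi (0 : ℝ), (K u : ℂ) * cexp (-z * u)) =ᶠ[nhds s]
        fun s ↦ (-1) ^ k * ∫ u in Ioi (0 : ℝ), (K u : ℂ) * (u : ℂ) ^ k * cexp (-s * u) := by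
      filter_upwards [(isOpen_lt continuous_const Complex.continuous_re).mem_nhds hs] with z hz
      exact ih hz
    rw [h.deriv_eq, ((hasDerivAt_integral_pow_mul_cexp hK hKC k hs).const_mul _).deriv]
    ring

open MeasureTheory Set in
/-- If `K ≥ 0` near the peak of `u ^ k * exp (-a u)`, then the complex Laplace moments of `K` are
dominated by the real one, up to an exponentially small error. -/
lemma norm_integral_le_of_nonneg_near_peak {K : ℝ → ℝ} (hK : Measurable K) {B C : ℝ}
    (hKC : ∀ u, 0 < u → |K u| ≤ C * rexp (B * u)) {a δ μ : ℝ} (ha : 0 < a) (haB : B < a)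
    (hμ : 0 ≤ μ) (hC : 0 ≤ C) (hμ1 : 0 < 1 + μ - B / a) (hμ2 : 0 < 1 - μ - B / a)
    (k : ℕ) (hpos : ∀ u, (1 - δ) * (k / a) ≤ u → u ≤ (1 + δ) * (k / a) → 0 ≤ K u)
    {s : ℂ} (hs : s.re = a) :
    ‖∫ u in Ioi (0 : ℝ), (K u : ℂ) * (u : ℂ) ^ k * cexp (-s * u)‖ ≤
      (∫ u in Ioi (0 : ℝ), (K u : ℂ) * (u : ℂ) ^ k * cexp (-(a : ℂ) * u)).re +
      2 * C * k.factorial / a ^ (k + 1) *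
        (rexp (μ * (1 - δ)) ^ k / (1 + μ - B / a) ^ (k + 1) +
          rexp (-(μ * (1 + δ))) ^ k / (1 - μ - B / a) ^ (k + 1)) := by
  have hre : ∀ u : ℝ, ((K u : ℂ) * (u : ℂ) ^ k * cexp (-(a : ℂ) * u)) =
      ((K u * u ^ k * rexp (-(a * u)) : ℝ) : ℂ) := by
    intro u; push_cast; ring_nf
  have hint0 := integrableOn_pow_mul_cexp hK hKC k (s := (a : ℂ)) (by simpa using haB)
  simp_rw [hre] at hint0 ⊢
  have hint : IntegrableOn (fun u : ℝ ↦ K u * u ^ k * rexp (-(a * u))) (Ioi 0) := by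
    exact hint0.re
  rw [integral_complex_ofReal, Complex.ofReal_re]
  have h1 : 0 < a + μ * a - B := by
    have := mul_pos ha hμ1
    field_simp at this; linarith
  have h2 : 0 < a - μ * a - B := by
    have := mul_pos ha hμ2
    field_simp at this; linarith
  set E1 := rexp (μ * (1 - δ)) ^ k with hE1
  set E2 := rexp (-(μ * (1 + δ))) ^ k with hE2
  have hE1' : E1 = rexp (μ * a * ((1 - δ) * (k / a))) := by
    rw [hE1, ← Real.exp_nat_mul]; congr 1; field_simp
  have hE2' : E2 = rexp (-(μ * a * ((1 + δ) * (k / a)))) := by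
    rw [hE2, ← Real.exp_nat_mul]; congr 1; field_simp
  have i1 := (integrableOn_pow_mul_exp_neg k h1).const_mul (2 * C * E1)
  have i2 := (integrableOn_pow_mul_exp_neg k h2).const_mul (2 * C * E2)
  have hle : ‖∫ u in Ioi (0 : ℝ), (K u : ℂ) * (u : ℂ) ^ k * cexp (-s * u)‖ ≤
      ∫ u in Ioi (0 : ℝ), (K u * u ^ k * rexp (-(a * u)) +
        (2 * C * E1 * (u ^ k * rexp (-((a + μ * a - B) * u))) +
        2 * C * E2 * (u ^ k * rexp (-((a - μ * a - B) * u))))) := by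
    refine norm_integral_le_of_norm_le (hint.add (i1.add i2))
      ((ae_restrict_iff' measurableSet_Ioi).2 (ae_of_all _ fun u hu ↦ ?_))
    have hu : 0 < u := hu
    rw [norm_mul, norm_mul, norm_pow, Complex.norm_real, Complex.norm_real, Complex.norm_exp,
      Real.norm_eq_abs, Real.norm_eq_abs, abs_of_pos hu]
    have h3 : (-s * (u : ℂ)).re = -(a * u) := by simp [hs]
    rw [h3]
    have e1 : rexp (-((a + μ * a - B) * u)) = rexp (B * u) * rexp (-(μ * a * u)) * rexp (-(a * u)) := by
      rw [← Real.exp_add, ← Real.exp_add]; ring_nf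
    have e2 : rexp (-((a - μ * a - B) * u)) = rexp (B * u) * rexp (μ * a * u) * rexp (-(a * u)) := by
      rw [← Real.exp_add, ← Real.exp_add]; ring_nf
    rw [e1, e2]
    have key : |K u| ≤ K u + 2 * C * rexp (B * u) * (E1 * rexp (-(μ * a * u)) + E2 * rexp (μ * a * u)) := by
      have hE1p : 0 < E1 := by positivity
      have hE2p : 0 < E2 := by positivity
      rcases le_or_gt 0 (K u) with h | h
      · rw [abs_of_nonneg h]
        have : 0 ≤ 2 * C * rexp (B * u) * (E1 * rexp (-(μ * a * u)) + E2 * rexp (μ * a * u)) := by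
          positivity
        linarith
      · have hb := hKC u hu
        have hone : 1 ≤ E1 * rexp (-(μ * a * u)) + E2 * rexp (μ * a * u) := by
          rcases lt_or_ge u ((1 - δ) * (k / a)) with h4 | h4
          · have : 1 ≤ E1 * rexp (-(μ * a * u)) := by
              rw [hE1', ← Real.exp_add]
              apply Real.one_le_exp
              nlinarith [mul_nonneg hμ ha.le]
            have : 0 < E2 * rexp (μ * a * u) := by positivity
            linarith
          · have h5 : (1 + δ) * (k / a) < u := by
              by_contra! h5
              exact absurd (hpos u h4 h5) (not_le.2 h)
            have : 1 ≤ E2 * rexp (μ * a * u) := by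
              rw [hE2', ← Real.exp_add]
              apply Real.one_le_exp
              nlinarith [mul_nonneg hμ ha.le]
            have : 0 < E1 * rexp (-(μ * a * u)) := by positivity
            linarith
        have : |K u| = - K u := abs_of_neg h
        have h6 : 2 * C * rexp (B * u) * 1 ≤ 2 * C * rexp (B * u) * (E1 * rexp (-(μ * a * u)) + E2 * rexp (μ * a * u)) := by
          gcongr
        linarith
    have hw : 0 ≤ u ^ k * rexp (-(a * u)) := by positivity
    calc |K u| * u ^ k * rexp (-(a * u)) = |K u| * (u ^ k * rexp (-(a * u))) := by ring
      _ ≤ (K u + 2 * C * rexp (B * u) * (E1 * rexp (-(μ * a * u)) + E2 * rexp (μ * a * u))) *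
          (u ^ k * rexp (-(a * u))) := by gcongr
      _ = _ := by ring
  refine hle.trans (le_of_eq ?_)
  have hadd := integral_add i1 i2
  have hadd' := integral_add hint (i1.add i2)
  simp only [Pi.add_apply] at hadd'
  rw [hadd', hadd, integral_const_mul, integral_const_mul,
    integral_pow_mul_exp_neg_Ioi k h1, integral_pow_mul_exp_neg_Ioi k h2]
  have e1 : a + μ * a - B = a * (1 + μ - B / a) := by field_simp
  have e2 : a - μ * a - B = a * (1 - μ - B / a) := by field_simp
  rw [e1, e2, mul_pow, mul_pow]
  field_simp

lemma exists_peak_tail_bound {δ : ℝ} (hδ0 : 0 < δ) (hδ1 : δ < 1) :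
    ∃ γ : ℝ, 0 < γ ∧ ∀ B C a : ℝ, 0 < B → 0 ≤ C → B / γ < a →
      B < a ∧ 0 < 1 + δ / 2 - B / a ∧ 0 < 1 - δ / 2 - B / a ∧
      ∃ D r : ℝ, 0 ≤ D ∧ a < r ∧ ∀ k : ℕ,
        2 * C * k.factorial / a ^ (k + 1) *
          (rexp (δ / 2 * (1 - δ)) ^ k / (1 + δ / 2 - B / a) ^ (k + 1) +
            rexp (-(δ / 2 * (1 + δ))) ^ k / (1 - δ / 2 - B / a) ^ (k + 1)) ≤
          D * k.factorial / r ^ k := by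
  set x1 := rexp (δ / 2 * (1 - δ)) with hx1
  set x2 := rexp (-(δ / 2 * (1 + δ))) with hx2
  have x1pos : 0 < x1 := Real.exp_pos _
  have x2pos : 0 < x2 := Real.exp_pos _
  have h1 : x1 < 1 + δ / 2 := by
    have h := Real.add_one_le_exp (-(δ / 2 * (1 - δ)))
    have hm : rexp (-(δ / 2 * (1 - δ))) * x1 = 1 := by
      rw [hx1, ← Real.exp_add]; simp
    have hp : 1 < (1 + δ / 2) * (-(δ / 2 * (1 - δ)) + 1) := by nlinarith [mul_pos hδ0 hδ0]
    have h3 : (-(δ / 2 * (1 - δ)) + 1) * x1 ≤ 1 := by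
      exact (mul_le_mul_of_nonneg_right h x1pos.le).trans hm.le
    by_contra! hc
    have : 0 < (-(δ / 2 * (1 - δ)) + 1) := by nlinarith
    nlinarith
  have h2 : x2 < 1 - δ / 2 := by
    have h := Real.add_one_le_exp (δ / 2 * (1 + δ))
    have hm : rexp (δ / 2 * (1 + δ)) * x2 = 1 := by
      rw [hx2, ← Real.exp_add]; simp
    have hp : 1 < (1 - δ / 2) * (δ / 2 * (1 + δ) + 1) := by
      nlinarith [mul_pos hδ0 hδ0, mul_pos (mul_pos hδ0 hδ0) (sub_pos.2 hδ1)]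
    have h3 : (δ / 2 * (1 + δ) + 1) * x2 ≤ 1 := by
      exact (mul_le_mul_of_nonneg_right h x2pos.le).trans hm.le
    by_contra! hc
    have : 0 < δ / 2 * (1 + δ) + 1 := by positivity
    nlinarith
  refine ⟨min (1 + δ / 2 - x1) (1 - δ / 2 - x2), lt_min (by linarith) (by linarith), ?_⟩
  set γ := min (1 + δ / 2 - x1) (1 - δ / 2 - x2) with hγ
  have hγ0 : 0 < γ := lt_min (by linarith) (by linarith)
  intro B C a hB hC ha
  have ha0 : 0 < a := lt_trans (by positivity) ha
  have hBa : B / a < γ := by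
    rw [div_lt_iff₀ hγ0] at ha
    rw [div_lt_iff₀ ha0]; linarith
  have g1 : γ ≤ 1 + δ / 2 - x1 := min_le_left _ _
  have g2 : γ ≤ 1 - δ / 2 - x2 := min_le_right _ _
  have hB1 : B / a < 1 := by linarith
  have y1 : x1 < 1 + δ / 2 - B / a := by linarith
  have y2 : x2 < 1 - δ / 2 - B / a := by linarith
  refine ⟨by rwa [div_lt_one ha0] at hB1, by linarith, by linarith, ?_⟩
  generalize 1 + δ / 2 - B / a = Y1 at y1
  generalize 1 - δ / 2 - B / a = Y2 at y2
  have Y1pos : 0 < Y1 := by linarith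
  have Y2pos : 0 < Y2 := by linarith
  set Q := max (x1 / Y1) (x2 / Y2) with hQ
  have Qpos : 0 < Q := lt_max_of_lt_left (by positivity)
  have Q1 : Q < 1 := max_lt ((div_lt_one Y1pos).2 y1) ((div_lt_one Y2pos).2 y2)
  refine ⟨2 * C / a * (1 / Y1 + 1 / Y2), a / Q, by positivity, ?_, fun k ↦ ?_⟩
  · rw [lt_div_iff₀ Qpos]; nlinarith
  have e1 : x1 ^ k / Y1 ^ (k + 1) ≤ Q ^ k * (1 / Y1) := by
    have : x1 ^ k / Y1 ^ (k + 1) = (x1 / Y1) ^ k * (1 / Y1) := by rw [div_pow]; field_simp; ring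
    rw [this]
    gcongr
    exact le_max_left _ _
  have e2 : x2 ^ k / Y2 ^ (k + 1) ≤ Q ^ k * (1 / Y2) := by
    have : x2 ^ k / Y2 ^ (k + 1) = (x2 / Y2) ^ k * (1 / Y2) := by rw [div_pow]; field_simp; ring
    rw [this]
    gcongr
    exact le_max_right _ _
  calc _ ≤ 2 * C * k.factorial / a ^ (k + 1) * (Q ^ k * (1 / Y1) + Q ^ k * (1 / Y2)) := by gcongr
    _ = _ := by rw [div_pow]; field_simp; ring

lemma exists_entire_factor {E : ℂ → ℂ} (hE : Differentiable ℂ E) {z₀ ρ : ℂ} (hz₀ : E z₀ ≠ 0)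
    (hρ : E ρ = 0) :
    ∃ (m : ℕ) (g : ℂ → ℂ), m ≠ 0 ∧ Differentiable ℂ g ∧ g ρ ≠ 0 ∧
      ∀ z, E z = (z - ρ) ^ m * g z := by
  have han : AnalyticOnNhd ℂ E Set.univ := fun z _ ↦ hE.analyticAt z
  have h0 : analyticOrderAt E z₀ ≠ ⊤ := by
    rw [(hE.analyticAt z₀).analyticOrderAt_eq_zero.2 hz₀]; simp
  have hord : analyticOrderAt E ρ ≠ ⊤ :=
    han.analyticOrderAt_ne_top_of_isPreconnected isPreconnected_univ (Set.mem_univ z₀)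
      (Set.mem_univ ρ) h0
  obtain ⟨g₀, hg₀, hg₀ρ, hfac⟩ := (hE.analyticAt ρ).analyticOrderAt_ne_top.1 hord
  set m := analyticOrderNatAt E ρ with hm
  have hm0 : m ≠ 0 := by
    intro h
    have := hfac.self_of_nhds
    rw [h, hρ] at this
    simp at this
    exact hg₀ρ this.symm
  refine ⟨m, fun z ↦ if z = ρ then g₀ ρ else E z / (z - ρ) ^ m, hm0, ?_, by simpa using hg₀ρ, ?_⟩
  · intro z
    by_cases hz : z = ρ
    · subst hz
      refine hg₀.differentiableAt.congr_of_eventuallyEq ?_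
      filter_upwards [hfac] with w hw
      split_ifs with hwz
      · rw [hwz]
      · rw [hw, smul_eq_mul, mul_div_cancel_left₀]
        exact pow_ne_zero _ (sub_ne_zero.2 hwz)
    · have : DifferentiableAt ℂ (fun z ↦ E z / (z - ρ) ^ m) z :=
        (hE z).div (by fun_prop) (pow_ne_zero _ (sub_ne_zero.2 hz))
      refine this.congr_of_eventuallyEq ?_
      filter_upwards [isOpen_ne.mem_nhds hz] with w hw
      exact if_neg hw
  · intro z
    by_cases hz : z = ρ
    · subst hz; simp [hρ, hm0]
    · simp only [if_neg hz]
      rw [mul_div_cancel₀]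
      exact pow_ne_zero _ (sub_ne_zero.2 hz)

lemma exists_iteratedDeriv_bound {f : ℂ → ℂ} {c : ℂ} {d r : ℝ} (hr : 0 < r) (hrd : r < d)
    (hf : DifferentiableOn ℂ f (Metric.ball c d)) :
    ∃ M : ℝ, 0 ≤ M ∧ ∀ k : ℕ, ‖iteratedDeriv k f c‖ ≤ M * k.factorial / r ^ k := by
  have hcl : Metric.closedBall c r ⊆ Metric.ball c d := Metric.closedBall_subset_ball hrd
  have hsph : Metric.sphere c r ⊆ Metric.ball c d := Metric.sphere_subset_closedBall.trans hcl
  obtain ⟨M, hM⟩ := (isCompact_sphere c r).exists_bound_of_continuousOn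
    (hf.continuousOn.mono hsph)
  refine ⟨max M 0, le_max_right _ _, fun k ↦ ?_⟩
  have := Complex.norm_iteratedDeriv_le_of_forall_mem_sphere_norm_le (C := max M 0) k hr
    ((hf.mono hcl).diffContOnCl_ball subset_rfl) (fun z hz ↦ (hM z hz).trans (le_max_left _ _))
  rwa [mul_comm (max M 0)]

lemma iteratedDeriv_const_div_sub (k : ℕ) (c ρ : ℂ) :
    iteratedDeriv k (fun z ↦ c / (z - ρ)) =
      fun z ↦ c * ((-1) ^ k * k.factorial / (z - ρ) ^ (k + 1)) := by
  have h := iter_deriv_inv_linear_sub k (1 : ℂ) ρ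
  ext z
  have h2 : (fun z ↦ c / (z - ρ)) = fun z ↦ c * (fun x : ℂ ↦ (1 * x - ρ)⁻¹) z := by
    ext z; simp [div_eq_mul_inv]
  rw [h2, iteratedDeriv_const_mul_field, iteratedDeriv_eq_iterate, h]
  simp
  left
  rw [show (-1 - (k : ℤ)) = -((k + 1 : ℕ) : ℤ) by push_cast; ring, zpow_neg, zpow_natCast]
  field_simp

open MeasureTheory Set in
lemma eventually_exists_neg_of_pole {K : ℝ → ℝ} (hK : Measurable K) {B C : ℝ} (hC : 0 ≤ C)
    (hKC : ∀ u, 0 < u → |K u| ≤ C * rexp (B * u)) {F : ℂ → ℂ}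
    (hL : ∀ s : ℂ, B < s.re → ∫ u in Ioi (0 : ℝ), (K u : ℂ) * cexp (-s * u) = F s)
    {δ a D r₄ : ℝ} (ha : 0 < a) (haB : B < a) (hδ : 0 < δ) (h1 : 0 < 1 + δ / 2 - B / a)
    (h2 : 0 < 1 - δ / 2 - B / a) (hr₄ : a < r₄)
    (htail : ∀ k : ℕ, 2 * C * k.factorial / a ^ (k + 1) *
      (rexp (δ / 2 * (1 - δ)) ^ k / (1 + δ / 2 - B / a) ^ (k + 1) +
        rexp (-(δ / 2 * (1 + δ))) ^ k / (1 - δ / 2 - B / a) ^ (k + 1)) ≤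
      D * k.factorial / r₄ ^ k)
    {s ρ c : ℂ} {R : ℂ → ℂ} {r₁ d₀ : ℝ} (hs : s.re = a) (hr₁ : 0 < r₁) (hsρ : ‖s - ρ‖ = r₁)
    (hr₁a : r₁ < a) (hc : c ≠ 0) (hF : F =ᶠ[nhds s] fun z ↦ c / (z - ρ) + R z) (hd : r₁ < d₀)
    (hR : DifferentiableOn ℂ R (Metric.ball s d₀)) {M' r' : ℝ} (hr' : r₁ < r')
    (hup : ∀ k : ℕ, ((-1) ^ k * iteratedDeriv k F a).re ≤ M' * k.factorial / r' ^ k) :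
    ∀ᶠ k : ℕ in atTop, ∃ u, (1 - δ) * (k / a) ≤ u ∧ u ≤ (1 + δ) * (k / a) ∧ K u < 0 := by
  obtain ⟨M, hM0, hM⟩ := exists_iteratedDeriv_bound (r := (r₁ + d₀) / 2) (by linarith)
    (by linarith) hR
  set r₂ := (r₁ + d₀) / 2 with hr₂
  have hr₂1 : r₁ < r₂ := by rw [hr₂]; linarith
  have hiter : ∀ z : ℂ, B < z.re → ∀ k, iteratedDeriv k F z =
      (-1) ^ k * ∫ u in Ioi (0 : ℝ), (K u : ℂ) * (u : ℂ) ^ k * cexp (-z * u) := by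
    intro z hz k
    rw [← iteratedDeriv_integral_mul_cexp hK hKC k hz]
    refine EventuallyEq.iteratedDeriv_eq k ?_
    filter_upwards [(isOpen_lt continuous_const Complex.continuous_re).mem_nhds hz] with w hw
    exact (hL w hw).symm
  have hlim : Tendsto (fun k : ℕ ↦ M' * (r₁ / r') ^ k + D * (r₁ / r₄) ^ k + M * (r₁ / r₂) ^ k)
      atTop (nhds (M' * 0 + D * 0 + M * 0)) := by
    have key : ∀ r, r₁ < r → Tendsto (fun k : ℕ ↦ (r₁ / r) ^ k) atTop (nhds 0) := fun r hr ↦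
      tendsto_pow_atTop_nhds_zero_of_lt_one (by have := hr₁.trans hr; positivity)
        ((div_lt_one (hr₁.trans hr)).2 hr)
    exact (((key _ hr').const_mul _).add ((key _ (hr₁a.trans hr₄)).const_mul _)).add
      ((key _ hr₂1).const_mul _)
  have hpos : M' * 0 + D * 0 + M * 0 < ‖c‖ / r₁ := by
    simp only [mul_zero, add_zero]
    have := norm_pos_iff.2 hc
    positivity
  filter_upwards [hlim.eventually_lt_const hpos] with k hk
  by_contra! hno
  have hpeak := norm_integral_le_of_nonneg_near_peak hK hKC (μ := δ / 2) ha haB (by linarith) hC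
    h1 h2 k (fun u hu1 hu2 ↦ hno u hu1 hu2) hs
  have hIa := hiter (a : ℂ) (by simpa using haB) k
  have hIs := hiter s (by rw [hs]; exact haB) k
  have hm1 : ((-1 : ℂ) ^ k) * (-1) ^ k = 1 := by rw [← mul_pow]; simp
  have hIa' : (∫ u in Ioi (0 : ℝ), (K u : ℂ) * (u : ℂ) ^ k * cexp (-(a : ℂ) * u)) =
      (-1) ^ k * iteratedDeriv k F a := by rw [hIa, ← mul_assoc, hm1, one_mul]
  have hIs' : ‖∫ u in Ioi (0 : ℝ), (K u : ℂ) * (u : ℂ) ^ k * cexp (-s * u)‖ =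
      ‖iteratedDeriv k F s‖ := by rw [hIs]; simp
  rw [hIa', hIs'] at hpeak
  have hbound := hpeak.trans (add_le_add (hup k) (htail k))
  have hsρ0 : s - ρ ≠ 0 := norm_pos_iff.1 (by rw [hsρ]; exact hr₁)
  have hRan : ContDiffAt ℂ k R s :=
    (hR.analyticAt (Metric.ball_mem_nhds s (hr₁.trans hd))).contDiffAt
  have hcan : ContDiffAt ℂ k (fun z ↦ c / (z - ρ)) s :=
    contDiffAt_const.div (contDiffAt_id.sub contDiffAt_const) hsρ0
  have hsplit : iteratedDeriv k F s =
      c * ((-1) ^ k * k.factorial / (s - ρ) ^ (k + 1)) + iteratedDeriv k R s := by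
    rw [EventuallyEq.iteratedDeriv_eq k hF, iteratedDeriv_fun_add hcan hRan,
      iteratedDeriv_const_div_sub]
  have hmain : ‖c‖ * (k.factorial / r₁ ^ (k + 1)) ≤ ‖iteratedDeriv k F s‖ + ‖iteratedDeriv k R s‖ := by
    have : c * ((-1) ^ k * k.factorial / (s - ρ) ^ (k + 1)) =
      iteratedDeriv k F s - iteratedDeriv k R s := by rw [hsplit]; ring
    calc _ = ‖c * ((-1) ^ k * k.factorial / (s - ρ) ^ (k + 1))‖ := by simp [hsρ]
      _ ≤ _ := by rw [this]; exact norm_sub_le _ _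
  have hfin := hmain.trans (add_le_add hbound (hM k))
  have hkf : (0 : ℝ) < k.factorial := by positivity
  have : ‖c‖ / r₁ ≤ M' * (r₁ / r') ^ k + D * (r₁ / r₄) ^ k + M * (r₁ / r₂) ^ k := by
    have h3 := mul_le_mul_of_nonneg_left hfin (show 0 ≤ r₁ ^ k / k.factorial by positivity)
    have e1 : r₁ ^ k / k.factorial * (‖c‖ * (k.factorial / r₁ ^ (k + 1))) = ‖c‖ / r₁ := by
      field_simp; ring
    have e2 : r₁ ^ k / k.factorial * (M' * k.factorial / r' ^ k + D * k.factorial / r₄ ^ k +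
        M * k.factorial / r₂ ^ k) =
        M' * (r₁ / r') ^ k + D * (r₁ / r₄) ^ k + M * (r₁ / r₂) ^ k := by
      simp only [div_pow]
      field_simp
    rwa [e1, e2] at h3
  linarith

lemma eq_of_norm_sub_smul_le {v w : ℂ} {η : ℝ} (h0 : 0 < η) (h1 : η < 1) (h : ‖w‖ ≤ ‖v‖)
    (h' : ‖v - η * w‖ ≤ (1 - η) * ‖w‖) : v = w := by
  have e1 : ‖w‖ ^ 2 ≤ ‖v‖ ^ 2 := by gcongr
  have e2 : ‖v - η * w‖ ^ 2 ≤ ((1 - η) * ‖w‖) ^ 2 := by gcongr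
  rw [mul_pow] at e2
  simp only [← Complex.normSq_eq_norm_sq, Complex.normSq_apply] at e1 e2
  simp at e2
  have key : (v.re - w.re) ^ 2 + (v.im - w.im) ^ 2 ≤ 0 := by
    have : η * ((v.re - w.re) ^ 2 + (v.im - w.im) ^ 2) ≤ 0 := by nlinarith
    nlinarith
  apply Complex.ext <;> nlinarith [sq_nonneg (v.re - w.re), sq_nonneg (v.im - w.im)]

lemma exists_nearest_zero {E : ℂ → ℂ} (hE : Continuous E) {ρ' A : ℂ} (h : E ρ' = 0) :
    ∃ ρ, E ρ = 0 ∧ ∀ z, E z = 0 → ‖ρ - A‖ ≤ ‖z - A‖ := by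
  have hcl : IsClosed {z | E z = 0} := isClosed_eq hE continuous_const
  obtain ⟨ρ, hρ, hd⟩ := hcl.exists_infDist_eq_dist ⟨ρ', h⟩ A
  refine ⟨ρ, hρ, fun z hz ↦ ?_⟩
  have := Metric.infDist_le_dist_of_mem (x := A) (show z ∈ {z | E z = 0} from hz)
  rw [hd] at this
  simpa [dist_eq_norm, norm_sub_rev] using this

open MeasureTheory Set in
lemma exists_neg_near_peak {K : ℝ → ℝ} (hK : Measurable K) {B C : ℝ} (hB : 0 < B) (hC : 0 ≤ C)
    (hKC : ∀ u, 0 < u → |K u| ≤ C * rexp (B * u)) {E : ℂ → ℂ} (hE : Differentiable ℂ E)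
    (hE0 : ∀ s : ℂ, B < s.re → E s ≠ 0) {θ : ℝ} (hθ : 0 < θ) (d : ℂ)
    (hL : ∀ s : ℂ, B < s.re → ∫ u in Ioi (0 : ℝ), (K u : ℂ) * cexp (-s * u) =
      -(deriv E s / E s) / (2 * s) - d / s + 1 / (s - θ))
    {ρ' : ℂ} (hρ' : E ρ' = 0) (hρ'θ : θ < ρ'.re) {δ : ℝ} (hδ0 : 0 < δ) (hδ1 : δ < 1) :
    ∃ a : ℝ, 0 < a ∧ ∀ᶠ k : ℕ in atTop,
      ∃ u, (1 - δ) * (k / a) ≤ u ∧ u ≤ (1 + δ) * (k / a) ∧ K u < 0 := by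
  obtain ⟨γ, hγ, hnum⟩ := exists_peak_tail_bound hδ0 hδ1
  obtain ⟨A, hA⟩ : ∃ A : ℝ, B / γ + 1 < A ∧ B + 1 < A ∧ θ + 1 < A ∧ 2 < A ∧
      (ρ'.re ^ 2 + ρ'.im ^ 2) / (2 * (ρ'.re - θ)) < A := by
    have h : ∀ x : ℝ, ∀ᶠ A : ℝ in atTop, x < A := fun x ↦ eventually_gt_atTop x
    exact ((h _).and ((h _).and ((h _).and ((h _).and (h _))))).exists
  obtain ⟨hA1, hA2, hA3, hA4, hA5⟩ := hA
  have hEA : E A ≠ 0 := hE0 A (by simp; linarith)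
  obtain ⟨ρ, hρ, hnear⟩ := exists_nearest_zero (A := (A : ℂ)) hE.continuous hρ'
  set N := ‖ρ - A‖ with hN
  have hNpos : 0 < N := by
    rw [hN, norm_pos_iff, sub_ne_zero]
    rintro rfl; exact hEA hρ
  have hNθ : N < A - θ := by
    refine (hnear ρ' hρ').trans_lt ?_
    rw [div_lt_iff₀ (by linarith)] at hA5
    refine lt_of_pow_lt_pow_left₀ 2 (by linarith) ?_
    rw [← Complex.normSq_eq_norm_sq, Complex.normSq_apply]
    simp
    nlinarith [mul_pos hθ hθ]
  have hreN : A - ρ.re ≤ N := by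
    have := (abs_le.1 (Complex.abs_re_le_norm (ρ - A))).1
    simp at this
    linarith
  have hβθ : θ < ρ.re := by linarith
  have hβB : ρ.re ≤ B := by
    by_contra! h
    exact hE0 ρ h hρ
  set η := 1 / (2 * A) with hη
  have hη0 : 0 < η := by
    have : 0 < A := by linarith
    positivity
  have hη1 : η < 1 := by
    rw [hη, div_lt_one (by linarith)]; linarith
  have hηA : η * A = 1 / 2 := by
    rw [hη]
    have : A ≠ 0 := by linarith
    field_simp
  set t := η * (A - ρ.re) with ht
  have ht0 : 0 < t := mul_pos hη0 (by linarith)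
  have ht1 : t ≤ 1 / 2 := by
    rw [ht, ← hηA]
    exact mul_le_mul_of_nonneg_left (by linarith) hη0.le
  have htN : t ≤ η * N := mul_le_mul_of_nonneg_left hreN hη0.le
  set a := A - t with ha
  obtain ⟨haB, hn1, hn2, D, r₄, hD, hr₄, htail⟩ := hnum B C a hB hC (by linarith)
  have ha0 : 0 < a := hB.trans haB
  set s : ℂ := A + η * (ρ - A) with hs
  have hsre : s.re = a := by
    simp [hs, ha, ht]; ring
  have hsρ : ‖s - ρ‖ = (1 - η) * N := by
    have : s - ρ = ((1 - η : ℝ) : ℂ) * -(ρ - A) := by simp [hs]; ring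
    rw [this, norm_mul, norm_neg, Complex.norm_real, Real.norm_of_nonneg (by linarith)]
  set r₁ := (1 - η) * N with hr₁
  have hr₁0 : 0 < r₁ := mul_pos (by linarith) hNpos
  have hr₁a' : r₁ < a - θ := by rw [hr₁, ha]; linarith
  have hr₁a : r₁ < a := by linarith
  obtain ⟨m, g, hm, hg, hgρ, hfac⟩ := exists_entire_factor hE hEA hρ
  have hρ0 : ρ ≠ 0 := by
    rintro rfl; simp at hβθ; linarith
  have havoid : ∀ z ∈ Metric.closedBall s r₁, g z ≠ 0 ∧ z ≠ 0 ∧ z ≠ θ := by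
    intro z hz
    rw [mem_closedBall_iff_norm] at hz
    have hz' : a - z.re ≤ r₁ := by
      have h3 : (s - z).re ≤ ‖s - z‖ := Complex.re_le_norm _
      rw [norm_sub_rev] at hz
      rw [Complex.sub_re, hsre] at h3
      linarith
    refine ⟨fun h ↦ ?_, ?_, ?_⟩
    · have hEz : E z = 0 := by rw [hfac, h, mul_zero]
      have := eq_of_norm_sub_smul_le hη0 hη1 (hnear z hEz)
        (v := z - A) (w := ρ - A) (by
          rw [show z - A - η * (ρ - A) = z - s by rw [hs]; ring]; exact hz)
      rw [sub_left_inj] at this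
      rw [this] at h
      exact hgρ h
    · rintro rfl; simp at hz'; linarith
    · rintro rfl; simp at hz'; linarith
  set F : ℂ → ℂ := fun s ↦ -(deriv E s / E s) / (2 * s) - d / s + 1 / (s - θ) with hFdef
  set c : ℂ := -(m / (2 * ρ)) with hc
  have hc0 : c ≠ 0 := by
    rw [hc, neg_ne_zero]
    exact div_ne_zero (by exact_mod_cast hm) (mul_ne_zero two_ne_zero hρ0)
  set R : ℂ → ℂ := fun z ↦ -(deriv g z / g z) / (2 * z) + (m / (2 * ρ) - d) / z + 1 / (z - θ)
    with hR
  have hUo : IsOpen {z : ℂ | g z ≠ 0 ∧ z ≠ 0 ∧ z ≠ θ} :=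
    (isOpen_ne_fun hg.continuous continuous_const).inter
      ((isOpen_ne_fun continuous_id continuous_const).inter
        (isOpen_ne_fun continuous_id continuous_const))
  obtain ⟨e, he0, he⟩ := (isCompact_closedBall s r₁).exists_thickening_subset_open hUo havoid
  rw [thickening_closedBall he0 hr₁0.le] at he
  have hdg : Differentiable ℂ (deriv g) := by
    intro z
    exact (hg.analyticAt z).deriv.differentiableAt
  have hRdiff : DifferentiableOn ℂ R (Metric.ball s (e + r₁)) := by
    intro z hz
    obtain ⟨h1, h2, h3⟩ := he hz
    have h3' : z - θ ≠ 0 := sub_ne_zero.2 h3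
    have h2' : 2 * z ≠ 0 := mul_ne_zero two_ne_zero h2
    refine DifferentiableAt.differentiableWithinAt ?_
    have hgz := hg z
    have hdgz := hdg z
    have i1 : DifferentiableAt ℂ (fun z ↦ deriv g z / g z) z := hdgz.div hgz h1
    have i2 : DifferentiableAt ℂ (fun z ↦ -(deriv g z / g z) / (2 * z)) z :=
      i1.neg.div (by fun_prop) h2'
    have i3 : DifferentiableAt ℂ (fun z ↦ (m / (2 * ρ) - d) / z) z :=
      (differentiableAt_const _).div differentiableAt_id h2
    have i4 : DifferentiableAt ℂ (fun z : ℂ ↦ 1 / (z - θ)) z :=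
      (differentiableAt_const _).div (by fun_prop) h3'
    exact (i2.add i3).add i4
  have hlog : ∀ z, z ≠ ρ → g z ≠ 0 → deriv E z / E z = m / (z - ρ) + deriv g z / g z := by
    intro z hz hgz
    have hzρ := sub_ne_zero.2 hz
    have hd1 : HasDerivAt (fun z ↦ (z - ρ) ^ m * g z)
        (m * (z - ρ) ^ (m - 1) * 1 * g z + (z - ρ) ^ m * deriv g z) z :=
      (((hasDerivAt_id z).sub_const ρ).pow m).mul (hg z).hasDerivAt
    have hEeq : E = fun z ↦ (z - ρ) ^ m * g z := funext hfac
    rw [hEeq, hd1.deriv]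
    obtain ⟨n, rfl⟩ := Nat.exists_eq_succ_of_ne_zero hm
    simp only [Nat.succ_eq_add_one, Nat.add_sub_cancel, pow_succ]
    field_simp
  have hFR : F =ᶠ[nhds s] fun z ↦ c / (z - ρ) + R z := by
    have hsne : s ≠ ρ := by
      rw [← sub_ne_zero, ← norm_pos_iff, hsρ]; exact hr₁0
    filter_upwards [hUo.mem_nhds (havoid s (Metric.mem_closedBall_self hr₁0.le)),
      isOpen_ne.mem_nhds hsne] with z hz hzρ
    obtain ⟨h1, h2, h3⟩ := hz
    have h3' : z - θ ≠ 0 := sub_ne_zero.2 h3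
    have h4 := sub_ne_zero.2 hzρ
    simp only [hFdef, hR, hc]
    rw [hlog z hzρ h1]
    field_simp
    ring
  have hdr : r₁ < e + r₁ := by linarith
  refine ⟨a, ha0, ?_⟩
  by_cases him : ρ.im = 0
  · have hρre : ρ = (ρ.re : ℂ) := Complex.ext (by simp) (by simp [him])
    have hsa : s = (a : ℂ) := by
      apply Complex.ext
      · simpa using hsre
      · simp [hs, him]
    obtain ⟨M, hM0, hM⟩ := exists_iteratedDeriv_bound (r := (r₁ + (e + r₁)) / 2) (by linarith)
      (by linarith) hRdiff
    refine eventually_exists_neg_of_pole hK hC hKC hL ha0 haB hδ0 hn1 hn2 hr₄ htail hsre hr₁0 hsρ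
      hr₁a hc0 hFR hdr hRdiff (M' := M) (r' := (r₁ + (e + r₁)) / 2) (by linarith) fun k ↦ ?_
    rw [← hsa, EventuallyEq.iteratedDeriv_eq k hFR]
    have hsρ0 : s - ρ ≠ 0 := norm_pos_iff.1 (by rw [hsρ]; exact hr₁0)
    have hRan : ContDiffAt ℂ k R s :=
      (hRdiff.analyticAt (Metric.ball_mem_nhds s (by linarith))).contDiffAt
    have hcan : ContDiffAt ℂ k (fun z ↦ c / (z - ρ)) s :=
      contDiffAt_const.div (contDiffAt_id.sub contDiffAt_const) hsρ0
    rw [iteratedDeriv_fun_add hcan hRan, iteratedDeriv_const_div_sub, mul_add, Complex.add_re]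
    have hm1 : ((-1 : ℂ) ^ k) * (-1) ^ k = 1 := by rw [← mul_pow]; simp
    have hneg : ((-1) ^ k * (c * ((-1) ^ k * k.factorial / (s - ρ) ^ (k + 1)))).re ≤ 0 := by
      have : (-1) ^ k * (c * ((-1) ^ k * k.factorial / (s - ρ) ^ (k + 1))) =
          ((-(m / (2 * ρ.re) * (k.factorial / (a - ρ.re) ^ (k + 1))) : ℝ) : ℂ) := by
        have e1 : (-1) ^ k * (c * ((-1) ^ k * k.factorial / (s - ρ) ^ (k + 1))) =
            ((-1 : ℂ) ^ k * (-1) ^ k) * (c * (k.factorial / (s - ρ) ^ (k + 1))) := by ring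
        rw [e1, hm1, one_mul, hc, hsa]
        push_cast
        rw [← hρre]
        ring
      rw [this, Complex.ofReal_re, neg_nonpos]
      have h5 : 0 < a - ρ.re := by linarith
      have h6 : 0 < ρ.re := by linarith
      positivity
    have hle : ((-1) ^ k * iteratedDeriv k R s).re ≤ ‖iteratedDeriv k R s‖ := by
      refine (Complex.re_le_norm _).trans ?_
      simp
    linarith [hM k]
  · have hlt : A - ρ.re < N := by
      have h3 : |(ρ - A).re| < ‖ρ - A‖ := by
        rw [Complex.abs_re_lt_norm]; simpa using him
      have := (abs_lt.1 h3).1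
      simp at this
      linarith
    have hlt2 : r₁ < N - t := by
      have : t < η * N := mul_lt_mul_of_pos_left hlt hη0
      rw [hr₁]; linarith
    have hFdiff : DifferentiableOn ℂ F (Metric.ball (a : ℂ) (N - t)) := by
      intro z hz
      rw [mem_ball_iff_norm] at hz
      have hzre : a - z.re < N - t := by
        have h3 : (a - z).re ≤ ‖(a : ℂ) - z‖ := Complex.re_le_norm _
        rw [norm_sub_rev] at hz
        rw [Complex.sub_re, Complex.ofReal_re] at h3
        linarith
      have h1 : E z ≠ 0 := by
        intro h
        have h4 := hnear z h
        have h5 : ‖z - A‖ ≤ ‖z - a‖ + ‖(a : ℂ) - A‖ := norm_sub_le_norm_sub_add_norm_sub _ _ _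
        have h6 : ‖(a : ℂ) - A‖ = t := by
          rw [← Complex.ofReal_sub, Complex.norm_real, ha]
          simp [abs_of_pos ht0]
        linarith
      have h2 : z ≠ 0 := by
        rintro rfl; simp at hzre; linarith
      have h3 : z ≠ θ := by
        rintro rfl; simp at hzre; linarith
      have h3' : z - θ ≠ 0 := sub_ne_zero.2 h3
      have h2' : 2 * z ≠ 0 := mul_ne_zero two_ne_zero h2
      refine DifferentiableAt.differentiableWithinAt ?_
      have i1 : DifferentiableAt ℂ (fun z ↦ deriv E z / E z) z :=
        (hE.analyticAt z).deriv.differentiableAt.div (hE z) h1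
      have i2 : DifferentiableAt ℂ (fun z ↦ -(deriv E z / E z) / (2 * z)) z :=
        i1.neg.div (by fun_prop) h2'
      have i3 : DifferentiableAt ℂ (fun z ↦ d / z) z :=
        (differentiableAt_const _).div differentiableAt_id h2
      have i4 : DifferentiableAt ℂ (fun z : ℂ ↦ 1 / (z - θ)) z :=
        (differentiableAt_const _).div (by fun_prop) h3'
      exact (i2.sub i3).add i4
    obtain ⟨M, hM0, hM⟩ := exists_iteratedDeriv_bound (r := (r₁ + (N - t)) / 2) (by linarith)
      (by linarith) hFdiff
    refine eventually_exists_neg_of_pole hK hC hKC hL ha0 haB hδ0 hn1 hn2 hr₄ htail hsre hr₁0 hsρ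
      hr₁a hc0 hFR hdr hRdiff (M' := M) (r' := (r₁ + (N - t)) / 2) (by linarith) fun k ↦ ?_
    refine ((Complex.re_le_norm _).trans ?_).trans (hM k)
    rw [norm_mul, norm_pow, norm_neg, norm_one, one_pow, one_mul]

open MeasureTheory Set in
lemma exists_neg_in_window {K : ℝ → ℝ} (hK : Measurable K) {B C : ℝ} (hB : 0 < B) (hC : 0 ≤ C)
    (hKC : ∀ u, 0 < u → |K u| ≤ C * rexp (B * u)) {E : ℂ → ℂ} (hE : Differentiable ℂ E)
    (hE0 : ∀ s : ℂ, B < s.re → E s ≠ 0) {θ : ℝ} (hθ : 0 < θ) (d : ℂ)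
    (hL : ∀ s : ℂ, B < s.re → ∫ u in Ioi (0 : ℝ), (K u : ℂ) * cexp (-s * u) =
      -(deriv E s / E s) / (2 * s) - d / s + 1 / (s - θ))
    {ρ' : ℂ} (hρ' : E ρ' = 0) (hρ'θ : θ < ρ'.re) {ε : ℝ} (hε0 : 0 < ε) (hε1 : ε < 1) :
    ∃ U₀ : ℝ, ∀ U : ℝ, U₀ ≤ U → ∃ u, (1 - ε) * U ≤ u ∧ u ≤ U ∧ K u < 0 := by
  obtain ⟨a, ha, hev⟩ := exists_neg_near_peak hK hB hC hKC hE hE0 hθ d hL hρ' hρ'θ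
    (δ := ε / 4) (by linarith) (by linarith)
  obtain ⟨k₀, hk₀⟩ := eventually_atTop.1 hev
  refine ⟨max (8 / (ε * a)) ((k₀ + 1) / (a * (1 - ε / 2))), fun U hU ↦ ?_⟩
  have hU1 : 8 / (ε * a) ≤ U := (le_max_left _ _).trans hU
  have hU2 : (k₀ + 1) / (a * (1 - ε / 2)) ≤ U := (le_max_right _ _).trans hU
  have h1 : 0 < 1 - ε / 2 := by linarith
  have hU0 : 0 < U := lt_of_lt_of_le (by positivity) hU1
  rw [div_le_iff₀ (by positivity)] at hU1 hU2
  set y := a * (1 - ε / 2) * U with hy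
  have hy0 : 0 ≤ y := by positivity
  have hf1 := Nat.floor_le hy0
  have hf2 := Nat.lt_floor_add_one y
  obtain ⟨u, hu1, hu2, hu3⟩ := hk₀ ⌊y⌋₊ (Nat.le_floor (by linarith))
  set k : ℝ := (⌊y⌋₊ : ℝ) with hk
  refine ⟨u, le_trans ?_ hu1, hu2.trans ?_, hu3⟩
  · have h3 : (1 - ε / 2) * U - 1 / a ≤ k / a := by
      have : (1 - ε / 2) * U - 1 / a = (y - 1) / a := by rw [hy]; field_simp
      rw [this]
      gcongr
      linarith
    have h4 : 1 / a ≤ ε / 8 * U := by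
      rw [div_le_iff₀ ha]; linarith
    have h5 := mul_le_mul_of_nonneg_left h3 (show 0 ≤ 1 - ε / 4 by linarith)
    nlinarith [mul_pos hε0 hU0, mul_pos (mul_pos hε0 hε0) hU0]
  · have h3 : k / a ≤ (1 - ε / 2) * U := by
      have : (1 - ε / 2) * U = y / a := by rw [hy]; field_simp
      rw [this]
      gcongr
    have h5 := mul_le_mul_of_nonneg_left h3 (show 0 ≤ 1 + ε / 4 by linarith)
    nlinarith [mul_pos hε0 hU0, mul_pos (mul_pos hε0 hε0) hU0]

lemma exists_log_of_entire_ne_zero {H : ℂ → ℂ} (hH : Differentiable ℂ H) (h0 : ∀ z, H z ≠ 0) :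
    ∃ g : ℂ → ℂ, Differentiable ℂ g ∧ ∀ z, H z = cexp (g z) := by
  have hdH : Differentiable ℂ (deriv H) := fun z ↦ (hH.analyticAt z).deriv.differentiableAt
  have hφ : Differentiable ℂ (fun z ↦ deriv H z / H z) := fun z ↦ (hdH z).div (hH z) (h0 z)
  obtain ⟨g, hg0, hg⟩ := ((IsConservativeOn.isExactOn_univ hφ.continuous
    hφ.differentiableOn.isConservativeOn).with_val_at 0 (Complex.log (H 0)))
  have hg' : ∀ z, HasDerivAt g (deriv H z / H z) z := fun z ↦ hg z (Set.mem_univ z)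
  have hgd : Differentiable ℂ g := fun z ↦ (hg' z).differentiableAt
  refine ⟨g, hgd, fun z ↦ ?_⟩
  have hq : ∀ z, HasDerivAt (fun z ↦ H z * cexp (-g z)) 0 z := by
    intro z
    have h1 := (hH z).hasDerivAt.mul (hg' z).neg.cexp
    have h2 := h0 z
    convert! h1 using 1
    field_simp
    ring
  have hconst := is_const_of_deriv_eq_zero (fun z ↦ (hq z).differentiableAt)
    (fun z ↦ (hq z).deriv) z 0
  simp only [hg0, Complex.exp_neg, Complex.exp_log (h0 0)] at hconst
  rw [mul_inv_cancel₀ (h0 0)] at hconst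
  field_simp [Complex.exp_ne_zero] at hconst
  exact hconst

/-- An entire function without zeros which grows at most like `exp o(r²)` is of the form
`A exp (b z)`. -/
lemma eq_mul_exp_of_ne_zero_of_growth {H : ℂ → ℂ} (hH : Differentiable ℂ H) (h0 : ∀ z, H z ≠ 0)
    {M : ℕ → ℝ} (hM : Tendsto (fun n ↦ M n / (n : ℝ) ^ 2) atTop (nhds 0))
    (hHM : ∀ (n : ℕ) (z : ℂ), ‖z‖ ≤ n → ‖H z‖ ≤ rexp (M n)) :
    ∃ b : ℂ, ∀ z, H z = H 0 * cexp (b * z) := by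
  obtain ⟨g, hg, hHg⟩ := exists_log_of_entire_ne_zero hH h0
  have hre : ∀ (n : ℕ) (z : ℂ), ‖z‖ ≤ n → (g z).re ≤ M n := by
    intro n z hz
    have := hHM n z hz
    rwa [hHg, Complex.norm_exp, Real.exp_le_exp] at this
  have hbound : ∀ (n : ℕ), 0 < n → ∀ z : ℂ, ‖z‖ ≤ n / 2 →
      ‖g z‖ ≤ 2 * (|M n| + 1) + 3 * ‖g 0‖ := by
    intro n hn z hz
    have hn0 : (0 : ℝ) < n := by exact_mod_cast hn
    have hbc := Complex.borelCaratheodory (f := g) (M := |M n| + 1) (R := n) (z := z)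
      (by positivity) hg.differentiableOn
      (fun w hw ↦ by
        rw [mem_ball_zero_iff] at hw
        have h1 := hre n w hw.le
        have h2 := le_abs_self (M n)
        show (g w).re ≤ |M n| + 1
        linarith) hn0
      (by rw [mem_ball_zero_iff]; linarith)
    refine hbc.trans ?_
    have hd : (0 : ℝ) < n - ‖z‖ := by linarith
    have e1 : 2 * (|M n| + 1) * ‖z‖ / (n - ‖z‖) ≤ 2 * (|M n| + 1) := by
      rw [div_le_iff₀ hd]
      gcongr
      linarith
    have e2 : ‖g 0‖ * (n + ‖z‖) / (n - ‖z‖) ≤ 3 * ‖g 0‖ := by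
      rw [div_le_iff₀ hd]
      nlinarith [norm_nonneg (g 0), norm_nonneg z]
    linarith
  have hsec : ∀ z, iteratedDeriv 2 g z = 0 := by
    intro z
    have hev : ∀ᶠ n : ℕ in atTop, ‖iteratedDeriv 2 g z‖ ≤
        32 * (2 * (|M n / (n : ℝ) ^ 2| + 1 / (n : ℝ) ^ 2) + 3 * ‖g 0‖ * (1 / (n : ℝ) ^ 2)) := by
      filter_upwards [eventually_gt_atTop 0, eventually_ge_atTop ⌈4 * ‖z‖⌉₊] with n hn hnz
      have hn0 : (0 : ℝ) < n := by exact_mod_cast hn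
      have hz4 : 4 * ‖z‖ ≤ n := Nat.ceil_le.1 hnz
      have := Complex.norm_iteratedDeriv_le_of_forall_mem_sphere_norm_le (c := z) (R := n / 4)
        (C := 2 * (|M n| + 1) + 3 * ‖g 0‖) 2 (by positivity) (hg.diffContOnCl)
        (fun w hw ↦ hbound n hn w (by
          have h1 : ‖w - z‖ = n / 4 := by simpa [dist_eq_norm] using hw
          have h2 : ‖w‖ ≤ ‖w - z‖ + ‖z‖ := by simpa using norm_add_le (w - z) z
          linarith))
      refine this.trans (le_of_eq ?_)
      rw [abs_div, abs_of_nonneg (show (0 : ℝ) ≤ (n : ℝ) ^ 2 by positivity)]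
      simp [Nat.factorial]
      field_simp
      ring
    have hinv : Tendsto (fun n : ℕ ↦ 1 / (n : ℝ) ^ 2) atTop (nhds 0) :=
      tendsto_const_div_pow 1 2 two_ne_zero
    have hlim : Tendsto (fun n : ℕ ↦ 32 * (2 * (|M n / (n : ℝ) ^ 2| + 1 / (n : ℝ) ^ 2) +
        3 * ‖g 0‖ * (1 / (n : ℝ) ^ 2))) atTop
        (nhds (32 * (2 * (|0| + 0) + 3 * ‖g 0‖ * 0))) :=
      (((hM.abs.add hinv).const_mul 2).add (hinv.const_mul _)).const_mul 32
    have := ge_of_tendsto hlim hev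
    simpa using this
  have hdg : Differentiable ℂ (deriv g) := fun z ↦ (hg.analyticAt z).deriv.differentiableAt
  have hdconst : ∀ z, deriv g z = deriv g 0 := fun z ↦
    is_const_of_deriv_eq_zero hdg (fun w ↦ by
      have := hsec w
      rwa [iteratedDeriv_succ, iteratedDeriv_one] at this) z 0
  have hlin : ∀ z, g z - deriv g 0 * z = g 0 - deriv g 0 * 0 := fun z ↦
    is_const_of_deriv_eq_zero (f := fun z ↦ g z - deriv g 0 * z) (by fun_prop) (fun w ↦ by
      have h1 : HasDerivAt (fun z ↦ g z - deriv g 0 * z) (deriv g w - deriv g 0 * 1) w :=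
        (hg w).hasDerivAt.sub ((hasDerivAt_id w).const_mul _)
      rw [h1.deriv, hdconst w]
      simp) z 0
  refine ⟨deriv g 0, fun z ↦ ?_⟩
  rw [hHg z, hHg 0, ← Complex.exp_add]
  congr 1
  have := hlin z
  linear_combination this

/-- Growth at most like that of the factorial function, up to exponential factors. -/
def HasFactorialGrowth (f : ℂ → ℂ) : Prop :=
  ∃ C Q : ℝ, 0 ≤ C ∧ 1 ≤ Q ∧ ∀ (n : ℕ) (s : ℂ), ‖s‖ ≤ n → ‖f s‖ ≤ C * Q ^ n * n.factorial

namespace HasFactorialGrowth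

lemma add {f g : ℂ → ℂ} (hf : HasFactorialGrowth f) (hg : HasFactorialGrowth g) :
    HasFactorialGrowth (fun s ↦ f s + g s) := by
  obtain ⟨C, Q, hC, hQ, h⟩ := hf
  obtain ⟨C', Q', hC', hQ', h'⟩ := hg
  refine ⟨C + C', Q * Q', by positivity, one_le_mul_of_one_le_of_one_le hQ hQ', fun n s hs ↦ ?_⟩
  have e1 : Q ^ n ≤ (Q * Q') ^ n := by
    gcongr; nlinarith
  have e2 : Q' ^ n ≤ (Q * Q') ^ n := by
    gcongr; nlinarith
  calc ‖f s + g s‖ ≤ ‖f s‖ + ‖g s‖ := norm_add_le _ _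
    _ ≤ C * Q ^ n * n.factorial + C' * Q' ^ n * n.factorial := add_le_add (h n s hs) (h' n s hs)
    _ ≤ C * (Q * Q') ^ n * n.factorial + C' * (Q * Q') ^ n * n.factorial := by gcongr
    _ = _ := by ring

lemma mul_of_exp_bound {f g : ℂ → ℂ} (hf : HasFactorialGrowth f) {C' Q' : ℝ} (hC' : 0 ≤ C')
    (hQ' : 1 ≤ Q') (hg : ∀ (n : ℕ) (s : ℂ), ‖s‖ ≤ n → ‖g s‖ ≤ C' * Q' ^ n) :
    HasFactorialGrowth (fun s ↦ g s * f s) := by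
  obtain ⟨C, Q, hC, hQ, h⟩ := hf
  refine ⟨C' * C, Q' * Q, by positivity, one_le_mul_of_one_le_of_one_le hQ' hQ, fun n s hs ↦ ?_⟩
  rw [norm_mul]
  calc ‖g s‖ * ‖f s‖ ≤ (C' * Q' ^ n) * (C * Q ^ n * n.factorial) := by
        gcongr
        · exact hg n s hs
        · exact h n s hs
    _ = _ := by rw [mul_pow]; ring

lemma const_mul {f : ℂ → ℂ} (hf : HasFactorialGrowth f) (c : ℂ) :
    HasFactorialGrowth (fun s ↦ c * f s) :=
  hf.mul_of_exp_bound (norm_nonneg c) le_rfl (by simp)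

lemma const (c : ℂ) : HasFactorialGrowth (fun _ ↦ c) := by
  refine ⟨‖c‖, 1, norm_nonneg c, le_rfl, fun n s _ ↦ ?_⟩
  have : (1 : ℝ) ≤ n.factorial := by exact_mod_cast n.factorial_pos
  simpa using le_mul_of_one_le_right (norm_nonneg c) this

lemma sum {ι : Type*} {f : ι → ℂ → ℂ} (t : Finset ι) (hf : ∀ i ∈ t, HasFactorialGrowth (f i)) :
    HasFactorialGrowth (fun s ↦ ∑ i ∈ t, f i s) := by
  induction t using Finset.induction_on with
  | empty => simpa using const 0
  | insert i t hi ih =>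
    simp only [Finset.sum_insert hi]
    exact (hf i (by simp)).add (ih fun j hj ↦ hf j (by simp [hj]))

lemma comp_of_norm_le {f : ℂ → ℂ} (hf : HasFactorialGrowth f) {g : ℂ → ℂ}
    (hg : ∀ s, ‖g s‖ ≤ ‖s‖ + 1) : HasFactorialGrowth (fun s ↦ f (g s)) := by
  obtain ⟨C, Q, hC, hQ, h⟩ := hf
  refine ⟨C * Q, 2 * Q, by positivity, by linarith, fun n s hs ↦ ?_⟩
  have h1 := h (n + 1) (g s) (by push_cast; linarith [hg s])
  refine h1.trans ?_
  have h2 : ((n : ℝ) + 1) ≤ 2 ^ n := by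
    exact_mod_cast Nat.lt_two_pow_self
  rw [Nat.factorial_succ]
  push_cast
  calc C * Q ^ (n + 1) * ((n + 1) * n.factorial) ≤ C * Q ^ (n + 1) * (2 ^ n * n.factorial) := by
        gcongr
    _ = _ := by rw [mul_pow]; ring

/-- A zero-free entire function of at most factorial growth is `A exp (b z)`. -/
lemma eq_mul_exp {H : ℂ → ℂ} (hf : HasFactorialGrowth H) (hH : Differentiable ℂ H)
    (h0 : ∀ z, H z ≠ 0) : ∃ b : ℂ, ∀ z, H z = H 0 * cexp (b * z) := by
  obtain ⟨C, Q, hC, hQ, h⟩ := hf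
  refine eq_mul_exp_of_ne_zero_of_growth hH h0 (M := fun n ↦ C + n * Real.log Q + n * Real.log n)
    ?_ fun n z hz ↦ (h n z hz).trans ?_
  · have hlog : Tendsto (fun n : ℕ ↦ Real.log n / n) atTop (nhds 0) :=
      (Real.isLittleO_log_id_atTop.tendsto_div_nhds_zero).comp tendsto_natCast_atTop_atTop
    have hinv2 : Tendsto (fun n : ℕ ↦ C / (n : ℝ) ^ 2) atTop (nhds 0) :=
      tendsto_const_div_pow C 2 two_ne_zero
    have hinv : Tendsto (fun n : ℕ ↦ Real.log Q / (n : ℝ)) atTop (nhds 0) :=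
      tendsto_const_div_atTop_nhds_zero_nat _
    have := (hinv2.add hinv).add hlog
    simp only [add_zero] at this
    refine this.congr' ?_
    filter_upwards [eventually_gt_atTop 0] with n hn
    have hn0 : (0 : ℝ) < n := by exact_mod_cast hn
    field_simp
  · have hQ0 : 0 < Q := by linarith
    rw [Real.exp_add, Real.exp_add]
    have e1 : C ≤ rexp C := by linarith [Real.add_one_le_exp C]
    have e2 : Q ^ n = rexp (n * Real.log Q) := by
      rw [Real.exp_nat_mul, Real.exp_log hQ0]
    have e3 : (n.factorial : ℝ) ≤ rexp (n * Real.log n) := by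
      rcases Nat.eq_zero_or_pos n with rfl | hn
      · simp
      · rw [Real.exp_nat_mul, Real.exp_log (by exact_mod_cast hn)]
        exact_mod_cast Nat.factorial_le_pow n
    rw [← e2]
    gcongr

end HasFactorialGrowth

open MeasureTheory Set in
lemma WeakFEPair.exists_norm_Λ₀_le_of_re_nonneg (P : WeakFEPair ℂ) {p : ℝ} (hp : 0 < p)
    (hf : (fun x ↦ P.f x - P.f₀) =O[atTop] fun x ↦ rexp (-p * x)) :
    ∃ C Q : ℝ, 0 ≤ C ∧ 1 ≤ Q ∧ ∀ (n : ℕ) (s : ℂ), 0 ≤ s.re → s.re ≤ n + 1 →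
      ‖P.Λ₀ s‖ ≤ C * Q ^ n * n.factorial := by
  set h := P.f_modif with hh
  have hloc : LocallyIntegrableOn h (Ioi 0) := P.hf_modif_int
  have htop : h =O[atTop] fun x ↦ rexp (-p * x) := by
    refine EventuallyEq.trans_isBigO ?_ hf
    filter_upwards [eventually_gt_atTop 1] with x hx
    simp [hh, WeakFEPair.f_modif, mem_Ioi.mpr hx, notMem_Ioo_of_ge hx.le]
  have hint : ∀ s : ℂ, IntegrableOn (fun t : ℝ ↦ (t : ℂ) ^ (s - 1) • h t) (Ioi 0) := fun s ↦
    (P.isStrongFEPair_toStrongFEPair.hasMellin s).1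
  have hintn : ∀ s : ℂ, IntegrableOn (fun t : ℝ ↦ ‖(t : ℂ) ^ (s - 1) • h t‖) (Ioi 0) := fun s ↦
    (hint s).norm
  have i1 : IntegrableOn (fun t : ℝ ↦ ‖h t‖ * rexp (p / 2 * t)) (Ici 1) := by
    have hl : LocallyIntegrableOn (fun t : ℝ ↦ ‖h t‖ * rexp (p / 2 * t)) (Ici 1) := by
      have h1 : LocallyIntegrableOn (fun t ↦ ‖h t‖) (Ici 1) :=
        (hloc.mono_set (fun x (hx : 1 ≤ x) ↦ lt_of_lt_of_le one_pos hx)).norm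
      exact h1.mul_continuousOn (by fun_prop) isClosed_Ici.isLocallyClosed
    refine hl.integrableOn_of_isBigO_atTop (g := fun t ↦ rexp (-(p / 2) * t)) ?_
      ⟨Ioi 0, Ioi_mem_atTop 0, exp_neg_integrableOn_Ioi 0 (by positivity)⟩
    have := htop.norm_left.mul (Asymptotics.isBigO_refl (fun t ↦ rexp (p / 2 * t)) atTop)
    refine this.congr_right fun t ↦ ?_
    rw [← Real.exp_add]
    congr 1
    ring
  set A := ∫ t in Ioi (0 : ℝ), ‖(t : ℂ) ^ ((0 : ℂ) - 1) • h t‖ with hA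
  set D := ∫ t in Ici (1 : ℝ), ‖h t‖ * rexp (p / 2 * t) with hD
  have hA0 : 0 ≤ A := setIntegral_nonneg measurableSet_Ioi fun t _ ↦ norm_nonneg _
  have hD0 : 0 ≤ D := setIntegral_nonneg measurableSet_Ici fun t _ ↦ by positivity
  refine ⟨A + D, max 1 (2 / p), by positivity, le_max_left _ _, fun n s hs0 hsn ↦ ?_⟩
  set Q := max 1 (2 / p) with hQ
  have hQ1 : 1 ≤ Q := le_max_left _ _
  have hfac : (1 : ℝ) ≤ n.factorial := by exact_mod_cast n.factorial_pos
  have hQn : 1 ≤ Q ^ n := one_le_pow₀ hQ1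
  have hcoef : 1 ≤ Q ^ n * n.factorial := one_le_mul_of_one_le_of_one_le hQn hfac
  have hnorm : ∀ (w : ℂ) (t : ℝ), 0 < t → ‖(t : ℂ) ^ (w - 1) • h t‖ = t ^ (w.re - 1) * ‖h t‖ := by
    intro w t ht
    rw [norm_smul, Complex.norm_cpow_eq_rpow_re_of_pos ht]
    simp
  have hunion : Ioi (0 : ℝ) = Ioo 0 1 ∪ Ici 1 := (Ioo_union_Ici_eq_Ioi one_pos).symm
  have hsub1 : Ioo (0 : ℝ) 1 ⊆ Ioi 0 := fun x hx ↦ hx.1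
  have hsub2 : Ici (1 : ℝ) ⊆ Ioi 0 := fun x (hx : 1 ≤ x) ↦ lt_of_lt_of_le one_pos hx
  have b1 : ∫ t in Ioo (0 : ℝ) 1, ‖(t : ℂ) ^ (s - 1) • h t‖ ≤ A := by
    calc _ ≤ ∫ t in Ioo (0 : ℝ) 1, ‖(t : ℂ) ^ ((0 : ℂ) - 1) • h t‖ := by
          refine setIntegral_mono_on ((hintn s).mono_set hsub1) ((hintn 0).mono_set hsub1)
            measurableSet_Ioo fun t ht ↦ ?_
          rw [hnorm s t ht.1, hnorm 0 t ht.1]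
          gcongr ?_ * _
          exact Real.rpow_le_rpow_of_exponent_ge ht.1 ht.2.le (by simpa using hs0)
      _ ≤ A := setIntegral_mono_set (hintn 0) (ae_of_all _ fun t ↦ norm_nonneg _)
          (LE.le.eventuallyLE hsub1)
  have b2 : ∫ t in Ici (1 : ℝ), ‖(t : ℂ) ^ (s - 1) • h t‖ ≤ Q ^ n * n.factorial * D := by
    rw [hD, ← integral_const_mul]
    refine setIntegral_mono_on ((hintn s).mono_set hsub2) (i1.const_mul _)
      measurableSet_Ici fun t ht ↦ ?_
    have ht1 : 1 ≤ t := ht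
    have ht0 : 0 < t := by linarith
    rw [hnorm s t ht0]
    have e1 : t ^ (s.re - 1) ≤ t ^ n := by
      rw [← Real.rpow_natCast]
      exact Real.rpow_le_rpow_of_exponent_le ht1 (by linarith)
    have e2 : t ^ n ≤ (2 / p) ^ n * n.factorial * rexp (p / 2 * t) := by
      have := Real.pow_div_factorial_le_exp (p / 2 * t) (by positivity) n
      rw [div_le_iff₀ (by positivity)] at this
      calc t ^ n = (2 / p) ^ n * (p / 2 * t) ^ n := by
            rw [← mul_pow]; congr 1; field_simp
        _ ≤ (2 / p) ^ n * (rexp (p / 2 * t) * n.factorial) := by gcongr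
        _ = _ := by ring
    have e3 : (2 / p) ^ n ≤ Q ^ n := by
      gcongr
      exact le_max_right _ _
    calc t ^ (s.re - 1) * ‖h t‖ ≤ ((2 / p) ^ n * n.factorial * rexp (p / 2 * t)) * ‖h t‖ := by
          gcongr
          exact e1.trans e2
      _ ≤ (Q ^ n * n.factorial * rexp (p / 2 * t)) * ‖h t‖ := by gcongr
      _ = _ := by ring
  have hΛ : P.Λ₀ s = ∫ t in Ioi (0 : ℝ), (t : ℂ) ^ (s - 1) • h t := rfl
  rw [hΛ]
  refine (norm_integral_le_integral_norm _).trans ?_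
  rw [hunion, setIntegral_union (by
      rw [Set.disjoint_left]; intro x hx hx'; exact absurd hx.2 (not_lt.2 hx')) measurableSet_Ici
    ((hintn s).mono_set hsub1) ((hintn s).mono_set hsub2)]
  have : A ≤ Q ^ n * n.factorial * A := le_mul_of_one_le_left hA0 hcoef
  calc _ ≤ Q ^ n * n.factorial * A + Q ^ n * n.factorial * D := add_le_add (b1.trans this) b2
    _ = _ := by ring

lemma WeakFEPair.hasFactorialGrowth_Λ₀ (P : WeakFEPair ℂ) (hk : P.k ≤ 2) {p p' : ℝ} (hp : 0 < p)
    (hf : (fun x ↦ P.f x - P.f₀) =O[atTop] fun x ↦ rexp (-p * x)) (hp' : 0 < p')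
    (hg : (fun x ↦ P.g x - P.g₀) =O[atTop] fun x ↦ rexp (-p' * x)) :
    HasFactorialGrowth P.Λ₀ := by
  obtain ⟨C, Q, hC, hQ, h⟩ := P.exists_norm_Λ₀_le_of_re_nonneg hp hf
  obtain ⟨C', Q', hC', hQ', h'⟩ := P.symm.exists_norm_Λ₀_le_of_re_nonneg hp' hg
  have hk0 := P.hk
  refine ⟨C + ‖P.ε‖ * (C' * Q'), Q * (2 * Q'), by positivity, by nlinarith, fun n s hs ↦ ?_⟩
  have hre := (abs_le.1 ((Complex.abs_re_le_norm s).trans hs))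
  have hle1 : Q ^ n ≤ (Q * (2 * Q')) ^ n := pow_le_pow_left₀ (by positivity) (by nlinarith) n
  have hle2 : (2 * Q') ^ n ≤ (Q * (2 * Q')) ^ n := pow_le_pow_left₀ (by positivity) (by nlinarith) n
  rcases le_or_gt 0 s.re with h0 | h0
  · calc ‖P.Λ₀ s‖ ≤ C * Q ^ n * n.factorial := h n s h0 (by linarith)
      _ ≤ (C + ‖P.ε‖ * (C' * Q')) * (Q * (2 * Q')) ^ n * n.factorial := by
        gcongr
        have : 0 ≤ ‖P.ε‖ * (C' * Q') := by positivity
        linarith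
  · have hfe := P.functional_equation₀ (P.k - s)
    rw [sub_sub_cancel] at hfe
    rw [hfe, norm_smul]
    have h1 := h' (n + 1) (P.k - s) (by simp; linarith) (by simp; linarith)
    have h2 : ((n : ℝ) + 1) ≤ 2 ^ n := by exact_mod_cast Nat.lt_two_pow_self
    calc ‖P.ε‖ * ‖P.symm.Λ₀ (P.k - s)‖ ≤ ‖P.ε‖ * (C' * Q' ^ (n + 1) * (n + 1).factorial) := by
          gcongr
      _ = ‖P.ε‖ * (C' * Q') * (Q' ^ n * (n + 1)) * n.factorial := by
          rw [Nat.factorial_succ]; push_cast; ring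
      _ ≤ ‖P.ε‖ * (C' * Q') * (Q' ^ n * 2 ^ n) * n.factorial := by gcongr
      _ = ‖P.ε‖ * (C' * Q') * (2 * Q') ^ n * n.factorial := by rw [mul_pow 2]; ring
      _ ≤ (C + ‖P.ε‖ * (C' * Q')) * (Q * (2 * Q')) ^ n * n.factorial := by
        gcongr
        linarith

open HurwitzZeta in
lemma hasFactorialGrowth_completedHurwitzZetaEven₀ (a : UnitAddCircle) :
    HasFactorialGrowth (completedHurwitzZetaEven₀ a) := by
  obtain ⟨p, hp, hp'⟩ := isBigO_atTop_evenKernel_sub a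
  obtain ⟨r, hr, hr'⟩ := isBigO_atTop_cosKernel_sub a
  have hk : (hurwitzEvenFEPair a).k ≤ 2 := by
    show (1 / 2 : ℝ) ≤ 2
    norm_num
  have h := (hurwitzEvenFEPair a).hasFactorialGrowth_Λ₀ hk hp
    (by
      rw [← Asymptotics.isBigO_norm_left] at hp' ⊢
      refine hp'.congr_left fun x ↦ ?_
      rw [← Complex.norm_real]
      simp only [hurwitzEvenFEPair]
      split_ifs <;> simp) hr
    (by
      rw [← Asymptotics.isBigO_norm_left] at hr' ⊢
      refine hr'.congr_left fun x ↦ ?_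
      rw [← Complex.norm_real]
      simp [hurwitzEvenFEPair])
  have h2 := (h.comp_of_norm_le (g := fun s ↦ s / 2) (fun s ↦ by
    rw [norm_div, Complex.norm_ofNat]; linarith [norm_nonneg s])).const_mul (1 / 2)
  convert h2 using 2 with s
  rw [completedHurwitzZetaEven₀]
  ring

open HurwitzZeta in
lemma hasFactorialGrowth_completedHurwitzZetaOdd (a : UnitAddCircle) :
    HasFactorialGrowth (completedHurwitzZetaOdd a) := by
  obtain ⟨p, hp, hp'⟩ := isBigO_atTop_oddKernel a
  obtain ⟨r, hr, hr'⟩ := isBigO_atTop_sinKernel a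
  have hk : (hurwitzOddFEPair a).k ≤ 2 := by
    show (3 / 2 : ℝ) ≤ 2
    norm_num
  have h := (hurwitzOddFEPair a).hasFactorialGrowth_Λ₀ hk hp
    (by
      rw [← Asymptotics.isBigO_norm_left] at hp' ⊢
      refine hp'.congr_left fun x ↦ ?_
      rw [← Complex.norm_real]
      simp [hurwitzOddFEPair]) hr
    (by
      rw [← Asymptotics.isBigO_norm_left] at hr' ⊢
      refine hr'.congr_left fun x ↦ ?_
      rw [← Complex.norm_real]
      simp [hurwitzOddFEPair])
  have h2 := (h.comp_of_norm_le (g := fun s ↦ (s + 1) / 2) (fun s ↦ by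
    rw [norm_div, Complex.norm_ofNat]
    have := norm_add_le s 1
    simp at this
    linarith [norm_nonneg s])).const_mul (1 / 2)
  convert h2 using 2 with s
  rw [completedHurwitzZetaOdd, WeakFEPair.Λ]
  simp [hurwitzOddFEPair]
  ring

lemma false_of_gamma_growth_le_exp {H : ℂ → ℂ} {b : ℂ} (hH : ∀ z, H z = H 0 * cexp (b * z))
    {δ : ℝ} (hδ : δ ∈ Set.Icc (0 : ℝ) 1)
    (hlow : ∀ᶠ m : ℕ in atTop, (m.factorial : ℝ) / (2 * π ^ (m + 1)) ≤
      ‖H ((2 * (m + 1) - δ : ℝ) : ℂ)‖) : False := by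
  have hlim := (FloorSemiring.tendsto_pow_div_factorial_atTop (π * rexp (2 * ‖b‖))).const_mul
    (‖H 0‖ * rexp (2 * ‖b‖) * 2 * π)
  rw [mul_zero] at hlim
  obtain ⟨m, hm1, hm2⟩ := (hlow.and (hlim.eventually (gt_mem_nhds zero_lt_one))).exists
  have hf : (0 : ℝ) < m.factorial := by exact_mod_cast m.factorial_pos
  have hup : ‖H ((2 * (m + 1) - δ : ℝ) : ℂ)‖ ≤
      ‖H 0‖ * (rexp (2 * ‖b‖) ^ m * rexp (2 * ‖b‖)) := by
    rw [hH, norm_mul, Complex.norm_exp, ← Real.exp_nat_mul, ← Real.exp_add]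
    gcongr
    refine (Complex.re_le_norm _).trans ?_
    rw [norm_mul, Complex.norm_real, Real.norm_eq_abs, abs_of_nonneg
      (by have := hδ.2; have : (0 : ℝ) ≤ m := m.cast_nonneg; linarith)]
    nlinarith [norm_nonneg b, hδ.1]
  have h3 := hm1.trans hup
  rw [div_le_iff₀ (by positivity)] at h3
  rw [mul_div_assoc', div_lt_one hf, mul_pow] at hm2
  refine absurd h3 (not_le.mpr (lt_of_eq_of_lt ?_ hm2))
  ring

namespace DirichletCharacter

variable {N : ℕ} [NeZero N]

lemma eventually_half_le_norm_LFunction (χ : DirichletCharacter ℂ N) :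
    ∀ᶠ σ : ℝ in atTop, 1 / 2 ≤ ‖LFunction χ σ‖ := by
  have h := (LSeries.tendsto_atTop (f := fun n : ℕ ↦ χ n) (by
    rw [absicssaOfAbsConv_eq_one (NeZero.ne N) χ]
    exact EReal.coe_lt_top 1)).norm
  simp only [Nat.cast_one, map_one, norm_one] at h
  filter_upwards [h.eventually (lt_mem_nhds (show (1 / 2 : ℝ) < 1 by norm_num)),
    eventually_gt_atTop 1] with σ h1 h2
  rw [LFunction_eq_LSeries χ (by simpa using h2)]
  exact h1.le

lemma norm_Gammaℝ_two_mul_add (m : ℕ) :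
    ‖Gammaℝ (2 * (m + 1))‖ = m.factorial / π ^ (m + 1) := by
  rw [Gammaℝ_def, mul_div_cancel_left₀ _ two_ne_zero, Complex.Gamma_nat_eq_factorial, norm_mul,
    show (-(2 * ((m : ℂ) + 1)) / 2) = ((-(m + 1 : ℕ) : ℝ) : ℂ) by push_cast; ring,
    Complex.norm_cpow_eq_rpow_re_of_pos Real.pi_pos, Complex.ofReal_re, Real.rpow_neg Real.pi_pos.le,
    Real.rpow_natCast, Complex.norm_natCast]
  ring

lemma exists_zero_of_eq_mul_completedLFunction (χ : DirichletCharacter ℂ N) {H P : ℂ → ℂ}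
    (hH : Differentiable ℂ H) (hg : HasFactorialGrowth H)
    (hHP : ∀ s, s ≠ 0 → s ≠ 1 → H s = P s * completedLFunction χ s)
    (hP : ∀ σ : ℝ, 2 ≤ σ → 1 ≤ ‖P σ‖) : ∃ s, H s = 0 := by
  by_contra! h0
  obtain ⟨b, hb⟩ := hg.eq_mul_exp hH h0
  obtain ⟨δ, hδ, hγ⟩ : ∃ δ ∈ Set.Icc (0 : ℝ) 1, ∀ m : ℕ,
      gammaFactor χ ((2 * (m + 1) - δ : ℝ) : ℂ) = Gammaℝ (2 * (m + 1)) := by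
    rcases χ.even_or_odd with hχ | hχ
    · exact ⟨0, by simp, fun m ↦ by rw [hχ.gammaFactor_def]; push_cast; simp⟩
    · exact ⟨1, by simp, fun m ↦ by rw [hχ.gammaFactor_def]; push_cast; simp⟩
  refine false_of_gamma_growth_le_exp hb hδ ?_
  have ht : Tendsto (fun m : ℕ ↦ (2 * (m + 1) - δ : ℝ)) atTop atTop := by
    refine tendsto_atTop_mono (fun m ↦ ?_) tendsto_natCast_atTop_atTop
    have := hδ.2
    have : (0 : ℝ) ≤ m := m.cast_nonneg
    linarith
  filter_upwards [ht.eventually (eventually_half_le_norm_LFunction χ),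
    ht.eventually (eventually_ge_atTop 2)] with m h1 h2
  set σ : ℝ := 2 * (m + 1) - δ with hσ
  have hs0 : (σ : ℂ) ≠ 0 := by exact_mod_cast (by linarith : σ ≠ 0)
  have hs1 : (σ : ℂ) ≠ 1 := by exact_mod_cast (by linarith : σ ≠ 1)
  rw [hHP _ hs0 hs1, norm_mul]
  rw [LFunction_eq_completed_div_gammaFactor χ _ (.inl hs0), hγ, norm_div,
    norm_Gammaℝ_two_mul_add, le_div_iff₀ (by positivity)] at h1
  calc (m.factorial : ℝ) / (2 * π ^ (m + 1)) = 1 / 2 * (m.factorial / π ^ (m + 1)) := by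
        field_simp
    _ ≤ ‖completedLFunction χ σ‖ := h1
    _ ≤ _ := le_mul_of_one_le_left (norm_nonneg _) (hP σ h2)

lemma hasFactorialGrowth_completedLFunction {χ : DirichletCharacter ℂ N} (hχ : χ ≠ 1) :
    HasFactorialGrowth (completedLFunction χ) := by
  have hN : N ≠ 1 := hχ ∘ level_one' _
  have h1 : HasFactorialGrowth (ZMod.completedLFunction₀ χ) := by
    have hb : ∀ (n : ℕ) (s : ℂ), ‖s‖ ≤ n → ‖(N : ℂ) ^ (-s)‖ ≤ 1 * (N : ℝ) ^ n := by
      intro n s hs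
      have h1N : (1 : ℝ) ≤ N := by exact_mod_cast NeZero.one_le
      rw [Complex.norm_natCast_cpow_of_pos (NeZero.pos N), one_mul, ← Real.rpow_natCast]
      refine Real.rpow_le_rpow_of_exponent_le h1N ?_
      rw [Complex.neg_re]
      exact ((neg_le_abs _).trans (Complex.abs_re_le_norm s)).trans hs
    refine HasFactorialGrowth.add ?_ ?_
    · exact (HasFactorialGrowth.sum _ fun j _ ↦
        (hasFactorialGrowth_completedHurwitzZetaEven₀ _).const_mul _).mul_of_exp_bound
        zero_le_one (by exact_mod_cast NeZero.one_le) hb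
    · exact (HasFactorialGrowth.sum _ fun j _ ↦
        (hasFactorialGrowth_completedHurwitzZetaOdd _).const_mul _).mul_of_exp_bound
        zero_le_one (by exact_mod_cast NeZero.one_le) hb
  convert h1 using 1
  ext s
  rw [completedLFunction, ZMod.completedLFunction_eq, χ.map_zero' hN, χ.sum_eq_zero_of_ne_one hχ]
  simp

lemma exists_completedLFunction_eq_zero (χ : DirichletCharacter ℂ N) (hχ : χ.IsPrimitive) :
    ∃ s, s ≠ 0 ∧ s ≠ 1 ∧ completedLFunction χ s = 0 := by
  by_cases h1 : χ = 1
  · have hN : N = 1 := by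
      rw [isPrimitive_def, h1, conductor_one] at hχ
      exact hχ.symm
    subst hN
    have hH : Differentiable ℂ (fun s : ℂ ↦ s * (1 - s) * completedRiemannZeta₀ s + (-1)) := by
      have := differentiable_completedZeta₀
      fun_prop
    have hg : HasFactorialGrowth (fun s : ℂ ↦ s * (1 - s) * completedRiemannZeta₀ s + (-1)) := by
      refine HasFactorialGrowth.add ?_ (.const _)
      refine (hasFactorialGrowth_completedHurwitzZetaEven₀ 0).mul_of_exp_bound
        (g := fun s ↦ s * (1 - s)) zero_le_one (by norm_num : (1 : ℝ) ≤ 4) fun n s hs ↦ ?_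
      have h2 : (n : ℝ) + 1 ≤ 2 ^ n := by exact_mod_cast Nat.lt_two_pow_self
      have h3 : ‖1 - s‖ ≤ n + 1 := by
        have := norm_sub_le 1 s
        rw [norm_one] at this
        linarith
      rw [norm_mul, one_mul, show (4 : ℝ) ^ n = 2 ^ n * 2 ^ n by rw [← mul_pow]; norm_num]
      gcongr
      · linarith
      · linarith
    have hHP : ∀ s : ℂ, s ≠ 0 → s ≠ 1 → s * (1 - s) * completedRiemannZeta₀ s + (-1) =
        s * (1 - s) * completedLFunction χ s := by
      intro s h0 h1
      have : 1 - s ≠ 0 := sub_ne_zero.mpr h1.symm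
      rw [completedLFunction_modOne_eq, completedRiemannZeta_eq]
      field_simp
      ring
    obtain ⟨s, hs⟩ := exists_zero_of_eq_mul_completedLFunction χ hH hg hHP (fun σ hσ ↦ by
      rw [show (σ : ℂ) * (1 - σ) = ((σ * (1 - σ) : ℝ) : ℂ) by push_cast; ring,
        Complex.norm_real, Real.norm_eq_abs, abs_of_nonpos (by nlinarith)]
      nlinarith)
    have h0 : s ≠ 0 := by rintro rfl; simp at hs
    have h1 : s ≠ 1 := by rintro rfl; simp at hs
    refine ⟨s, h0, h1, ?_⟩
    rw [hHP s h0 h1] at hs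
    exact (mul_eq_zero.mp hs).resolve_left (mul_ne_zero h0 (sub_ne_zero.mpr h1.symm))
  · have hN : N ≠ 1 := h1 ∘ level_one' _
    obtain ⟨s, hs⟩ := exists_zero_of_eq_mul_completedLFunction χ (P := fun _ ↦ 1)
      (differentiable_completedLFunction h1) (hasFactorialGrowth_completedLFunction h1)
      (by simp) (by simp)
    have key : ∀ {ψ : DirichletCharacter ℂ N}, ψ ≠ 1 → completedLFunction ψ 1 ≠ 0 := by
      intro ψ hψ h
      refine LFunction_ne_zero_of_one_le_re ψ (s := 1) (.inl hψ) (by simp) ?_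
      rw [LFunction_eq_completed_div_gammaFactor ψ _ (.inr hN), h, zero_div]
    refine ⟨s, ?_, ?_, hs⟩
    · rintro rfl
      have hinv : (χ⁻¹).IsPrimitive := by rwa [isPrimitive_def, conductor_inv]
      refine key (ψ := χ⁻¹) (inv_ne_one.mpr h1) ?_
      have := hinv.completedLFunction_one_sub 0
      rwa [sub_zero, inv_inv, hs, mul_zero] at this
    · rintro rfl
      exact key h1 hs

lemma exists_LFunction_eq_zero_of_isPrimitive (χ : DirichletCharacter ℂ N) (hχ : χ.IsPrimitive) :
    ∃ s : ℂ, 1 / 2 ≤ s.re ∧ s.re < 1 ∧ (LFunction χ s = 0 ∨ LFunction χ⁻¹ s = 0) := by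
  have hinv : (χ⁻¹).IsPrimitive := by rwa [isPrimitive_def, conductor_inv]
  have key : ∀ (ψ : DirichletCharacter ℂ N) (s : ℂ), s ≠ 0 → s ≠ 1 → completedLFunction ψ s = 0 →
      LFunction ψ s = 0 ∧ s.re < 1 := by
    intro ψ s h0 h1 h
    have hL : LFunction ψ s = 0 := by
      rw [LFunction_eq_completed_div_gammaFactor ψ _ (.inl h0), h, zero_div]
    refine ⟨hL, ?_⟩
    by_contra! hre
    exact LFunction_ne_zero_of_one_le_re ψ (.inr h1) hre hL
  obtain ⟨s, h0, h1, hs⟩ := exists_completedLFunction_eq_zero χ hχ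
  obtain ⟨hL, hre⟩ := key χ s h0 h1 hs
  have h0' : 1 - s ≠ 0 := sub_ne_zero.mpr h1.symm
  have h1' : 1 - s ≠ 1 := by simpa using h0
  have hs' : completedLFunction χ⁻¹ (1 - s) = 0 := by
    rw [hinv.completedLFunction_one_sub, inv_inv, hs, mul_zero]
  obtain ⟨hL', hre'⟩ := key χ⁻¹ (1 - s) h0' h1' hs'
  rcases le_total (1 / 2) s.re with h | h
  · exact ⟨s, h, hre, .inl hL⟩
  · refine ⟨1 - s, ?_, hre', .inr hL'⟩
    rw [Complex.sub_re, Complex.one_re]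
    linarith

lemma exists_LFunction_eq_zero (χ : DirichletCharacter ℂ N) :
    ∃ s : ℂ, 1 / 2 ≤ s.re ∧ s.re < 1 ∧ (LFunction χ s = 0 ∨ LFunction χ⁻¹ s = 0) := by
  have : NeZero χ.conductor := ⟨fun h ↦ NeZero.ne N (conductor_eq_zero_iff_level_eq_zero.mp h)⟩
  obtain ⟨s, h1, h2, h⟩ :=
    exists_LFunction_eq_zero_of_isPrimitive χ.primitiveCharacter χ.primitiveCharacter_isPrimitive
  have hs : s ≠ 1 := by rintro rfl; simp at h2
  refine ⟨s, h1, h2, h.imp (fun h ↦ ?_) fun h ↦ ?_⟩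
  · rw [← changeLevel_primitiveCharacter χ, LFunction_changeLevel _ _ (.inr hs), h, zero_mul]
  · rw [← changeLevel_primitiveCharacter χ, ← map_inv, LFunction_changeLevel _ _ (.inr hs), h,
      zero_mul]

end DirichletCharacter

lemma psiChi_eq_sum_Icc {q : ℕ} (χ : DirichletCharacter ℂ q) (x : ℝ) :
    psiChi χ x = ∑ n ∈ Finset.Icc 1 ⌊x⌋₊, χ n * (ArithmeticFunction.vonMangoldt n : ℂ) := by
  rw [psiChi, Finset.range_eq_Ico, Finset.sum_eq_sum_Ico_succ_bot (by positivity)]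
  simp only [ArithmeticFunction.map_zero, Complex.ofReal_zero, mul_zero, zero_add]
  rfl

lemma sum_norm_mul_vonMangoldt_le {q : ℕ} (χ : DirichletCharacter ℂ q) {x : ℝ} (hx : 0 ≤ x) :
    ∑ n ∈ Finset.Icc 1 ⌊x⌋₊, ‖χ n * (ArithmeticFunction.vonMangoldt n : ℂ)‖ ≤
      (Real.log 4 + 4) * x := by
  refine le_trans ?_ (Chebyshev.psi_le_const_mul_self hx)
  rw [Chebyshev.psi]
  refine Finset.sum_le_sum fun n _ ↦ ?_
  rw [norm_mul, Complex.norm_real, Real.norm_of_nonneg ArithmeticFunction.vonMangoldt_nonneg]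
  exact mul_le_of_le_one_left ArithmeticFunction.vonMangoldt_nonneg (χ.norm_le_one _)

lemma norm_psiChi_le {q : ℕ} (χ : DirichletCharacter ℂ q) {x : ℝ} (hx : 0 ≤ x) :
    ‖psiChi χ x‖ ≤ (Real.log 4 + 4) * x := by
  rw [psiChi_eq_sum_Icc]
  exact (norm_sum_le _ _).trans (sum_norm_mul_vonMangoldt_le χ hx)

lemma measurable_psiChi {q : ℕ} (χ : DirichletCharacter ℂ q) : Measurable (psiChi χ) :=
  (measurable_from_nat (f := fun m ↦ ∑ n ∈ Finset.range (m + 1),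
    χ n * (ArithmeticFunction.vonMangoldt n : ℂ))).comp Nat.measurable_floor

lemma psiChi_inv {q : ℕ} (χ : DirichletCharacter ℂ q) (x : ℝ) :
    psiChi χ⁻¹ x = (starRingEnd ℂ) (psiChi χ x) := by
  simp only [psiChi, map_sum, map_mul, Complex.conj_ofReal]
  refine Finset.sum_congr rfl fun n _ ↦ ?_
  rw [← MulChar.star_apply']
  rfl

lemma integrableOn_psiChi_mul_cexp {q : ℕ} (χ : DirichletCharacter ℂ q) {s : ℂ} (hs : 1 < s.re) :
    MeasureTheory.IntegrableOn (fun u : ℝ ↦ psiChi χ (rexp u) * cexp (-s * u)) (Set.Ioi 0) := by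
  refine ((integrableOn_pow_mul_exp_neg 0 (sub_pos.2 hs)).const_mul (Real.log 4 + 4)).mono' ?_ ?_
  · refine Measurable.aestronglyMeasurable ?_
    exact ((measurable_psiChi χ).comp Real.measurable_exp).mul (by fun_prop)
  · refine Eventually.of_forall fun u ↦ ?_
    rw [norm_mul, Complex.norm_exp]
    have h := norm_psiChi_le χ (Real.exp_pos u).le
    have hre : (-s * (u : ℂ)).re = -(s.re * u) := by simp
    calc ‖psiChi χ (rexp u)‖ * rexp (-s * (u : ℂ)).re
        ≤ (Real.log 4 + 4) * rexp u * rexp (-s * (u : ℂ)).re := by gcongr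
      _ = _ := by
        rw [hre, mul_assoc, ← Real.exp_add, pow_zero, one_mul]
        congr 2
        ring

lemma integral_psiChi_mul_cexp {q : ℕ} [NeZero q] (χ : DirichletCharacter ℂ q) {s : ℂ}
    (hs : 1 < s.re) :
    ∫ u in Set.Ioi (0 : ℝ), psiChi χ (rexp u) * cexp (-s * u) =
      -(deriv χ.LFunction s / χ.LFunction s) / s := by
  have hs0 : s ≠ 0 := by rintro rfl; simp at hs; linarith
  have h1 := LSeries_eq_mul_integral'
    (fun n : ℕ ↦ χ n * (ArithmeticFunction.vonMangoldt n : ℂ)) zero_le_one hs (by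
      refine Asymptotics.IsBigO.of_bound (Real.log 4 + 4) (Eventually.of_forall fun n ↦ ?_)
      rw [Real.norm_of_nonneg (Finset.sum_nonneg fun _ _ ↦ norm_nonneg _), Real.rpow_one,
        Real.norm_natCast]
      simpa using sum_norm_mul_vonMangoldt_le χ n.cast_nonneg)
  have h2 := DirichletCharacter.LSeries_twist_vonMangoldt_eq χ hs
  rw [← DirichletCharacter.deriv_LFunction_eq_deriv_LSeries χ hs,
    ← DirichletCharacter.LFunction_eq_LSeries χ hs] at h2
  have h3 : -(deriv χ.LFunction s / χ.LFunction s) / s = ∫ t in Set.Ioi (1 : ℝ),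
      (∑ k ∈ Finset.Icc 1 ⌊t⌋₊, χ k * (ArithmeticFunction.vonMangoldt k : ℂ)) *
        (t : ℂ) ^ (-(s + 1)) := by
    rw [← neg_div, ← h2, div_eq_iff hs0, mul_comm _ s]
    exact h1
  rw [h3, ← Real.exp_zero, ← MeasureTheory.integral_comp_exp_Ioi]
  refine MeasureTheory.setIntegral_congr_fun measurableSet_Ioi fun u _ ↦ ?_
  rw [psiChi_eq_sum_Icc, Complex.real_smul, Complex.cpow_def_of_ne_zero
    (by exact_mod_cast (Real.exp_pos u).ne'), ← Complex.ofReal_log (Real.exp_pos u).le,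
    Real.log_exp, mul_left_comm, Complex.ofReal_exp, ← Complex.exp_add]
  congr 2
  ring

lemma exists_entire_with_same_zeros {q : ℕ} [NeZero q] (χ : DirichletCharacter ℂ q) :
    ∃ E : ℂ → ℂ, Differentiable ℂ E ∧ (∀ s : ℂ, 1 < s.re → E s ≠ 0 ∧
      deriv χ.LFunction s / χ.LFunction s =
        deriv E s / E s - (if χ = 1 then 1 else 0) / (s - 1)) ∧
      ∀ s, s ≠ 1 → χ.LFunction s = 0 → E s = 0 := by
  by_cases h : χ = 1
  · subst h
    have hE : ∀ s, s ≠ 1 → DirichletCharacter.LFunctionTrivChar₁ q s =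
        (s - 1) * DirichletCharacter.LFunction (1 : DirichletCharacter ℂ q) s :=
      fun s hs ↦ Function.update_of_ne hs ..
    refine ⟨DirichletCharacter.LFunctionTrivChar₁ q,
      DirichletCharacter.differentiable_LFunctionTrivChar₁ q, fun s hs ↦ ?_, fun s hs h0 ↦ ?_⟩
    · have h1 : s ≠ 1 := by rintro rfl; simp at hs
      have h1' := sub_ne_zero.mpr h1
      have h0 := DirichletCharacter.LFunction_ne_zero_of_one_le_re
        (1 : DirichletCharacter ℂ q) (.inr h1) hs.le
      refine ⟨by rw [hE s h1]; exact mul_ne_zero h1' h0, ?_⟩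
      rw [DirichletCharacter.deriv_LFunctionTrivChar₁_apply_of_ne_one q h1, hE s h1, if_pos rfl,
        DirichletCharacter.LFunctionTrivChar]
      field_simp
      ring
    · rw [hE s hs, h0, mul_zero]
  · refine ⟨χ.LFunction, DirichletCharacter.differentiable_LFunction h, fun s hs ↦ ⟨?_, ?_⟩,
      fun s _ h0 ↦ h0⟩
    · exact DirichletCharacter.LFunction_ne_zero_of_one_le_re χ (.inl h) hs.le
    · simp [h]

lemma exists_entire_laplace_psiChi {q : ℕ} [NeZero q] (χ : DirichletCharacter ℂ q) {θ : ℝ}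
    (hθ : θ ≤ 1) :
    ∃ E : ℂ → ℂ, Differentiable ℂ E ∧ (∀ s : ℂ, 1 < s.re → E s ≠ 0) ∧
      (∀ s, s ≠ 1 → (χ.LFunction s = 0 ∨ χ⁻¹.LFunction s = 0) → E s = 0) ∧
      ∀ s : ℂ, 1 < s.re →
        ∫ u in Set.Ioi (0 : ℝ), (((psiChi χ (rexp u)).re - (if χ = 1 then rexp u else 0) +
          rexp (θ * u) : ℝ) : ℂ) * cexp (-s * u) =
        -(deriv E s / E s) / (2 * s) - (if χ = 1 then 1 else 0) / s + 1 / (s - θ) := by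
  obtain ⟨E₁, hd₁, hE₁, hz₁⟩ := exists_entire_with_same_zeros χ
  obtain ⟨E₂, hd₂, hE₂, hz₂⟩ := exists_entire_with_same_zeros χ⁻¹
  refine ⟨fun s ↦ E₁ s * E₂ s, hd₁.mul hd₂, fun s hs ↦ mul_ne_zero (hE₁ s hs).1 (hE₂ s hs).1,
    fun s h1 h ↦ ?_, fun s hs ↦ ?_⟩
  · rcases h with h | h
    · simp only [hz₁ s h1 h, zero_mul]
    · simp only [hz₂ s h1 h, mul_zero]
  have hexp : ∀ c : ℝ, c ≤ 1 → MeasureTheory.IntegrableOn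
      (fun u : ℝ ↦ cexp ((c - s) * u)) (Set.Ioi 0) ∧
      ∫ u in Set.Ioi (0 : ℝ), cexp ((c - s) * u) = 1 / (s - c) := by
    intro c hc
    have hre : ((c : ℂ) - s).re < 0 := by
      rw [Complex.sub_re, Complex.ofReal_re]
      linarith
    refine ⟨integrableOn_exp_mul_complex_Ioi hre 0, ?_⟩
    rw [integral_exp_mul_complex_Ioi hre, Complex.ofReal_zero, mul_zero, Complex.exp_zero,
      ← neg_sub s, neg_div_neg_eq]
  have hs0 : s ≠ 0 := by rintro rfl; simp at hs; linarith
  have hs1 : s - 1 ≠ 0 := sub_ne_zero.mpr (by rintro rfl; simp at hs)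
  have hK : ∀ u : ℝ, (((psiChi χ (rexp u)).re - (if χ = 1 then rexp u else 0) +
      rexp (θ * u) : ℝ) : ℂ) * cexp (-s * u) =
      (1 / 2 * (psiChi χ (rexp u) * cexp (-s * u)) + 1 / 2 * (psiChi χ⁻¹ (rexp u) * cexp (-s * u))
      - (if χ = 1 then 1 else 0) * cexp (((1 : ℝ) - s) * u)) + cexp ((θ - s) * u) := by
    intro u
    have e : ∀ c : ℝ, cexp ((c - s) * u) = cexp (c * u) * cexp (-s * u) := by
      intro c
      rw [← Complex.exp_add]
      congr 1
      ring
    rw [e, e, psiChi_inv, Complex.ofReal_add, Complex.ofReal_sub, Complex.re_eq_add_conj]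
    split_ifs <;> push_cast <;> ring
  simp_rw [hK]
  rw [MeasureTheory.integral_add, MeasureTheory.integral_sub, MeasureTheory.integral_add,
    MeasureTheory.integral_const_mul, MeasureTheory.integral_const_mul,
    MeasureTheory.integral_const_mul, integral_psiChi_mul_cexp χ hs,
    integral_psiChi_mul_cexp χ⁻¹ hs, (hexp 1 le_rfl).2, (hexp θ hθ).2, (hE₁ s hs).2, (hE₂ s hs).2,
    deriv_fun_mul (hd₁ s) (hd₂ s)]
  · have h1 := (hE₁ s hs).1
    have h2 := (hE₂ s hs).1
    simp only [inv_eq_one, Complex.ofReal_one]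
    congr 1
    field_simp
    split_ifs <;> ring_nf
  · exact (integrableOn_psiChi_mul_cexp χ hs).const_mul _
  · exact (integrableOn_psiChi_mul_cexp χ⁻¹ hs).const_mul _
  · exact ((integrableOn_psiChi_mul_cexp χ hs).const_mul _).add
      ((integrableOn_psiChi_mul_cexp χ⁻¹ hs).const_mul _)
  · exact (hexp 1 le_rfl).1.const_mul _
  · exact (((integrableOn_psiChi_mul_cexp χ hs).const_mul _).add
      ((integrableOn_psiChi_mul_cexp χ⁻¹ hs).const_mul _)).sub ((hexp 1 le_rfl).1.const_mul _)
  · exact (hexp θ hθ).1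

lemma Lfunc_eq_LFunction {q : ℕ} [NeZero q] (χ : DirichletCharacter ℂ q) (s : ℂ) :
    Lfunc q χ s = χ.LFunction s := by
  rw [Lfunc, dif_neg (NeZero.ne q)]

lemma half_le_ThetaChi_and_le_one (q : ℕ) (χ : DirichletCharacter ℂ q) :
    1 / 2 ≤ ThetaChi q χ ∧ ThetaChi q χ ≤ 1 := by
  have hb : ∀ σ ∈ insert (1 / 2 : ℝ)
      {σ : ℝ | ∃ s : ℂ, Lfunc q χ s = 0 ∧ 0 < s.re ∧ s.re < 1 ∧ s.re = σ}, σ ≤ 1 := by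
    rintro σ (rfl | ⟨s, -, -, h, rfl⟩)
    · norm_num
    · exact h.le
  exact ⟨le_csSup ⟨1, hb⟩ (Set.mem_insert _ _), csSup_le (Set.insert_nonempty _ _) hb⟩

lemma exists_zero_re_gt_of_lt_ThetaChi {q : ℕ} [NeZero q] (χ : DirichletCharacter ℂ q) {θ : ℝ}
    (hθ : θ < ThetaChi q χ) :
    ∃ s : ℂ, θ < s.re ∧ s.re < 1 ∧ (χ.LFunction s = 0 ∨ χ⁻¹.LFunction s = 0) := by
  obtain ⟨σ, hσ, hlt⟩ := exists_lt_of_lt_csSup (Set.insert_nonempty _ _) hθ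
  rcases hσ with rfl | ⟨s, h0, -, h1, rfl⟩
  · obtain ⟨s, hs, hs1, h⟩ := DirichletCharacter.exists_LFunction_eq_zero χ
    exact ⟨s, hlt.trans_le hs, hs1, h⟩
  · exact ⟨s, hlt, h1, .inl (by rwa [Lfunc_eq_LFunction] at h0)⟩

lemma exists_psiChi_lt_in_window {q : ℕ} [NeZero q] (χ : DirichletCharacter ℂ q) {ε : ℝ}
    (hε : 0 < ε) (hε' : ε ≤ 1 / 4) :
    ∃ X₀ : ℝ, ∀ X : ℝ, X₀ ≤ X → ∃ x : ℝ, X ^ (1 - ε) ≤ x ∧ x ≤ X ∧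
      (psiChi χ x).re - (if χ = 1 then x else 0) < -(x ^ (ThetaChi q χ - ε)) := by
  obtain ⟨hΘ, hΘ1⟩ := half_le_ThetaChi_and_le_one q χ
  set θ := ThetaChi q χ - ε with hθdef
  have hθ1 : θ ≤ 1 := by linarith
  obtain ⟨E, hE, hE0, hEz, hL⟩ := exists_entire_laplace_psiChi χ hθ1
  obtain ⟨ρ, hρ, hρ1, hρ0⟩ := exists_zero_re_gt_of_lt_ThetaChi χ (θ := θ) (by linarith)
  have hρne : ρ ≠ 1 := by rintro rfl; simp at hρ1
  have hmeas : Measurable fun u : ℝ ↦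
      (psiChi χ (rexp u)).re - (if χ = 1 then rexp u else 0) + rexp (θ * u) := by
    have h := Complex.measurable_re.comp ((measurable_psiChi χ).comp Real.measurable_exp)
    refine (h.sub ?_).add (by fun_prop)
    split_ifs <;> fun_prop
  have hlog : 0 ≤ Real.log 4 := Real.log_nonneg (by norm_num)
  have hbound : ∀ u : ℝ, 0 < u →
      |(psiChi χ (rexp u)).re - (if χ = 1 then rexp u else 0) + rexp (θ * u)| ≤
        (Real.log 4 + 6) * rexp (1 * u) := by
    intro u hu
    have h1 : |(psiChi χ (rexp u)).re| ≤ (Real.log 4 + 4) * rexp u :=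
      (Complex.abs_re_le_norm _).trans (norm_psiChi_le χ (Real.exp_pos u).le)
    have h2 : |if χ = 1 then rexp u else 0| ≤ rexp u := by
      split_ifs
      · rw [abs_of_pos (Real.exp_pos u)]
      · simpa using (Real.exp_pos u).le
    have h3 : |rexp (θ * u)| ≤ rexp u := by
      rw [abs_of_pos (Real.exp_pos _)]
      exact Real.exp_le_exp.mpr (by nlinarith)
    have h4 := abs_add_le ((psiChi χ (rexp u)).re - (if χ = 1 then rexp u else 0)) (rexp (θ * u))
    have h5 := abs_sub (psiChi χ (rexp u)).re (if χ = 1 then rexp u else 0)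
    rw [one_mul]
    linarith
  obtain ⟨U₀, hU₀⟩ := exists_neg_in_window hmeas one_pos (by linarith) hbound hE hE0
    (by linarith : 0 < θ) (if χ = 1 then 1 else 0) hL (hEz ρ hρne hρ0) hρ hε (by linarith)
  refine ⟨rexp U₀, fun X hX ↦ ?_⟩
  have hX0 : 0 < X := (Real.exp_pos _).trans_le hX
  obtain ⟨u, hu1, hu2, hneg⟩ := hU₀ (Real.log X) ((Real.le_log_iff_exp_le hX0).mpr hX)
  refine ⟨rexp u, ?_, ?_, ?_⟩
  · rw [Real.rpow_def_of_pos hX0, mul_comm]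
    exact Real.exp_le_exp.mpr hu1
  · exact (Real.le_log_iff_exp_le hX0).mp hu2
  · rw [← Real.exp_mul, mul_comm u]
    linarith

theorem complex_oscillations (ε : ℝ) (hε : 0 < ε) (q : ℕ) (hq : 1 ≤ q)
    (χ : DirichletCharacter ℂ q) :
    ∃ X₀ : ℝ, ∀ X : ℝ, X₀ ≤ X → ∃ x : ℝ, X ^ (1 - ε) ≤ x ∧ x ≤ X ∧
      (psiChi χ x).re - (if χ = 1 then x else 0) < -(x ^ (ThetaChi q χ - ε)) := by
  have : NeZero q := ⟨by omega⟩
  have hmin : min ε (1 / 4) ≤ ε := min_le_left _ _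
  have hmin4 : min ε (1 / 4) ≤ 1 / 4 := min_le_right _ _
  obtain ⟨X₀, hX₀⟩ := exists_psiChi_lt_in_window χ (lt_min hε (by norm_num)) hmin4
  refine ⟨max X₀ 1, fun X hX ↦ ?_⟩
  have hX1 : 1 ≤ X := (le_max_right _ _).trans hX
  obtain ⟨x, h1, h2, h3⟩ := hX₀ X ((le_max_left _ _).trans hX)
  have hx1 : 1 ≤ x := (Real.one_le_rpow hX1 (by linarith)).trans h1
  have h4 := h3.trans_le (neg_le_neg (Real.rpow_le_rpow_of_exponent_le hx1
    (by linarith : ThetaChi q χ - ε ≤ ThetaChi q χ - min ε (1 / 4))))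
  refine ⟨x, (Real.rpow_le_rpow_of_exponent_le hX1 (by linarith)).trans h1, h2, ?_⟩
  refine lt_of_eq_of_lt ?_ h4
  congr
end

section
/- Assume that GRH is false, i.e., some Dirichlet L-function L(s,χ) has a zero s with 0 < Re(s) < 1 and Re(s) ≠ 1/2. Then there exists a constant δ > 0 with the following property: for any increasing function h tending to infinity with h(x) = o(x^δ) as x → ∞, the set of moduli q for which there exists a real number x_q with h(x_q^{1−δ}) ≤ q ≤ h(x_q) and G(x_q; q) ≥ x_q^{1+δ} has positive lower natural density in the positive integers. If moreover GRH(χ) is false for some nonprincipal character χ, the same conclusion holds with V_Λ(x_q;q) in place of G(x_q;q). -/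
open Filter Real Complex
open scoped Classical

/-- `θ(x;q,a) = ∑_{p ≤ x, p ≡ a (mod q)} log p`. -/
noncomputable def thetaQA (x : ℝ) (q a : ℕ) : ℝ :=
  ∑ p ∈ (Finset.range (Nat.floor x + 1)).filter (fun p => p.Prime ∧ p % q = a), Real.log p

/-- The variance `G(x;q)` of primes in arithmetic progressions mod `q`, weighted by `log p`. -/
noncomputable def Gvar (x : ℝ) (q : ℕ) : ℝ :=
  ∑ a ∈ (Finset.range q).filter (fun a => Nat.Coprime a q),
    (thetaQA x q a - x / (Nat.totient q)) ^ 2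

/-- The variance `V_Λ(x;q)`. -/
noncomputable def Vvar (x : ℝ) (q : ℕ) : ℝ :=
  ∑ a ∈ (Finset.range q).filter (fun a => Nat.Coprime a q),
    ((∑ n ∈ (Finset.range (Nat.floor x + 1)).filter (fun n => n % q = a),
        ArithmeticFunction.vonMangoldt n)
      - (1 / (Nat.totient q : ℝ)) *
        ∑ n ∈ (Finset.range (Nat.floor x + 1)).filter (fun n => Nat.Coprime n q),
          ArithmeticFunction.vonMangoldt n) ^ 2

/-- The generalized Riemann hypothesis for the character `χ`: every zero of `L(s,χ)`
with `0 < Re s < 1` lies on the critical line. -/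
def GRHchi {q : ℕ} (χ : DirichletCharacter ℂ q) : Prop :=
  ∀ s : ℂ, 0 < s.re → s.re < 1 → Lfunc q χ s = 0 → s.re = 1 / 2

/-- The generalized Riemann hypothesis for all Dirichlet L-functions. -/
def GRH : Prop := ∀ (q : ℕ) (χ : DirichletCharacter ℂ q), GRHchi χ

/-- The set `S ⊆ ℕ` has positive lower natural density. -/
def PosLowerDensity (S : Set ℕ) : Prop :=
  0 < Filter.liminf (fun N : ℕ => (Nat.card {n : ℕ | n ≤ N ∧ n ∈ S} : ℝ) / (N + 1)) Filter.atTop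


/-- The sequence `c` satisfies `‖c j‖ ≥ c₀ r ^ (-j)` for some `j` in every far enough window of a
fixed length. -/
def RecurrentlyLarge (c : ℕ → ℂ) (r : ℝ) : Prop :=
  ∃ (M : ℕ) (c₀ : ℝ) (K : ℕ), 0 < c₀ ∧ ∀ k ≥ K, ∃ j, k ≤ j ∧ j ≤ k + M ∧ c₀ ≤ ‖c j‖ * r ^ j

/-- The coefficients of `(a - w) * ∑ c k * w ^ k`. -/
def mulSubCoeff (a : ℂ) (c : ℕ → ℂ) : ℕ → ℂ
  | 0 => a * c 0
  | k + 1 => a * c (k + 1) - c k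

lemma hasSum_mulSubCoeff {a w S : ℂ} {c : ℕ → ℂ} (h : HasSum (fun k => w ^ k * c k) S) :
    HasSum (fun k => w ^ k * mulSubCoeff a c k) ((a - w) * S) := by
  have h1 := h.mul_left a
  rw [← hasSum_nat_add_iff' 1] at h1
  have h2 := h1.sub (h.mul_left w)
  rw [← hasSum_nat_add_iff' 1]
  convert! h2 using 1
  · ext k
    simp only [mulSubCoeff]
    ring
  · simp [mulSubCoeff]
    ring

lemma RecurrentlyLarge.of_mulSubCoeff {a : ℂ} {c : ℕ → ℂ} {r : ℝ} (hr : 0 < r)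
    (h : RecurrentlyLarge (mulSubCoeff a c) r) : RecurrentlyLarge c r := by
  obtain ⟨M, c₀, K, hc₀, h⟩ := h
  refine ⟨M + 1, c₀ / (‖a‖ + r), K, by positivity, fun k hk => ?_⟩
  obtain ⟨j, hj1, hj2, hj⟩ := h (k + 1) (by omega)
  obtain ⟨i, rfl⟩ : ∃ i, j = i + 1 := ⟨j - 1, by omega⟩
  by_contra! hcon
  have h1 := hcon (i + 1) (by omega) (by omega)
  have h2 := hcon i (by omega) (by omega)
  have h3 : ‖mulSubCoeff a c (i + 1)‖ ≤ ‖a‖ * ‖c (i + 1)‖ + ‖c i‖ := by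
    simp only [mulSubCoeff]
    exact (norm_sub_le _ _).trans (by rw [norm_mul])
  have h4 : ‖mulSubCoeff a c (i + 1)‖ * r ^ (i + 1) ≤
      ‖a‖ * (‖c (i + 1)‖ * r ^ (i + 1)) + r * (‖c i‖ * r ^ i) := by
    calc _ ≤ (‖a‖ * ‖c (i + 1)‖ + ‖c i‖) * r ^ (i + 1) := by gcongr
      _ = _ := by ring
  have h5 : ‖a‖ * (‖c (i + 1)‖ * r ^ (i + 1)) + r * (‖c i‖ * r ^ i) <
      (‖a‖ + r) * (c₀ / (‖a‖ + r)) := by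
    rw [add_mul]
    exact add_lt_add_of_le_of_lt (by gcongr) (by gcongr)
  rw [mul_div_cancel₀ _ (by positivity)] at h5
  linarith

lemma recurrentlyLarge_of_simple_pole {c : ℕ → ℂ} {Φ H : ℂ → ℂ} {w₁ : ℂ} {R : NNReal}
    (hw₁ : w₁ ≠ 0) (hR : ‖w₁‖ < R) (hH : DifferentiableOn ℂ H (Metric.closedBall 0 R))
    (hH₁ : H w₁ ≠ 0) (hc : ∀ᶠ w in nhds 0, HasSum (fun k => w ^ k * c k) (Φ w))
    (hΦ : ∀ᶠ w in nhds 0, (w₁ - w) * Φ w = H w) : RecurrentlyLarge c ‖w₁‖ := by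
  have hR0 : 0 < R := by
    have := (norm_nonneg w₁).trans_lt hR
    exact_mod_cast this
  have hps := hH.hasFPowerSeriesOnBall hR0
  set p := cauchyPowerSeries H 0 R
  have hd : HasFPowerSeriesAt H (FormalMultilinearSeries.ofScalars ℂ (mulSubCoeff w₁ c)) 0 := by
    rw [hasFPowerSeriesAt_iff]
    filter_upwards [hc, hΦ] with w h1 h2
    simpa [FormalMultilinearSeries.coeff_ofScalars, ← h2] using hasSum_mulSubCoeff h1
  have hpeq := hps.hasFPowerSeriesAt.eq_formalMultilinearSeries hd
  have hsum : HasSum (fun k => w₁ ^ k * mulSubCoeff w₁ c k) (H w₁) := by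
    have hmem : w₁ ∈ Metric.eball (0 : ℂ) R := by
      rw [Metric.eball_coe, mem_ball_zero_iff]
      exact hR
    have := hps.hasSum hmem
    rw [hpeq] at this
    simpa [FormalMultilinearSeries.ofScalars_apply_eq, mul_comm] using this
  have hpart : ∀ k, ∑ i ∈ Finset.range (k + 1), w₁ ^ i * mulSubCoeff w₁ c i
      = c k * w₁ ^ (k + 1) := by
    intro k
    induction k with
    | zero => simp [mulSubCoeff, mul_comm]
    | succ k ih =>
      rw [Finset.sum_range_succ, ih]
      simp only [mulSubCoeff]
      ring
  have hlim := ((hsum.tendsto_sum_nat.comp (tendsto_add_atTop_nat 1)).norm)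
  have hev := hlim.eventually (lt_mem_nhds (half_lt_self (norm_pos_iff.2 hH₁)))
  obtain ⟨K, hK⟩ := eventually_atTop.1 hev
  refine ⟨0, ‖H w₁‖ / 2 / ‖w₁‖, K, ?_, fun k hk => ⟨k, le_rfl, le_rfl, ?_⟩⟩
  · have := norm_pos_iff.2 hH₁
    have := norm_pos_iff.2 hw₁
    positivity
  · have h1 := (hK k hk).le
    simp only [Function.comp_apply, hpart, norm_mul, norm_pow] at h1
    rw [div_le_iff₀ (norm_pos_iff.2 hw₁), mul_assoc, ← pow_succ]
    exact h1

lemma recurrentlyLarge_of_poles {H : ℂ → ℂ} {w₁ : ℂ} {R : NNReal}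
    (hw₁ : w₁ ≠ 0) (hR : ‖w₁‖ < R) (hH : DifferentiableOn ℂ H (Metric.closedBall 0 R))
    (hH₁ : H w₁ ≠ 0) (l : Multiset ℂ) : ∀ {c : ℕ → ℂ} {Φ : ℂ → ℂ},
    (∀ᶠ w in nhds 0, HasSum (fun k => w ^ k * c k) (Φ w)) →
    (∀ᶠ w in nhds 0, (w₁ - w) * ((l.map (fun a => a - w)).prod * Φ w) = H w) →
    RecurrentlyLarge c ‖w₁‖ := by
  induction l using Multiset.induction_on with
  | empty =>
    intro c Φ hc hΦ
    exact recurrentlyLarge_of_simple_pole hw₁ hR hH hH₁ hc (by simpa using hΦ)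
  | cons a l ih =>
    intro c Φ hc hΦ
    refine RecurrentlyLarge.of_mulSubCoeff (a := a) (norm_pos_iff.2 hw₁)
      (ih (Φ := fun w => (a - w) * Φ w) ?_ ?_)
    · filter_upwards [hc] with w hw using hasSum_mulSubCoeff hw
    · filter_upwards [hΦ] with w hw
      rw [← hw]
      simp only [Multiset.map_cons, Multiset.prod_cons]
      ring

lemma differentiable_multiset_prod_sub (m : Multiset ℂ) :
    Differentiable ℂ (fun w : ℂ => (m.map (fun a => a - w)).prod) := by
  induction m using Multiset.induction_on with
  | empty => simp
  | cons a m ih =>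
    simp only [Multiset.map_cons, Multiset.prod_cons]
    exact (by fun_prop : Differentiable ℂ fun w : ℂ => a - w).mul ih

lemma meromorphicOrderAt_multiset_prod_sub (m : Multiset ℂ) (z : ℂ) :
    meromorphicOrderAt (fun w => (m.map (fun a => a - w)).prod) z = (m.count z : ℤ) := by
  induction m using Multiset.induction_on with
  | empty => simp [meromorphicOrderAt_const]
  | cons a m ih =>
    have h1 : MeromorphicAt (fun w : ℂ => a - w) z := by fun_prop
    have h2 : MeromorphicAt (fun w : ℂ => (m.map (fun a => a - w)).prod) z :=
      ((differentiable_multiset_prod_sub m).analyticAt z).meromorphicAt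
    have : (fun w : ℂ => ((a ::ₘ m).map (fun a => a - w)).prod) =
        (fun w : ℂ => a - w) * fun w => (m.map (fun a => a - w)).prod := by
      ext w; simp
    rw [this, meromorphicOrderAt_mul h1 h2, ih, Multiset.count_cons]
    by_cases hza : z = a
    · subst hza
      have : meromorphicOrderAt (fun w : ℂ => z - w) z = ((1 : ℤ) : WithTop ℤ) := by
        rw [meromorphicOrderAt_eq_int_iff h1]
        refine ⟨fun _ => -1, by fun_prop, by norm_num, ?_⟩
        filter_upwards with w
        simp
      rw [this]
      simp only [if_true]
      norm_cast
      omega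
    · have : meromorphicOrderAt (fun w : ℂ => a - w) z = ((0 : ℤ) : WithTop ℤ) := by
        rw [meromorphicOrderAt_eq_int_iff h1]
        refine ⟨fun w => a - w, by fun_prop, by simpa [sub_eq_zero] using fun h => hza h.symm, ?_⟩
        filter_upwards with w
        simp
      rw [this]
      simp [hza]

/-- The Taylor coefficients at `0` of a meromorphic function with a pole at `w₁` are recurrently
of size at least a constant times `‖w₁‖ ^ (-k)`. -/
theorem recurrentlyLarge_of_meromorphic {c : ℕ → ℂ} {Φ : ℂ → ℂ} {w₁ : ℂ} (hw₁ : w₁ ≠ 0)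
    (hΦ : ∀ z, MeromorphicAt Φ z) (htop : meromorphicOrderAt Φ w₁ ≠ ⊤)
    (hneg : meromorphicOrderAt Φ w₁ < 0)
    (hc : ∀ᶠ w in nhds 0, HasSum (fun k => w ^ k * c k) (Φ w)) : RecurrentlyLarge c ‖w₁‖ := by
  have hΦU : MeromorphicOn Φ Set.univ := fun z _ => hΦ z
  have htop' : ∀ z, meromorphicOrderAt Φ z ≠ ⊤ := fun z =>
    hΦU.meromorphicOrderAt_ne_top_of_isPreconnected isPreconnected_univ
      (Set.mem_univ w₁) (Set.mem_univ z) htop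
  set R : NNReal := ‖w₁‖₊ + 1 with hRdef
  have hR : ‖w₁‖ < R := by simp [hRdef]
  set U := Metric.closedBall (0 : ℂ) R
  have hmU : MeromorphicOn Φ U := fun z _ => hΦ z
  have hfin : (MeromorphicOn.divisor Φ U).support.Finite :=
    (MeromorphicOn.divisor Φ U).finiteSupport (isCompact_closedBall _ _)
  let d : ℂ →₀ ℕ := Finsupp.onFinset hfin.toFinset
    (fun u => (-(MeromorphicOn.divisor Φ U u)).toNat) (by
      intro u hu
      simp only [Set.Finite.mem_toFinset, Function.mem_support]
      intro h
      simp [h] at hu)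
  set m := Finsupp.toMultiset d
  have hcount : ∀ z, m.count z = (-(MeromorphicOn.divisor Φ U z)).toNat := by
    intro z
    rw [Finsupp.count_toMultiset]
    rfl
  have hw₁U : w₁ ∈ U := by simpa [U] using hR.le
  have hord : ∀ z ∈ U, meromorphicOrderAt Φ z = (MeromorphicOn.divisor Φ U z : ℤ) := by
    intro z hz
    rw [MeromorphicOn.divisor_apply hmU hz, WithTop.coe_untop₀_of_ne_top (htop' z)]
  have hneg' : MeromorphicOn.divisor Φ U w₁ < 0 := by
    rw [hord w₁ hw₁U] at hneg
    exact_mod_cast hneg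
  obtain ⟨l, hl⟩ : ∃ l, m = w₁ ::ₘ l := by
    apply Multiset.exists_cons_of_mem
    rw [← Multiset.count_pos, hcount]
    omega
  set P : ℂ → ℂ := fun w => (m.map (fun a => a - w)).prod with hP
  have hPmer : ∀ z, MeromorphicAt P z := fun z =>
    ((differentiable_multiset_prod_sub m).analyticAt z).meromorphicAt
  set Ψ : ℂ → ℂ := P * Φ with hΨ
  have hΨm : MeromorphicOn Ψ Set.univ := fun z _ => (hPmer z).mul (hΦ z)
  have hΨo : ∀ z ∈ U, meromorphicOrderAt Ψ z =
      (((-(MeromorphicOn.divisor Φ U z)).toNat + MeromorphicOn.divisor Φ U z : ℤ) : WithTop ℤ) := by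
    intro z hz
    rw [hΨ, meromorphicOrderAt_mul (hPmer z) (hΦ z), meromorphicOrderAt_multiset_prod_sub,
      hord z hz, hcount]
    norm_cast
  set H := toMeromorphicNFOn Ψ Set.univ
  have hNF := meromorphicNFOn_toMeromorphicNFOn Ψ Set.univ
  have hHan : ∀ z ∈ U, AnalyticAt ℂ H z := by
    intro z hz
    rw [← (hNF (Set.mem_univ z)).meromorphicOrderAt_nonneg_iff_analyticAt,
      meromorphicOrderAt_toMeromorphicNFOn hΨm (Set.mem_univ z), hΨo z hz]
    norm_cast
    omega
  have hH₁ : H w₁ ≠ 0 := by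
    rw [← (hNF (Set.mem_univ w₁)).meromorphicOrderAt_eq_zero_iff,
      meromorphicOrderAt_toMeromorphicNFOn hΨm (Set.mem_univ w₁), hΨo w₁ hw₁U]
    norm_cast
    omega
  have hΦan : AnalyticAt ℂ Φ 0 := by
    refine ⟨FormalMultilinearSeries.ofScalars ℂ c, ?_⟩
    rw [hasFPowerSeriesAt_iff]
    filter_upwards [hc] with w h1
    simpa [FormalMultilinearSeries.coeff_ofScalars] using h1
  refine recurrentlyLarge_of_poles hw₁ hR
    (fun z hz => (hHan z hz).differentiableAt.differentiableWithinAt) hH₁ l hc ?_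
  have h0 : (0 : ℂ) ∈ U := by simp [U]
  have heq : ∀ᶠ w in nhds 0, Ψ w = H w := by
    refine (AnalyticAt.frequently_eq_iff_eventually_eq ?_ (hHan 0 h0)).1 ?_
    · exact ((differentiable_multiset_prod_sub m).analyticAt 0).mul hΦan
    · exact (hΨm.toMeromorphicNFOn_eq_self_on_nhdsNE (Set.mem_univ 0)).symm.frequently
  filter_upwards [heq] with w hw
  rw [← hw, hΨ, Pi.mul_apply, hP, hl]
  simp [mul_assoc]

/-- The coefficients of the expansion of `∫ t in Ioi 1, A t * t ^ (-(s - w + 1))` in powers of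
`w`. -/
noncomputable def logMoment (A : ℝ → ℂ) (s : ℂ) (k : ℕ) : ℂ :=
  ∫ t in Set.Ioi (1 : ℝ), A t * ((Real.log t : ℂ) ^ k / (k.factorial : ℂ)) * (t : ℂ) ^ (-(s + 1))

lemma hasSum_logMoment {A : ℝ → ℂ} (hAm : Measurable A)
    (hA : ∀ t : ℝ, 1 ≤ t → ‖A t‖ ≤ t ^ (2 : ℝ)) {s w : ℂ} (hw : ‖w‖ < s.re - 2) :
    HasSum (fun k => w ^ k * logMoment A s k)
      (∫ t in Set.Ioi (1 : ℝ), A t * (t : ℂ) ^ (-(s - w + 1))) := by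
  simp only [logMoment, ← MeasureTheory.integral_const_mul]
  have hexp : ∀ x : ℝ, HasSum (fun n : ℕ => x ^ n / (n.factorial : ℝ)) (Real.exp x) := fun x => by
    simpa [Real.exp_eq_exp_ℝ] using NormedSpace.expSeries_div_hasSum_exp x
  have hcexp : ∀ x : ℂ, HasSum (fun n : ℕ => x ^ n / (n.factorial : ℂ)) (Complex.exp x) :=
    fun x => by simpa [Complex.exp_eq_exp_ℂ] using NormedSpace.expSeries_div_hasSum_exp x
  have hb : ∀ t : ℝ, 1 < t → HasSum (fun k : ℕ => t ^ (2 : ℝ) * t ^ (-(s.re + 1)) *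
      ((‖w‖ * Real.log t) ^ k / (k.factorial : ℝ))) (t ^ (1 - s.re + ‖w‖)) := by
    intro t ht
    have ht0 : 0 < t := by linarith
    convert! (hexp (‖w‖ * Real.log t)).mul_left (t ^ (2 : ℝ) * t ^ (-(s.re + 1))) using 1
    rw [mul_comm ‖w‖, ← Real.rpow_def_of_pos ht0, ← Real.rpow_add ht0, ← Real.rpow_add ht0]
    congr 1
    ring
  refine MeasureTheory.hasSum_integral_of_dominated_convergence
    (fun k t => t ^ (2 : ℝ) * t ^ (-(s.re + 1)) * ((‖w‖ * Real.log t) ^ k / (k.factorial : ℝ)))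
    ?_ ?_ ?_ ?_ ?_
  · intro k
    apply Measurable.aestronglyMeasurable
    fun_prop
  · intro k
    filter_upwards [MeasureTheory.ae_restrict_mem measurableSet_Ioi] with t ht
    have ht1 : (1 : ℝ) < t := ht
    have ht0 : 0 < t := by linarith
    have hlog : 0 ≤ Real.log t := Real.log_nonneg ht1.le
    rw [norm_mul, norm_mul, norm_mul, norm_div, norm_pow, norm_pow,
      Complex.norm_cpow_eq_rpow_re_of_pos ht0, Complex.norm_real, Complex.norm_natCast,
      Real.norm_of_nonneg hlog]
    have := hA t ht1.le
    calc _ = ‖A t‖ * (t ^ (-(s + 1)).re * ((‖w‖ * Real.log t) ^ k / (k.factorial : ℝ))) := by ring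
      _ ≤ t ^ (2 : ℝ) * (t ^ (-(s + 1)).re * ((‖w‖ * Real.log t) ^ k / (k.factorial : ℝ))) := by
        gcongr
      _ = _ := by simp; ring
  · filter_upwards [MeasureTheory.ae_restrict_mem measurableSet_Ioi] with t ht
    exact (hb t ht).summable
  · have : MeasureTheory.IntegrableOn (fun t : ℝ => t ^ (1 - s.re + ‖w‖)) (Set.Ioi 1) :=
      integrableOn_Ioi_rpow_of_lt (by linarith) one_pos
    refine this.congr_fun ?_ measurableSet_Ioi
    intro t ht
    exact (hb t ht).tsum_eq.symm
  · filter_upwards [MeasureTheory.ae_restrict_mem measurableSet_Ioi] with t ht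
    have ht1 : (1 : ℝ) < t := ht
    have ht0 : (t : ℂ) ≠ 0 := by
      have : t ≠ 0 := by linarith
      exact_mod_cast this
    convert! (hcexp (Real.log t * w)).mul_left (A t * (t : ℂ) ^ (-(s + 1))) using 1
    · ext k
      rw [mul_pow]
      ring
    · rw [Complex.ofReal_log (by linarith), ← Complex.cpow_def_of_ne_zero ht0, mul_assoc,
        ← Complex.cpow_add _ _ ht0]
      congr 2
      ring

lemma log_pow_div_factorial_le {t b : ℝ} (ht : 1 ≤ t) (hb : 0 < b) (k : ℕ) :
    Real.log t ^ k / (k.factorial : ℝ) ≤ (b⁻¹) ^ k * t ^ b := by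
  have hlog : 0 ≤ Real.log t := Real.log_nonneg ht
  have h := Real.pow_div_factorial_le_exp (x := Real.log t * b) (by positivity) k
  rw [← Real.rpow_def_of_pos (by linarith), mul_pow] at h
  calc Real.log t ^ k / (k.factorial : ℝ)
      = (b⁻¹) ^ k * (Real.log t ^ k * b ^ k / (k.factorial : ℝ)) := by
        rw [inv_pow]; field_simp
    _ ≤ _ := by gcongr

lemma norm_logMoment_le {A : ℝ → ℂ}
    (hA : ∀ t : ℝ, 1 ≤ t → ‖A t‖ ≤ t ^ (2 : ℝ)) {s : ℂ} {X Z θ ε b₁ b₂ b₃ : ℝ} (hX : 1 ≤ X)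
    (hZ : 1 ≤ Z) (hXZ : ∀ t ∈ Set.Icc X Z, ‖A t‖ ≤ t ^ θ) (hε : 0 < ε)
    (h₁ : 0 < b₁) (h₂ : 0 < b₂) (h₃ : 0 < b₃) (hb₁ : s.re ≤ b₁ + 2 + ε) (hb₂ : b₂ + 2 + ε ≤ s.re)
    (hb₃ : b₃ + θ + ε ≤ s.re) (k : ℕ) :
    ‖logMoment A s k‖ ≤ ε⁻¹ * ((b₁⁻¹) ^ k * X ^ (b₁ + 2 + ε - s.re) +
      (b₂⁻¹) ^ k * Z ^ (b₂ + 2 + ε - s.re) + (b₃⁻¹) ^ k) := by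
  set C := (b₁⁻¹) ^ k * X ^ (b₁ + 2 + ε - s.re) +
      (b₂⁻¹) ^ k * Z ^ (b₂ + 2 + ε - s.re) + (b₃⁻¹) ^ k with hC
  have hgint : MeasureTheory.IntegrableOn (fun t : ℝ => C * t ^ (-1 - ε)) (Set.Ioi 1) :=
    (integrableOn_Ioi_rpow_of_lt (by linarith) one_pos).const_mul _
  have hval : ∫ t in Set.Ioi (1 : ℝ), C * t ^ (-1 - ε) = ε⁻¹ * C := by
    rw [MeasureTheory.integral_const_mul, integral_Ioi_rpow_of_lt (by linarith) one_pos,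
      Real.one_rpow, show -1 - ε + 1 = -ε by ring, neg_div_neg_eq]
    ring
  rw [← hval, logMoment]
  refine MeasureTheory.norm_integral_le_of_norm_le hgint ?_
  filter_upwards [MeasureTheory.ae_restrict_mem measurableSet_Ioi] with t ht
  have ht1 : (1 : ℝ) < t := ht
  have ht0 : 0 < t := by linarith
  have hX0 : 0 < X := by linarith
  have hZ0 : 0 < Z := by linarith
  have hlog : 0 ≤ Real.log t := Real.log_nonneg ht1.le
  rw [norm_mul, norm_mul, norm_div, norm_pow,
    Complex.norm_cpow_eq_rpow_re_of_pos ht0, Complex.norm_real, Complex.norm_natCast,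
    Real.norm_of_nonneg hlog]
  have hre : (-(s + 1)).re = -(s.re + 1) := by simp
  rw [hre]
  have key : ∀ α b D : ℝ, 0 < b → ‖A t‖ ≤ t ^ α → t ^ (b + α + ε - s.re) ≤ D →
      ‖A t‖ * (Real.log t ^ k / (k.factorial : ℝ)) * t ^ (-(s.re + 1)) ≤
        (b⁻¹) ^ k * D * t ^ (-1 - ε) := by
    intro α b D hb h1 h2
    calc _ ≤ t ^ α * ((b⁻¹) ^ k * t ^ b) * t ^ (-(s.re + 1)) := by
            gcongr
            exact log_pow_div_factorial_le ht1.le hb k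
      _ = (b⁻¹) ^ k * (t ^ α * t ^ b * t ^ (-(s.re + 1))) := by ring
      _ = (b⁻¹) ^ k * (t ^ (b + α + ε - s.re) * t ^ (-1 - ε)) := by
        rw [← Real.rpow_add ht0, ← Real.rpow_add ht0, ← Real.rpow_add ht0]
        congr 2
        ring
      _ ≤ (b⁻¹) ^ k * (D * t ^ (-1 - ε)) := by gcongr
      _ = _ := by ring
  have hp1 : 0 ≤ (b₁⁻¹) ^ k * X ^ (b₁ + 2 + ε - s.re) := by positivity
  have hp2 : 0 ≤ (b₂⁻¹) ^ k * Z ^ (b₂ + 2 + ε - s.re) := by positivity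
  have hp3 : 0 ≤ (b₃⁻¹) ^ k := by positivity
  rcases lt_or_ge t X with htX | htX
  · refine (key 2 b₁ _ h₁ (hA t ht1.le)
      (Real.rpow_le_rpow ht0.le htX.le (by linarith))).trans ?_
    gcongr
    linarith
  rcases lt_or_ge Z t with htZ | htZ
  · refine (key 2 b₂ _ h₂ (hA t ht1.le)
      (Real.rpow_le_rpow_of_nonpos hZ0 htZ.le (by linarith))).trans ?_
    gcongr
    linarith
  · refine (key θ b₃ 1 h₃ (hXZ t ⟨htX, htZ⟩)
      (Real.rpow_le_one_of_one_le_of_nonpos ht1.le (by linarith))).trans ?_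
    gcongr
    linarith

/-- The summatory function of `f` at a real argument. -/
noncomputable def partialSum (f : ℕ → ℂ) (t : ℝ) : ℂ := ∑ k ∈ Finset.Icc 1 ⌊t⌋₊, f k

lemma measurable_partialSum (f : ℕ → ℂ) : Measurable (partialSum f) :=
  (measurable_from_top (f := fun n : ℕ => ∑ k ∈ Finset.Icc 1 n, f k)).comp Nat.measurable_floor

lemma sum_norm_le_sq {f : ℕ → ℂ} (hf : ∀ n, 1 ≤ n → ‖f n‖ ≤ n) (n : ℕ) :
    ∑ k ∈ Finset.Icc 1 n, ‖f k‖ ≤ (n : ℝ) ^ (2 : ℝ) := by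
  calc ∑ k ∈ Finset.Icc 1 n, ‖f k‖ ≤ ∑ k ∈ Finset.Icc 1 n, (n : ℝ) := by
        refine Finset.sum_le_sum fun k hk => ?_
        rw [Finset.mem_Icc] at hk
        exact (hf k hk.1).trans (by exact_mod_cast hk.2)
    _ = (n : ℝ) ^ (2 : ℝ) := by simp [sq]

lemma norm_partialSum_le {f : ℕ → ℂ} (hf : ∀ n, 1 ≤ n → ‖f n‖ ≤ n) (t : ℝ) (ht : 1 ≤ t) :
    ‖partialSum f t‖ ≤ t ^ (2 : ℝ) := by
  refine (norm_sum_le _ _).trans ((sum_norm_le_sq hf _).trans ?_)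
  gcongr
  exact Nat.floor_le (by linarith)

lemma LSeries_eq_mul_integral_partialSum {f : ℕ → ℂ} (hf : ∀ n, 1 ≤ n → ‖f n‖ ≤ n) {s : ℂ}
    (hs : 2 < s.re) :
    LSeries f s = s * ∫ t in Set.Ioi (1 : ℝ), partialSum f t * (t : ℂ) ^ (-(s + 1)) := by
  refine LSeries_eq_mul_integral' f (r := 2) (by norm_num) hs ?_
  refine Asymptotics.IsBigO.of_norm_le fun n => ?_
  rw [Real.norm_of_nonneg (Finset.sum_nonneg fun _ _ => norm_nonneg _)]
  exact sum_norm_le_sq hf n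

lemma ratio_bounds {σ β τ e : ℝ} (hβ : 0 < β) (hβσ : β < σ) (hτ : 0 < τ) (hτ' : τ ≤ 1 / 8)
    (hσ : 6 / τ ^ 2 ≤ σ) (he : e ≤ 1) :
    (σ - β) * (σ * (1 + τ))⁻¹ * Real.exp ((σ * τ + 2 + e) / (σ * (1 + 2 * τ))) < 1 ∧
    (σ - β) * (σ * (1 - τ))⁻¹ * Real.exp ((2 + e - σ * τ) / (σ * (1 - 2 * τ))) < 1 := by
  have hσ0 : 0 < σ := by linarith
  have h6 : 6 ≤ σ * τ ^ 2 := by rwa [div_le_iff₀ (by positivity)] at hσ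
  constructor
  · have hb : 0 < 1 + τ := by linarith
    have h1 : (σ * τ + 2 + e) / (σ * (1 + 2 * τ)) ≤ Real.log (1 + τ) := by
      refine le_trans ?_ (Real.one_sub_inv_le_log_of_pos hb)
      rw [div_le_iff₀ (by positivity)]
      have : (1 - (1 + τ)⁻¹) = τ / (1 + τ) := by field_simp; ring
      rw [this, div_mul_eq_mul_div, le_div_iff₀ hb]
      nlinarith
    have h2 := Real.exp_le_exp.2 h1
    rw [Real.exp_log hb] at h2
    calc _ ≤ (σ - β) * (σ * (1 + τ))⁻¹ * (1 + τ) := by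
            have : 0 ≤ σ - β := by linarith
            gcongr
      _ = (σ - β) / σ := by field_simp
      _ < 1 := by rw [div_lt_one hσ0]; linarith
  · have hb : 0 < 1 - τ := by linarith
    have hb2 : 0 < 1 - 2 * τ := by linarith
    have h1 : (2 + e - σ * τ) / (σ * (1 - 2 * τ)) ≤ Real.log (1 - τ) := by
      refine le_trans ?_ (Real.one_sub_inv_le_log_of_pos hb)
      rw [div_le_iff₀ (by positivity)]
      have : (1 - (1 - τ)⁻¹) = -τ / (1 - τ) := by field_simp; ring
      rw [this, div_mul_eq_mul_div, le_div_iff₀ hb]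
      nlinarith
    have h2 := Real.exp_le_exp.2 h1
    rw [Real.exp_log hb] at h2
    calc _ ≤ (σ - β) * (σ * (1 - τ))⁻¹ * (1 - τ) := by
            have : 0 ≤ σ - β := by linarith
            gcongr
      _ = (σ - β) / σ := by field_simp
      _ < 1 := by rw [div_lt_one hσ0]; linarith

/-- If the Dirichlet series of `f` continues to a meromorphic function with a pole `ρ`, then the
summatory function of `f` is large somewhere in every far enough interval `[X, X ^ (1 + η)]`. -/
theorem eventually_exists_large_partialSum {f : ℕ → ℂ} (hf : ∀ n, 1 ≤ n → ‖f n‖ ≤ n) {F : ℂ → ℂ}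
    (hF : ∀ z, MeromorphicAt F z) (hL : ∀ s, 2 < s.re → LSeries f s = F s) {ρ : ℂ} {θ η : ℝ}
    (htop : meromorphicOrderAt F ρ ≠ ⊤) (hneg : meromorphicOrderAt F ρ < 0) (hθ : 0 < θ)
    (hθρ : θ < ρ.re) (hρ : ρ.re < 1) (hη : 0 < η) (hη1 : η ≤ 1) :
    ∀ᶠ X : ℝ in atTop, ∃ t ∈ Set.Icc X (X ^ (1 + η)), t ^ θ ≤ ‖partialSum f t‖ := by
  set β := ρ.re with hβ
  have hβ0 : 0 < β := hθ.trans hθρ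
  set τ := η / 8 with hτ
  have hτ0 : 0 < τ := by positivity
  have hτ1 : τ ≤ 1 / 8 := by rw [hτ]; linarith
  set ε := (β - θ) / 2 with hε
  have hε0 : 0 < ε := by rw [hε]; linarith
  have hε1 : ε ≤ 1 := by rw [hε]; linarith
  set σ := 6 / τ ^ 2 with hσ
  have h6 : σ * τ ^ 2 = 6 := by rw [hσ]; field_simp
  have hσ384 : 384 ≤ σ := by
    rw [hσ, le_div_iff₀ (by positivity)]
    nlinarith
  have hστ : 48 ≤ σ * τ := by nlinarith
  set s₀ : ℂ := ⟨σ, ρ.im⟩ with hs₀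
  have hs₀re : s₀.re = σ := rfl
  set w₁ : ℂ := s₀ - ρ with hw₁
  have hw₁' : w₁ = ((σ - β : ℝ) : ℂ) := by
    apply Complex.ext <;> simp [hw₁, hs₀, hβ]
  have hw₁n : ‖w₁‖ = σ - β := by
    rw [hw₁', Complex.norm_real, Real.norm_of_nonneg (by linarith)]
  have hw₁0 : w₁ ≠ 0 := by
    rw [← norm_pos_iff, hw₁n]; linarith
  have hρ0 : ρ ≠ 0 := by
    intro h
    rw [h] at hβ
    simp [hβ] at hβ0
  -- the generating function of the moments
  have hFm : ∀ z, MeromorphicAt (fun w => F (s₀ - w)) z := fun z =>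
    (hF (s₀ - z)).comp_analyticAt (by fun_prop)
  have hFo : meromorphicOrderAt (fun w => F (s₀ - w)) w₁ = meromorphicOrderAt F ρ := by
    have h := meromorphicOrderAt_comp_of_deriv_ne_zero (f := F) (g := fun w => s₀ - w) (x := w₁)
      (by fun_prop) (by simp)
    rw [show s₀ - w₁ = ρ by rw [hw₁]; ring] at h
    exact h
  have hDm : ∀ z, MeromorphicAt (fun w : ℂ => (s₀ - w)⁻¹) z := fun z => by fun_prop
  have hDo : meromorphicOrderAt (fun w : ℂ => (s₀ - w)⁻¹) w₁ = ((0 : ℤ) : WithTop ℤ) := by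
    rw [meromorphicOrderAt_eq_int_iff (hDm _)]
    have hne : s₀ - w₁ ≠ 0 := by rwa [show s₀ - w₁ = ρ by rw [hw₁]; ring]
    refine ⟨fun w => (s₀ - w)⁻¹, by fun_prop (disch := exact hne), by simpa using hne, ?_⟩
    filter_upwards with w
    simp
  set Φ : ℂ → ℂ := (fun w => F (s₀ - w)) * fun w => (s₀ - w)⁻¹ with hΦ
  have hΦm : ∀ z, MeromorphicAt Φ z := fun z => (hFm z).mul (hDm z)
  have hΦo : meromorphicOrderAt Φ w₁ = meromorphicOrderAt F ρ := by
    rw [hΦ, meromorphicOrderAt_mul (hFm _) (hDm _), hFo, hDo]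
    simp
  set A := partialSum f with hA
  set c := logMoment A s₀ with hc
  have hsum : ∀ᶠ w in nhds 0, HasSum (fun k => w ^ k * c k) (Φ w) := by
    filter_upwards [Metric.ball_mem_nhds (0 : ℂ) one_pos] with w hw
    rw [mem_ball_zero_iff] at hw
    have hre : 2 < (s₀ - w).re := by
      have := Complex.abs_re_le_norm w
      have := abs_le.1 this
      simp only [Complex.sub_re, hs₀re]
      linarith
    have hne : s₀ - w ≠ 0 := by
      intro h
      rw [h] at hre
      norm_num at hre
    convert! hasSum_logMoment (measurable_partialSum f) (norm_partialSum_le hf) (s := s₀) (w := w)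
      (by rw [hs₀re]; linarith) using 1
    rw [hΦ, Pi.mul_apply, ← hL _ hre, LSeries_eq_mul_integral_partialSum hf hre]
    field_simp
  obtain ⟨M, c₀, K, hc₀, hrec⟩ := recurrentlyLarge_of_meromorphic hw₁0 hΦm (by rwa [hΦo])
    (by rwa [hΦo]) hsum
  rw [hw₁n] at hrec
  -- the upper bound for the moments
  set κ₁ := σ * (1 + 2 * τ) with hκ₁
  set κ₂ := σ * (1 - 2 * τ) with hκ₂
  have hκ₁0 : 0 < κ₁ := by positivity
  have hκ₂0 : 0 < κ₂ := mul_pos (by linarith) (by linarith)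
  set b₁ := σ * (1 + τ) with hb₁
  set b₂ := σ * (1 - τ) with hb₂
  set b₃ := σ - θ - ε with hb₃
  have hb₁0 : 0 < b₁ := by positivity
  have hb₂0 : 0 < b₂ := mul_pos (by linarith) (by linarith)
  have hb₃0 : 0 < b₃ := by rw [hb₃]; linarith
  obtain ⟨hr₁, hr₂⟩ := ratio_bounds (σ := σ) hβ0 (by linarith) hτ0 hτ1 le_rfl hε1
  set r₁ := (σ - β) * b₁⁻¹ * Real.exp ((σ * τ + 2 + ε) / κ₁) with hr₁d
  set r₂ := (σ - β) * b₂⁻¹ * Real.exp ((2 + ε - σ * τ) / κ₂) with hr₂d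
  set r₃ := (σ - β) * b₃⁻¹ with hr₃d
  have hσβ : 0 < σ - β := by linarith
  have hr₃ : r₃ < 1 := by
    rw [hr₃d, ← div_eq_mul_inv, div_lt_one hb₃0, hb₃, hε]
    linarith
  have hlim : Tendsto (fun j : ℕ => ε⁻¹ * (r₁ ^ j + r₂ ^ j + r₃ ^ j)) atTop (nhds 0) := by
    have h := (((tendsto_pow_atTop_nhds_zero_of_lt_one (by positivity) hr₁).add
      (tendsto_pow_atTop_nhds_zero_of_lt_one (by positivity) hr₂)).add
      (tendsto_pow_atTop_nhds_zero_of_lt_one (by positivity) hr₃)).const_mul ε⁻¹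
    simpa using h
  obtain ⟨J, hJ⟩ := eventually_atTop.1 (hlim.eventually (gt_mem_nhds hc₀))
  have hlarge : ∀ j ≥ J, c₀ ≤ ‖c j‖ * (σ - β) ^ j →
      ∃ t ∈ Set.Icc (Real.exp (j / κ₁)) (Real.exp (j / κ₂)), t ^ θ ≤ ‖A t‖ := by
    intro j hj hcj
    by_contra! hcon
    have hbd := norm_logMoment_le (A := A) (norm_partialSum_le hf) (s := s₀)
      (X := Real.exp (j / κ₁)) (Z := Real.exp (j / κ₂)) (θ := θ) (ε := ε) (b₁ := b₁) (b₂ := b₂)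
      (b₃ := b₃) (Real.one_le_exp (by positivity)) (Real.one_le_exp (by positivity))
      (fun t ht => (hcon t ht).le) hε0 hb₁0 hb₂0 hb₃0
      (by rw [hs₀re, hb₁]; linarith) (by rw [hs₀re, hb₂]; linarith)
      (by rw [hs₀re, hb₃]; linarith) j
    have e1 : Real.exp (j / κ₁) ^ (b₁ + 2 + ε - s₀.re) =
        Real.exp ((σ * τ + 2 + ε) / κ₁) ^ j := by
      rw [← Real.exp_mul, ← Real.exp_nat_mul, hs₀re, hb₁]
      congr 1
      ring
    have e2 : Real.exp (j / κ₂) ^ (b₂ + 2 + ε - s₀.re) =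
        Real.exp ((2 + ε - σ * τ) / κ₂) ^ j := by
      rw [← Real.exp_mul, ← Real.exp_nat_mul, hs₀re, hb₂]
      congr 1
      ring
    rw [e1, e2] at hbd
    have h1 := hJ j hj
    have h2 : ‖c j‖ * (σ - β) ^ j ≤ ε⁻¹ * (r₁ ^ j + r₂ ^ j + r₃ ^ j) := by
      refine (mul_le_mul_of_nonneg_right hbd (by positivity)).trans (le_of_eq ?_)
      rw [hr₁d, hr₂d, hr₃d]
      simp only [mul_pow]
      ring
    linarith
  -- from windows of exponents to intervals
  have hgap : 0 < (1 + η) * κ₂ - κ₁ := by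
    have : (1 + η) * κ₂ - κ₁ = σ * (η - 2 * τ * (2 + η)) := by rw [hκ₁, hκ₂]; ring
    rw [this]
    apply mul_pos (by linarith)
    rw [hτ]
    nlinarith
  filter_upwards [eventually_ge_atTop 1,
    Real.tendsto_log_atTop.eventually_ge_atTop ((max K J : ℕ) / κ₁),
    Real.tendsto_log_atTop.eventually_ge_atTop ((1 + M) / ((1 + η) * κ₂ - κ₁))] with X hX1 hX2 hX3
  rw [div_le_iff₀ hκ₁0] at hX2
  rw [div_le_iff₀ hgap] at hX3
  have hX0 : 0 < X := by linarith
  have hlogX : 0 ≤ Real.log X := Real.log_nonneg hX1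
  set k := ⌈κ₁ * Real.log X⌉₊ with hk
  have hk1 : κ₁ * Real.log X ≤ k := Nat.le_ceil _
  have hk2 : (k : ℝ) < κ₁ * Real.log X + 1 := Nat.ceil_lt_add_one (by positivity)
  have hkm : max K J ≤ k := by
    have : ((max K J : ℕ) : ℝ) ≤ k := by linarith
    exact_mod_cast this
  obtain ⟨j, hj1, hj2, hj3⟩ := hrec k ((le_max_left _ _).trans hkm)
  obtain ⟨t, ⟨ht1, ht2⟩, ht3⟩ := hlarge j ((le_max_right _ _).trans (hkm.trans hj1)) hj3
  have hj1' : (k : ℝ) ≤ j := by exact_mod_cast hj1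
  have hj2' : (j : ℝ) ≤ k + M := by exact_mod_cast hj2
  refine ⟨t, ⟨le_trans ?_ ht1, ht2.trans ?_⟩, ht3⟩
  · rw [← Real.log_le_iff_le_exp hX0, le_div_iff₀ hκ₁0]
    linarith
  · rw [Real.rpow_def_of_pos hX0, Real.exp_le_exp, div_le_iff₀ hκ₂0]
    linarith

lemma meromorphicAt_LFunction {N : ℕ} [NeZero N] (χ : DirichletCharacter ℂ N) (z : ℂ) :
    MeromorphicAt (DirichletCharacter.LFunction χ) z := by
  by_cases hχ : χ = 1
  · subst hχ
    have h : MeromorphicAt (fun s => (s - 1)⁻¹ * DirichletCharacter.LFunctionTrivChar₁ N s) z :=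
      MeromorphicAt.mul (by fun_prop)
        ((DirichletCharacter.differentiable_LFunctionTrivChar₁ N).analyticAt z).meromorphicAt
    refine h.congr ?_
    have hne : ∀ᶠ s in nhdsWithin z {z}ᶜ, s ≠ 1 := by
      by_cases hz : z = 1
      · subst hz
        exact eventually_mem_nhdsWithin
      · exact eventually_nhdsWithin_of_eventually_nhds (isOpen_ne.mem_nhds hz)
    filter_upwards [hne] with s hs
    have : s - 1 ≠ 0 := sub_ne_zero.2 hs
    simp [Function.update_of_ne hs, this, DirichletCharacter.LFunctionTrivChar]
  · exact ((DirichletCharacter.differentiable_LFunction hχ).analyticAt z).meromorphicAt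

lemma meromorphicAt_riemannZeta (z : ℂ) : MeromorphicAt riemannZeta z := by
  rw [← DirichletCharacter.LFunction_modOne_eq (χ := 1)]
  exact meromorphicAt_LFunction _ z

lemma analyticAt_LFunction {N : ℕ} [NeZero N] (χ : DirichletCharacter ℂ N) {s : ℂ} (hs : s ≠ 1) :
    AnalyticAt ℂ (DirichletCharacter.LFunction χ) s := by
  rw [Complex.analyticAt_iff_eventually_differentiableAt]
  filter_upwards [isOpen_ne.mem_nhds hs] with z hz
  exact DirichletCharacter.differentiableAt_LFunction χ z (Or.inl hz)

lemma analyticAt_riemannZeta {s : ℂ} (hs : s ≠ 1) : AnalyticAt ℂ riemannZeta s := by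
  rw [← DirichletCharacter.LFunction_modOne_eq (χ := 1)]
  exact analyticAt_LFunction _ hs

lemma meromorphicOrderAt_logDeriv_LFunction {N : ℕ} [NeZero N] (χ : DirichletCharacter ℂ N) {ρ : ℂ}
    (hρ : ρ ≠ 1) (h0 : DirichletCharacter.LFunction χ ρ = 0) :
    meromorphicOrderAt (logDeriv (DirichletCharacter.LFunction χ)) ρ = -1 := by
  refine meromorphicOrderAt_logDeriv_eq_neg_one (meromorphicAt_LFunction χ ρ) ?_ ?_
  · rw [Ne, (analyticAt_LFunction χ hρ).meromorphicNFAt.meromorphicOrderAt_eq_zero_iff]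
    simp [h0]
  · have hm : MeromorphicOn (DirichletCharacter.LFunction χ) Set.univ :=
      fun z _ => meromorphicAt_LFunction χ z
    refine hm.meromorphicOrderAt_ne_top_of_isPreconnected (x := 2) isPreconnected_univ
      (Set.mem_univ _) (Set.mem_univ _) ?_
    have h2 : (2 : ℂ) ≠ 1 := by norm_num
    have hL2 := DirichletCharacter.LFunction_ne_zero_of_one_le_re χ (s := 2) (Or.inr h2)
      (by norm_num)
    rw [← (analyticAt_LFunction χ h2).meromorphicNFAt.meromorphicOrderAt_eq_zero_iff] at hL2
    simp [hL2]

/-- The mean value of a Dirichlet character on residue classes prime to the modulus. -/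
noncomputable def charMean {N : ℕ} (χ : DirichletCharacter ℂ N) : ℝ := if χ = 1 then 1 else 0

lemma charMean_nonneg {N : ℕ} (χ : DirichletCharacter ℂ N) : 0 ≤ charMean χ := by
  unfold charMean; split_ifs <;> norm_num

lemma charMean_le_one {N : ℕ} (χ : DirichletCharacter ℂ N) : charMean χ ≤ 1 := by
  unfold charMean; split_ifs <;> norm_num

/-- The coefficients `χ(n) Λ(n)`, minus the expected value of their mean. -/
noncomputable def centeredVonMangoldt {N : ℕ} (χ : DirichletCharacter ℂ N) (n : ℕ) : ℂ :=
  χ n * (ArithmeticFunction.vonMangoldt n : ℂ) - (charMean χ : ℂ)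

lemma norm_centeredVonMangoldt_le {N : ℕ} (χ : DirichletCharacter ℂ N) (n : ℕ) (hn : 1 ≤ n) :
    ‖centeredVonMangoldt χ n‖ ≤ n := by
  have hn0 : (0 : ℝ) < n := by exact_mod_cast hn
  have h1 : ‖χ (n : ZMod N) * (ArithmeticFunction.vonMangoldt n : ℂ)‖ ≤ Real.log n := by
    rw [norm_mul, Complex.norm_real, Real.norm_of_nonneg ArithmeticFunction.vonMangoldt_nonneg]
    calc _ ≤ 1 * ArithmeticFunction.vonMangoldt n := by
            gcongr
            exact DirichletCharacter.norm_le_one χ _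
      _ ≤ Real.log n := by rw [one_mul]; exact ArithmeticFunction.vonMangoldt_le_log
  have h2 : ‖(charMean χ : ℂ)‖ ≤ 1 := by
    rw [Complex.norm_real, Real.norm_of_nonneg (charMean_nonneg χ)]
    exact charMean_le_one χ
  have h3 := Real.log_le_sub_one_of_pos hn0
  exact (norm_sub_le _ _).trans (by linarith)

lemma LSeries_centeredVonMangoldt {N : ℕ} [NeZero N] (χ : DirichletCharacter ℂ N) {s : ℂ}
    (hs : 1 < s.re) : LSeries (centeredVonMangoldt χ) s =
      -logDeriv (DirichletCharacter.LFunction χ) s + -((charMean χ : ℂ) * riemannZeta s) := by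
  have h : centeredVonMangoldt χ =
      ((fun n : ℕ => χ n) * fun n => (ArithmeticFunction.vonMangoldt n : ℂ)) -
        (charMean χ : ℂ) • (1 : ℕ → ℂ) := by
    ext n
    simp [centeredVonMangoldt]
  rw [h, LSeries_sub (DirichletCharacter.LSeriesSummable_twist_vonMangoldt χ hs)
    ((LSeriesSummable_one_iff.2 hs).smul _), LSeries_smul, LSeries_one_eq_riemannZeta hs,
    DirichletCharacter.LSeries_twist_vonMangoldt_eq χ hs, logDeriv_apply,
    DirichletCharacter.deriv_LFunction_eq_deriv_LSeries χ hs,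
    DirichletCharacter.LFunction_eq_LSeries χ hs]
  ring

theorem eventually_exists_large_centeredVonMangoldt {N : ℕ} [NeZero N] (χ : DirichletCharacter ℂ N)
    {ρ : ℂ} {θ η : ℝ} (h0 : DirichletCharacter.LFunction χ ρ = 0) (hθ : 0 < θ)
    (hθρ : θ < ρ.re) (hρ : ρ.re < 1) (hη : 0 < η) (hη1 : η ≤ 1) :
    ∀ᶠ X : ℝ in atTop, ∃ t ∈ Set.Icc X (X ^ (1 + η)),
      t ^ θ ≤ ‖partialSum (centeredVonMangoldt χ) t‖ := by
  have hρ1 : ρ ≠ 1 := by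
    rintro rfl
    simp at hρ
  have hm1 : ∀ z, MeromorphicAt (-logDeriv (DirichletCharacter.LFunction χ)) z := fun z =>
    (meromorphicAt_LFunction χ z).logDeriv.neg
  have hm2 : ∀ z, MeromorphicAt (fun s => -((charMean χ : ℂ) * riemannZeta s)) z := fun z =>
    ((MeromorphicAt.const _ z).mul (meromorphicAt_riemannZeta z)).neg
  have ho1 : meromorphicOrderAt (-logDeriv (DirichletCharacter.LFunction χ)) ρ = -1 := by
    rw [← meromorphicOrderAt_neg, meromorphicOrderAt_logDeriv_LFunction χ hρ1 h0]
  have ho2 : 0 ≤ meromorphicOrderAt (fun s => -((charMean χ : ℂ) * riemannZeta s)) ρ :=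
    AnalyticAt.meromorphicOrderAt_nonneg
      ((analyticAt_const.mul (analyticAt_riemannZeta hρ1)).neg)
  have hlt : (-1 : WithTop ℤ) < 0 := by decide
  have ho := meromorphicOrderAt_add_eq_left_of_lt (hm2 ρ)
    (f₁ := -logDeriv (DirichletCharacter.LFunction χ)) (by rw [ho1]; exact hlt.trans_le ho2)
  rw [ho1] at ho
  refine eventually_exists_large_partialSum (norm_centeredVonMangoldt_le χ)
    (fun z => (hm1 z).add (hm2 z))
    (fun s hs => LSeries_centeredVonMangoldt χ (by linarith)) (ρ := ρ) ?_ ?_ hθ hθρ hρ hη hη1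
  · rw [ho]; decide
  · rw [ho]; exact hlt

lemma exists_primitive_zero {N : ℕ} [NeZero N] (χ : DirichletCharacter ℂ N) {s : ℂ}
    (hs0 : 0 < s.re) (hs1 : s.re < 1) (h0 : DirichletCharacter.LFunction χ s = 0) :
    ∃ (M : ℕ) (_ : NeZero M) (ψ : DirichletCharacter ℂ M), ψ.IsPrimitive ∧ (χ ≠ 1 → ψ ≠ 1) ∧
      DirichletCharacter.LFunction ψ s = 0 := by
  have hne : NeZero χ.conductor := ⟨fun h => NeZero.ne N
    (Nat.eq_zero_of_zero_dvd (h ▸ χ.conductor_dvd_level))⟩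
  refine ⟨χ.conductor, hne, χ.primitiveCharacter, χ.primitiveCharacter_isPrimitive, ?_, ?_⟩
  · intro hχ h
    apply hχ
    rw [← χ.changeLevel_primitiveCharacter, h, DirichletCharacter.changeLevel_one]
  · rw [← χ.changeLevel_primitiveCharacter, DirichletCharacter.LFunction_changeLevel
      χ.conductor_dvd_level _ (Or.inr (by rintro rfl; simp at hs1))] at h0
    refine (mul_eq_zero.1 h0).resolve_right (Finset.prod_ne_zero_iff.2 fun p hp h => ?_)
    have hp := Nat.prime_of_mem_primeFactors hp
    have h1 : ‖χ.primitiveCharacter (p : ZMod χ.conductor) * (p : ℂ) ^ (-s)‖ < 1 := by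
      rw [norm_mul, Complex.norm_natCast_cpow_of_pos hp.pos]
      have h2 : (p : ℝ) ^ (-s).re < 1 :=
        Real.rpow_lt_one_of_one_lt_of_neg (by exact_mod_cast hp.one_lt) (by simpa using hs0)
      have h3 := DirichletCharacter.norm_le_one χ.primitiveCharacter (p : ZMod χ.conductor)
      have h4 : 0 ≤ (p : ℝ) ^ (-s).re := by positivity
      nlinarith
    rw [← sub_eq_zero.1 h] at h1
    simp at h1

lemma gammaFactor_ne_zero {N : ℕ} (χ : DirichletCharacter ℂ N) {s : ℂ} (hs : 0 < s.re) :
    χ.gammaFactor s ≠ 0 := by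
  rcases χ.even_or_odd with h | h
  · rw [h.gammaFactor_def]
    exact Complex.Gammaℝ_ne_zero_of_re_pos hs
  · rw [h.gammaFactor_def]
    exact Complex.Gammaℝ_ne_zero_of_re_pos (by simp; linarith)

lemma LFunction_inv_one_sub_eq_zero {N : ℕ} [NeZero N] {χ : DirichletCharacter ℂ N}
    (hχ : χ.IsPrimitive) {s : ℂ} (hs0 : 0 < s.re) (hs1 : s.re < 1)
    (h0 : DirichletCharacter.LFunction χ s = 0) : DirichletCharacter.LFunction χ⁻¹ (1 - s) = 0 := by
  have hne : s ≠ 0 := by rintro rfl; simp at hs0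
  have hne' : 1 - s ≠ 0 := fun h => by
    rw [← sub_eq_zero.1 h] at hs1
    simp at hs1
  have hχ' : χ⁻¹.IsPrimitive := by
    unfold DirichletCharacter.IsPrimitive at hχ ⊢
    rw [DirichletCharacter.conductor_inv, hχ]
  rw [DirichletCharacter.LFunction_eq_completed_div_gammaFactor χ s (Or.inl hne),
    div_eq_zero_iff] at h0
  have h1 := h0.resolve_right (gammaFactor_ne_zero χ hs0)
  rw [DirichletCharacter.LFunction_eq_completed_div_gammaFactor _ _ (Or.inl hne'),
    hχ'.completedLFunction_one_sub, inv_inv, h1]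
  simp

/-- Failure of the Riemann hypothesis for a character yields a zero to the right of the critical
line for a possibly different character. -/
theorem exists_zero_of_not_GRHchi {N : ℕ} {χ : DirichletCharacter ℂ N} (h : ¬ GRHchi χ) :
    ∃ (M : ℕ) (_ : NeZero M) (ψ : DirichletCharacter ℂ M) (ρ : ℂ), (χ ≠ 1 → ψ ≠ 1) ∧
      1 / 2 < ρ.re ∧ ρ.re < 1 ∧ DirichletCharacter.LFunction ψ ρ = 0 := by
  simp only [GRHchi, not_forall] at h
  obtain ⟨s, hs0, hs1, hs, hne⟩ := h
  have hN : N ≠ 0 := by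
    intro h
    simp [Lfunc, h] at hs
  have : NeZero N := ⟨hN⟩
  simp only [Lfunc, hN, dif_neg, not_false_eq_true] at hs
  obtain ⟨M, hM, ψ, hψ, hψ1, hψs⟩ := exists_primitive_zero χ hs0 hs1 hs
  rcases lt_or_gt_of_ne hne with hlt | hgt
  · exact ⟨M, hM, ψ⁻¹, 1 - s, fun h => by simpa using hψ1 h, by simp; linarith,
      by simpa using hs0, LFunction_inv_one_sub_eq_zero hψ hs0 hs1 hψs⟩
  · exact ⟨M, hM, ψ, s, hψ1, hgt, hs1, hψs⟩

/-- The variance about `c` of the sums of `g` over the classes prime to `q` of a set `T`. -/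
noncomputable def progressionVariance (T : Finset ℕ) (g : ℕ → ℝ) (q : ℕ) (c : ℝ) : ℝ :=
  ∑ a ∈ (Finset.range q).filter (fun a => Nat.Coprime a q),
    ((∑ n ∈ T.filter (fun n => n % q = a), g n) - c) ^ 2

lemma sum_coprime_character_mul {q : ℕ} (ψ : DirichletCharacter ℂ q) (hq : q ≠ 0)
    (T : Finset ℕ) (g : ℕ → ℂ) :
    ∑ a ∈ (Finset.range q).filter (fun a => Nat.Coprime a q),
      ψ a * ∑ n ∈ T.filter (fun n => n % q = a), g n = ∑ n ∈ T, ψ n * g n := by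
  have h0 : ∑ n ∈ T, ψ n * g n = ∑ n ∈ T.filter (fun n => Nat.Coprime n q), ψ n * g n := by
    rw [Finset.sum_filter]
    refine Finset.sum_congr rfl fun n _ => ?_
    split_ifs with h
    · rfl
    · rw [ψ.map_nonunit (by rwa [ZMod.isUnit_iff_coprime]), zero_mul]
  rw [h0, ← Finset.sum_fiberwise_of_maps_to (s := T.filter (fun n => Nat.Coprime n q))
    (g := fun n => n % q)
    (t := (Finset.range q).filter (fun a => Nat.Coprime a q))]
  · refine Finset.sum_congr rfl fun a ha => ?_
    rw [Finset.mem_filter, Finset.mem_range] at ha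
    rw [Finset.mul_sum, Finset.filter_filter]
    refine Finset.sum_congr ?_ fun n hn => ?_
    · ext n
      simp only [Finset.mem_filter, and_congr_right_iff]
      refine fun _ => ⟨fun h => ⟨?_, h⟩, fun h => h.2⟩
      rw [← h, Nat.Coprime, ← Nat.gcd_rec, Nat.gcd_comm] at ha
      exact ha.2
    · rw [Finset.mem_filter] at hn
      rw [← hn.2.2, ZMod.natCast_mod]
  · intro n hn
    rw [Finset.mem_filter] at hn
    rw [Finset.mem_filter, Finset.mem_range]
    refine ⟨Nat.mod_lt _ (Nat.pos_of_ne_zero hq), ?_⟩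
    rw [Nat.Coprime, ← Nat.gcd_rec, Nat.gcd_comm]
    exact hn.2

lemma sum_coprime_character {q : ℕ} (ψ : DirichletCharacter ℂ q) (hq : q ≠ 0) :
    ∑ a ∈ (Finset.range q).filter (fun a => Nat.Coprime a q), ψ (a : ZMod q) =
      ((charMean ψ * q.totient : ℝ) : ℂ) := by
  have : NeZero q := ⟨hq⟩
  have h0 : ∑ a ∈ (Finset.range q).filter (fun a => Nat.Coprime a q), ψ (a : ZMod q) =
      ∑ x : ZMod q, ψ x := by
    rw [Finset.sum_filter]
    refine Finset.sum_nbij' (fun a => (a : ZMod q)) ZMod.val (by simp) (by simp [ZMod.val_lt]) ?_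
      (by simp) ?_
    · intro a ha
      exact ZMod.val_cast_of_lt (Finset.mem_range.1 ha)
    · intro a _
      split_ifs with h
      · rfl
      · rw [ψ.map_nonunit (by rwa [ZMod.isUnit_iff_coprime])]
  by_cases hψ : ψ = 1
  · rw [charMean, if_pos hψ, one_mul, Nat.totient_eq_card_coprime, Finset.card_eq_sum_ones]
    push_cast
    refine Finset.sum_congr (by simp [Nat.coprime_comm]) fun a ha => ?_
    rw [Finset.mem_filter] at ha
    rw [hψ, MulChar.one_apply ((ZMod.isUnit_iff_coprime a q).2 (Nat.coprime_comm.1 ha.2))]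
  · rw [h0, MulChar.sum_eq_zero_of_ne_one hψ, charMean, if_neg hψ]
    simp

lemma norm_sum_character_sub_le {q : ℕ} (ψ : DirichletCharacter ℂ q) (hq : q ≠ 0)
    (T : Finset ℕ) (g : ℕ → ℝ) (c : ℝ) :
    ‖∑ n ∈ T, ψ n * (g n : ℂ) - ((charMean ψ * q.totient * c : ℝ) : ℂ)‖ ≤
      √(q * progressionVariance T g q c) := by
  refine Real.le_sqrt_of_sq_le ?_
  rw [← sum_coprime_character_mul ψ hq, Complex.ofReal_mul, ← sum_coprime_character ψ hq,
    Finset.sum_mul, ← Finset.sum_sub_distrib]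
  set S := (Finset.range q).filter (fun a => Nat.Coprime a q)
  have hcard : (S.card : ℝ) ≤ q := by
    exact_mod_cast (Finset.card_filter_le _ _).trans (by simp)
  have hnn : 0 ≤ progressionVariance T g q c := Finset.sum_nonneg fun _ _ => sq_nonneg _
  calc _ ≤ (∑ a ∈ S, |(∑ n ∈ T.filter (fun n => n % q = a), g n) - c|) ^ 2 := by
        gcongr
        refine norm_sum_le_of_le _ fun a _ => ?_
        rw [← mul_sub, norm_mul, ← Complex.ofReal_sum, ← Complex.ofReal_sub, Complex.norm_real,
          Real.norm_eq_abs]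
        exact mul_le_of_le_one_left (abs_nonneg _) (ψ.norm_le_one _)
    _ ≤ S.card * ∑ a ∈ S, |(∑ n ∈ T.filter (fun n => n % q = a), g n) - c| ^ 2 :=
        sq_sum_le_card_mul_sum_sq
    _ = S.card * progressionVariance T g q c := by simp only [sq_abs]; rfl
    _ ≤ _ := by gcongr

lemma changeLevel_natCast {N q : ℕ} (hNq : N ∣ q) (χ : DirichletCharacter ℂ N) (n : ℕ) :
    DirichletCharacter.changeLevel hNq χ (n : ZMod q) = if n.Coprime q then χ n else 0 := by
  split_ifs with h
  · have := DirichletCharacter.changeLevel_eq_cast_of_dvd χ hNq (ZMod.unitOfCoprime n h)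
    rw [ZMod.coe_unitOfCoprime] at this
    rw [this, ZMod.cast_natCast hNq]
  · exact MulChar.map_nonunit _ (by rwa [ZMod.isUnit_iff_coprime])

lemma charMean_changeLevel {N q : ℕ} (hNq : N ∣ q) (hq : q ≠ 0) (χ : DirichletCharacter ℂ N) :
    charMean (DirichletCharacter.changeLevel hNq χ) = charMean χ := by
  have : NeZero q := ⟨hq⟩
  simp [charMean, DirichletCharacter.changeLevel_eq_one_iff]

lemma norm_character_mul_vonMangoldt_sub_le {N q : ℕ} (hNq : N ∣ q) (χ : DirichletCharacter ℂ N)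
    {g : ℕ → ℝ} (hg0 : ∀ n, 0 ≤ g n) (hgΛ : ∀ n, g n ≤ ArithmeticFunction.vonMangoldt n)
    (hgp : ∀ p : ℕ, p.Prime → g p = ArithmeticFunction.vonMangoldt p) (n : ℕ) :
    ‖χ n * (ArithmeticFunction.vonMangoldt n : ℂ) -
      DirichletCharacter.changeLevel hNq χ n * (g n : ℂ)‖ ≤
      (if ¬ n.Prime then 2 * ArithmeticFunction.vonMangoldt n else 0) +
        (if n ∣ q then ArithmeticFunction.vonMangoldt n else 0) := by
  have hΛ : 0 ≤ ArithmeticFunction.vonMangoldt n := ArithmeticFunction.vonMangoldt_nonneg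
  have h1 : ‖χ n * (ArithmeticFunction.vonMangoldt n : ℂ)‖ ≤
      ArithmeticFunction.vonMangoldt n := by
    rw [norm_mul, Complex.norm_real, Real.norm_of_nonneg hΛ]
    exact mul_le_of_le_one_left hΛ (χ.norm_le_one _)
  have h2 : ‖DirichletCharacter.changeLevel hNq χ n * (g n : ℂ)‖ ≤
      ArithmeticFunction.vonMangoldt n := by
    rw [norm_mul, Complex.norm_real, Real.norm_of_nonneg (hg0 n)]
    exact (mul_le_of_le_one_left (hg0 n) (DirichletCharacter.norm_le_one _ _)).trans (hgΛ n)
  have h3 : 0 ≤ if n ∣ q then ArithmeticFunction.vonMangoldt n else 0 := by split_ifs <;> simp [hΛ]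
  by_cases hn : n.Prime
  · rw [if_neg (not_not.2 hn), zero_add, hgp n hn, changeLevel_natCast]
    by_cases hnq : n ∣ q
    · rw [if_neg, if_pos hnq]
      · simpa using h1
      · rw [hn.coprime_iff_not_dvd]
        exact not_not.2 hnq
    · rw [if_pos ((hn.coprime_iff_not_dvd).2 hnq)]
      simp [hnq]
  · rw [if_pos hn]
    exact (norm_sub_le _ _).trans (by linarith)

/-- The summatory function of `χ(n) Λ(n)`, with its mean removed, is controlled by the variance in
progressions to a multiple of the modulus of `χ`. -/
lemma norm_partialSum_centeredVonMangoldt_le {N q : ℕ} (hNq : N ∣ q) (hq : q ≠ 0)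
    (χ : DirichletCharacter ℂ N) {g : ℕ → ℝ} (hg0 : ∀ n, 0 ≤ g n)
    (hgΛ : ∀ n, g n ≤ ArithmeticFunction.vonMangoldt n)
    (hgp : ∀ p : ℕ, p.Prime → g p = ArithmeticFunction.vonMangoldt p) {t c : ℝ} (ht : 1 ≤ t)
    (hc : charMean χ * q.totient * c = charMean χ * t) :
    ‖partialSum (centeredVonMangoldt χ) t‖ ≤
      √(q * progressionVariance (Finset.range (⌊t⌋₊ + 1)) g q c) + 4 * √t * Real.log t +
        Real.log q + 1 := by
  set ψ := DirichletCharacter.changeLevel hNq χ with hψ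
  have hrange : ∀ F : ℕ → ℂ, F 0 = 0 →
      ∑ n ∈ Finset.range (⌊t⌋₊ + 1), F n = ∑ n ∈ Finset.Icc 1 ⌊t⌋₊, F n := by
    intro F hF
    rw [Finset.sum_range_succ', hF, add_zero, Finset.range_eq_Ico, Finset.sum_Ico_add' F]
    rfl
  have hg00 : g 0 = 0 := le_antisymm ((hgΛ 0).trans (by simp)) (hg0 0)
  have h1 := norm_sum_character_sub_le ψ hq (Finset.range (⌊t⌋₊ + 1)) g c
  rw [hψ, charMean_changeLevel hNq hq, ← hψ, hc, hrange _ (by simp [hg00])] at h1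
  have h2 : ‖∑ n ∈ Finset.Icc 1 ⌊t⌋₊, (χ n * (ArithmeticFunction.vonMangoldt n : ℂ) -
      ψ n * (g n : ℂ))‖ ≤ 4 * √t * Real.log t + Real.log q := by
    refine (norm_sum_le_of_le _ fun n _ =>
      norm_character_mul_vonMangoldt_sub_le hNq χ hg0 hgΛ hgp n).trans ?_
    rw [Finset.sum_add_distrib]
    refine add_le_add ?_ ?_
    · rw [← Finset.sum_filter, ← Finset.mul_sum]
      have h := Chebyshev.psi_sub_theta_le ht
      rw [Chebyshev.psi_sub_theta_eq_sum_not_prime] at h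
      have he : Finset.Icc 1 ⌊t⌋₊ = Finset.Ioc 0 ⌊t⌋₊ := rfl
      rw [he]
      linarith
    · rw [← Finset.sum_filter, ← ArithmeticFunction.vonMangoldt_sum]
      refine Finset.sum_le_sum_of_subset_of_nonneg (fun n hn => ?_)
        fun _ _ _ => ArithmeticFunction.vonMangoldt_nonneg
      rw [Finset.mem_filter] at hn
      exact Nat.mem_divisors.2 ⟨hn.2, hq⟩
  have h3 : ‖((charMean χ * t : ℝ) : ℂ) - ∑ n ∈ Finset.Icc 1 ⌊t⌋₊, (charMean χ : ℂ)‖ ≤ 1 := by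
    have he : ((charMean χ * t : ℝ) : ℂ) - ∑ n ∈ Finset.Icc 1 ⌊t⌋₊, (charMean χ : ℂ) =
        ((charMean χ * (t - ⌊t⌋₊) : ℝ) : ℂ) := by
      simp
      ring
    have hfl := Nat.floor_le (zero_le_one.trans ht)
    have hfl' := Nat.lt_floor_add_one t
    rw [he, Complex.norm_real, Real.norm_of_nonneg
      (mul_nonneg (charMean_nonneg χ) (by linarith))]
    exact mul_le_one₀ (charMean_le_one χ) (by linarith) (by linarith)
  have he : partialSum (centeredVonMangoldt χ) t =
      (∑ n ∈ Finset.Icc 1 ⌊t⌋₊, ψ n * (g n : ℂ) - ((charMean χ * t : ℝ) : ℂ)) +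
      (∑ n ∈ Finset.Icc 1 ⌊t⌋₊, (χ n * (ArithmeticFunction.vonMangoldt n : ℂ) -
        ψ n * (g n : ℂ))) +
      (((charMean χ * t : ℝ) : ℂ) - ∑ n ∈ Finset.Icc 1 ⌊t⌋₊, (charMean χ : ℂ)) := by
    simp only [partialSum, centeredVonMangoldt, Finset.sum_sub_distrib]
    ring
  rw [he]
  refine (norm_add₃_le).trans ?_
  linarith

lemma Gvar_eq_progressionVariance (x : ℝ) (q : ℕ) :
    Gvar x q = progressionVariance (Finset.range (⌊x⌋₊ + 1))
      (fun n => if n.Prime then Real.log n else 0) q (x / q.totient) := by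
  refine Finset.sum_congr rfl fun a _ => ?_
  rw [thetaQA, ← Finset.sum_filter, Finset.filter_filter]
  simp only [and_comm]

lemma Vvar_eq_progressionVariance (x : ℝ) (q : ℕ) :
    Vvar x q = progressionVariance (Finset.range (⌊x⌋₊ + 1))
      (fun n => ArithmeticFunction.vonMangoldt n) q ((1 / (Nat.totient q : ℝ)) *
        ∑ n ∈ (Finset.range (⌊x⌋₊ + 1)).filter (fun n => Nat.Coprime n q),
          ArithmeticFunction.vonMangoldt n) := rfl

lemma norm_partialSum_le_of_Gvar {N q : ℕ} (hNq : N ∣ q) (hq : q ≠ 0)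
    (χ : DirichletCharacter ℂ N) {t : ℝ} (ht : 1 ≤ t) :
    ‖partialSum (centeredVonMangoldt χ) t‖ ≤
      √(q * Gvar t q) + 4 * √t * Real.log t + Real.log q + 1 := by
  rw [Gvar_eq_progressionVariance]
  have hφ : (q.totient : ℝ) ≠ 0 := by
    exact_mod_cast (Nat.totient_pos.2 (Nat.pos_of_ne_zero hq)).ne'
  refine norm_partialSum_centeredVonMangoldt_le hNq hq χ (fun n => ?_) (fun n => ?_)
    (fun p hp => ?_) ht (by field_simp)
  · split_ifs with h
    · exact Real.log_natCast_nonneg n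
    · exact le_rfl
  · split_ifs with h
    · rw [ArithmeticFunction.vonMangoldt_apply_prime h]
    · exact ArithmeticFunction.vonMangoldt_nonneg
  · rw [if_pos hp, ArithmeticFunction.vonMangoldt_apply_prime hp]

lemma norm_partialSum_le_of_Vvar {N q : ℕ} (hNq : N ∣ q) (hq : q ≠ 0)
    {χ : DirichletCharacter ℂ N} (hχ : χ ≠ 1) {t : ℝ} (ht : 1 ≤ t) :
    ‖partialSum (centeredVonMangoldt χ) t‖ ≤
      √(q * Vvar t q) + 4 * √t * Real.log t + Real.log q + 1 := by
  rw [Vvar_eq_progressionVariance]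
  exact norm_partialSum_centeredVonMangoldt_le hNq hq χ
    (fun n => ArithmeticFunction.vonMangoldt_nonneg) (fun n => le_rfl) (fun p _ => rfl) ht
    (by simp [charMean, hχ])

lemma eventually_rpow_le_of_le_sqrt {δ : ℝ} (hδ : 0 < δ) (hδ1 : δ ≤ 1) :
    ∀ᶠ t : ℝ in atTop, ∀ (q : ℕ) (W : ℝ), q ≠ 0 → (q : ℝ) ≤ t ^ δ →
      t ^ (1 / 2 + 2 * δ) ≤ √(q * W) + 4 * √t * Real.log t + Real.log q + 1 →
      t ^ (1 + δ) ≤ W := by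
  have hlog := (isLittleO_log_rpow_atTop hδ).bound (c := 1) one_pos
  filter_upwards [hlog, eventually_ge_atTop 1,
    (tendsto_rpow_atTop hδ).eventually_gt_atTop 7] with t hlog ht1 ht7 q W hq hqt hW
  have ht0 : 0 < t := by linarith
  have hl0 : 0 ≤ Real.log t := Real.log_nonneg ht1
  rw [Real.norm_of_nonneg hl0, Real.norm_of_nonneg (by positivity), one_mul] at hlog
  by_contra! hcon
  have hq0 : (0 : ℝ) < q := by exact_mod_cast Nat.pos_of_ne_zero hq
  have h1 : √(q * W) ≤ t ^ (1 / 2 + δ) := by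
    refine Real.sqrt_le_iff.2 ⟨by positivity, ?_⟩
    calc q * W ≤ q * t ^ (1 + δ) := by gcongr
      _ ≤ t ^ δ * t ^ (1 + δ) := by gcongr
      _ = (t ^ (1 / 2 + δ)) ^ 2 := by
        rw [← Real.rpow_natCast, ← Real.rpow_mul ht0.le, ← Real.rpow_add ht0]
        congr 1
        push_cast
        ring
  have h2 : √t * Real.log t ≤ t ^ (1 / 2 + δ) := by
    rw [Real.rpow_add ht0, ← Real.sqrt_eq_rpow]
    gcongr
  have h3 : Real.log q ≤ t ^ (1 / 2 + δ) := by
    calc Real.log q ≤ Real.log (t ^ δ) := Real.log_le_log hq0 hqt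
      _ = δ * Real.log t := Real.log_rpow ht0 δ
      _ ≤ 1 * Real.log t := by gcongr
      _ ≤ t ^ δ := by linarith
      _ ≤ t ^ (1 / 2 + δ) := Real.rpow_le_rpow_of_exponent_le ht1 (by linarith)
  have h4 : 1 ≤ t ^ (1 / 2 + δ) := Real.one_le_rpow ht1 (by positivity)
  have h5 : t ^ (1 / 2 + 2 * δ) = t ^ (1 / 2 + δ) * t ^ δ := by
    rw [← Real.rpow_add ht0]
    congr 1
    ring
  rw [h5] at hW
  nlinarith

/-- A set containing all large enough multiples of `N` has positive lower density. -/
lemma PosLowerDensity.of_multiples {S : Set ℕ} {N Q : ℕ} (hN : N ≠ 0)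
    (h : ∀ q ≥ Q, N ∣ q → q ∈ S) : PosLowerDensity S := by
  have hN0 : (0 : ℝ) < N := by exact_mod_cast Nat.pos_of_ne_zero hN
  have hfin : ∀ n : ℕ, {m : ℕ | m ≤ n ∧ m ∈ S}.Finite := fun n =>
    (Set.finite_Iic n).subset fun m hm => hm.1
  have hub : ∀ n : ℕ, Nat.card {m : ℕ | m ≤ n ∧ m ∈ S} ≤ n + 1 := by
    intro n
    have := Nat.card_mono (Set.finite_Iic n) (fun m hm => hm.1 :
      {m : ℕ | m ≤ n ∧ m ∈ S} ⊆ Set.Iic n)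
    simpa using this
  have hlb : ∀ n : ℕ, ((n : ℝ) + 1) / N - Q ≤ Nat.card {m : ℕ | m ≤ n ∧ m ∈ S} := by
    intro n
    have hsub : Set.image (fun k => N * k) (Finset.Icc Q (n / N) : Set ℕ) ⊆
        {m : ℕ | m ≤ n ∧ m ∈ S} := by
      rintro _ ⟨k, hk, rfl⟩
      rw [Finset.mem_coe, Finset.mem_Icc] at hk
      refine ⟨(Nat.mul_le_mul_left N hk.2).trans (Nat.mul_div_le n N), h _ ?_ (dvd_mul_right N k)⟩
      exact hk.1.trans (Nat.le_mul_of_pos_left k (Nat.pos_of_ne_zero hN))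
    have hc := Nat.card_mono (hfin n) hsub
    rw [Nat.card_image_of_injective (fun a b hab => Nat.eq_of_mul_eq_mul_left
      (Nat.pos_of_ne_zero hN) hab)] at hc
    simp only [SetLike.coe_sort_coe, Nat.card_eq_fintype_card, Fintype.card_coe,
      Nat.card_Icc] at hc
    have hc' : (n / N + 1 : ℕ) ≤ Nat.card {m : ℕ | m ≤ n ∧ m ∈ S} + Q := by omega
    have hcard : ((n / N + 1 : ℕ) : ℝ) ≤ Nat.card {m : ℕ | m ≤ n ∧ m ∈ S} + Q := by
      exact_mod_cast hc'
    have hd : ((n : ℝ) + 1) / N ≤ ((n / N + 1 : ℕ) : ℝ) := by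
      rw [div_le_iff₀ hN0]
      have := Nat.lt_div_mul_add (a := n) (Nat.pos_of_ne_zero hN)
      have h' : n + 1 ≤ (n / N + 1) * N := by
        rw [add_mul, one_mul]
        exact this
      exact_mod_cast h'
    linarith
  have hbdd : IsBoundedUnder (· ≤ ·) atTop
      (fun n : ℕ => (Nat.card {m : ℕ | m ≤ n ∧ m ∈ S} : ℝ) / (n + 1)) := by
    refine isBoundedUnder_of ⟨1, fun n => ?_⟩
    rw [div_le_one (by positivity)]
    exact_mod_cast hub n
  refine lt_of_lt_of_le (b := 1 / (2 * (N : ℝ))) (by positivity)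
    (le_liminf_of_le hbdd.isCoboundedUnder_ge ?_)
  filter_upwards [eventually_ge_atTop (2 * N * Q)] with n hn
  have hn' : 2 * (N : ℝ) * Q ≤ n := by exact_mod_cast hn
  rw [le_div_iff₀ (by positivity)]
  refine le_trans ?_ (hlb n)
  have e1 : ((n : ℝ) + 1) / N = 2 * (1 / (2 * (N : ℝ)) * (n + 1)) := by field_simp
  have e2 : (Q : ℝ) ≤ 1 / (2 * (N : ℝ)) * (n + 1) := by
    rw [one_div, inv_mul_eq_div, le_div_iff₀ (by positivity)]
    linarith
  linarith

/-- Large values of a summatory function on all intervals `[X, X ^ (1 + η)]` transfer to a positive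
lower density of moduli for which `W` is large. -/
lemma posLowerDensity_of_large_values {N : ℕ} (hN : N ≠ 0) {δ : ℝ} (hδ : 0 < δ) (hδ1 : δ < 1)
    {P : ℝ → Prop} {W : ℝ → ℕ → ℝ}
    (hP : ∀ᶠ X : ℝ in atTop, ∃ t ∈ Set.Icc X (X ^ (1 + δ / 2)), P t)
    (hW : ∀ᶠ t : ℝ in atTop, ∀ q : ℕ, N ∣ q → q ≠ 0 → (q : ℝ) ≤ t ^ δ → P t → t ^ (1 + δ) ≤ W t q)
    {h : ℝ → ℝ} (hmono : Monotone h) (htop : Tendsto h atTop atTop)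
    (ho : Tendsto (fun x : ℝ => h x / x ^ δ) atTop (nhds 0)) :
    PosLowerDensity {q : ℕ | ∃ x : ℝ,
      h (x ^ (1 - δ)) ≤ (q : ℝ) ∧ (q : ℝ) ≤ h x ∧ x ^ (1 + δ) ≤ W x q} := by
  set e := (1 + δ / 2) * (1 - δ) with he
  have he1 : e < 1 := by rw [he]; nlinarith
  have hexp : ∀ᶠ X : ℝ in atTop, X ^ e < X - 1 := by
    have h1 := (tendsto_rpow_neg_atTop (sub_pos.2 he1)).eventually
      (gt_mem_nhds (show (0 : ℝ) < 1 / 2 by norm_num))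
    filter_upwards [h1, eventually_gt_atTop 2] with X h1 hX
    have hX0 : 0 < X := by linarith
    have h2 : X ^ e = X ^ (-(1 - e)) * X := by
      rw [← Real.rpow_add_one hX0.ne']
      congr 1
      ring
    rw [h2]
    nlinarith
  obtain ⟨X₀, hX₀⟩ := eventually_atTop.1 (hP.and (hexp.and
    (hW.and ((ho.eventually (gt_mem_nhds one_pos)).and (eventually_gt_atTop 0)))))
  refine PosLowerDensity.of_multiples (N := N) (Q := ⌊h X₀⌋₊ + 1) hN fun q hq hNq => ?_
  have hq' : h X₀ < q := (Nat.lt_floor_add_one _).trans_le (by exact_mod_cast hq)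
  have hq0 : q ≠ 0 := by omega
  set B := {x : ℝ | (q : ℝ) ≤ h x} with hB
  have hBne : B.Nonempty := (htop.eventually_ge_atTop (q : ℝ)).exists
  have hBlb : ∀ x ∈ B, X₀ ≤ x := by
    intro x hx
    by_contra! hlt
    exact absurd (hmono hlt.le) (not_le.2 (hq'.trans_le hx))
  have hBbdd : BddBelow B := ⟨X₀, hBlb⟩
  have hX₀B : X₀ ≤ sInf B := le_csInf hBne hBlb
  obtain ⟨⟨t, ⟨ht1, ht2⟩, hPt⟩, hXe, -, -, hX0⟩ := hX₀ (sInf B + 1) (by linarith)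
  obtain ⟨-, -, hWt, hot, ht0⟩ := hX₀ t (by linarith)
  have hqt : (q : ℝ) ≤ h t := by
    obtain ⟨b, hb, hb'⟩ := exists_lt_of_csInf_lt hBne (lt_add_one (sInf B))
    exact le_trans hb (hmono (hb'.le.trans ht1))
  refine ⟨t, ?_, hqt, hWt q hNq hq0 ?_ hPt⟩
  · have hlt : t ^ (1 - δ) < sInf B := by
      calc t ^ (1 - δ) ≤ ((sInf B + 1) ^ (1 + δ / 2)) ^ (1 - δ) :=
            Real.rpow_le_rpow ht0.le ht2 (by linarith)
        _ = (sInf B + 1) ^ e := by rw [← Real.rpow_mul hX0.le]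
        _ < _ := by linarith
    have := notMem_of_lt_csInf hlt hBbdd
    exact (not_le.1 this).le
  · rw [div_lt_one (by positivity)] at hot
    linarith

/-- The conclusion for the characters whose failure of the Riemann hypothesis is witnessed by the
zero `ρ` of `L(s, χ)`, with `δ = (Re ρ - 1 / 2) / 4`. -/
lemma posLowerDensity_of_zero {N : ℕ} [NeZero N] {χ : DirichletCharacter ℂ N} {ρ : ℂ}
    (hρ : 1 / 2 < ρ.re) (hρ1 : ρ.re < 1) (h0 : DirichletCharacter.LFunction χ ρ = 0)
    {W : ℝ → ℕ → ℝ} (hW : ∀ (q : ℕ) (t : ℝ), N ∣ q → q ≠ 0 → 1 ≤ t →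
      ‖partialSum (centeredVonMangoldt χ) t‖ ≤
        √(q * W t q) + 4 * √t * Real.log t + Real.log q + 1)
    {h : ℝ → ℝ} (hmono : Monotone h) (htop : Tendsto h atTop atTop)
    (ho : Tendsto (fun x : ℝ => h x / x ^ ((ρ.re - 1 / 2) / 4)) atTop (nhds 0)) :
    PosLowerDensity {q : ℕ | ∃ x : ℝ, h (x ^ (1 - (ρ.re - 1 / 2) / 4)) ≤ (q : ℝ) ∧
      (q : ℝ) ≤ h x ∧ x ^ (1 + (ρ.re - 1 / 2) / 4) ≤ W x q} := by
  set δ := (ρ.re - 1 / 2) / 4 with hδ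
  have hδ0 : 0 < δ := by rw [hδ]; linarith
  have hδ1 : δ < 1 := by rw [hδ]; linarith
  refine posLowerDensity_of_large_values (NeZero.ne N) hδ0 hδ1
    (P := fun t => t ^ (1 / 2 + 2 * δ) ≤ ‖partialSum (centeredVonMangoldt χ) t‖)
    (eventually_exists_large_centeredVonMangoldt χ h0 (by linarith) (by rw [hδ]; linarith) hρ1
      (by linarith) (by linarith)) ?_ hmono htop ho
  filter_upwards [eventually_rpow_le_of_le_sqrt hδ0 hδ1.le, eventually_ge_atTop 1]
    with t ht ht1 q hNq hq hqt hP
  exact ht q (W t q) hq hqt (hP.trans (hW q t hNq hq ht1))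

theorem GRH_false_implies_large_values (hGRH : ¬ GRH) :
    ∃ δ : ℝ, 0 < δ ∧ ∀ h : ℝ → ℝ, Monotone h → Tendsto h atTop atTop →
      Tendsto (fun x : ℝ => h x / x ^ δ) atTop (nhds 0) →
      PosLowerDensity {q : ℕ | ∃ x : ℝ,
        h (x ^ (1 - δ)) ≤ (q : ℝ) ∧ (q : ℝ) ≤ h x ∧ x ^ (1 + δ) ≤ Gvar x q} ∧
      ((∃ (N : ℕ) (χ : DirichletCharacter ℂ N), χ ≠ 1 ∧ ¬ GRHchi χ) →
        PosLowerDensity {q : ℕ | ∃ x : ℝ,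
          h (x ^ (1 - δ)) ≤ (q : ℝ) ∧ (q : ℝ) ≤ h x ∧ x ^ (1 + δ) ≤ Vvar x q}) := by
  by_cases hnp : ∃ (N : ℕ) (χ : DirichletCharacter ℂ N), χ ≠ 1 ∧ ¬ GRHchi χ
  · obtain ⟨N, χ, hχ, hbad⟩ := hnp
    obtain ⟨M, hM, ψ, ρ, hψ, hρ, hρ1, h0⟩ := exists_zero_of_not_GRHchi hbad
    refine ⟨(ρ.re - 1 / 2) / 4, by linarith, fun h hmono htop ho => ⟨?_, fun _ => ?_⟩⟩
    · exact posLowerDensity_of_zero hρ hρ1 h0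
        (fun q t hq hq0 ht => norm_partialSum_le_of_Gvar hq hq0 ψ ht) hmono htop ho
    · exact posLowerDensity_of_zero hρ hρ1 h0
        (fun q t hq hq0 ht => norm_partialSum_le_of_Vvar hq hq0 (hψ hχ) ht) hmono htop ho
  · simp only [GRH, not_forall] at hGRH
    obtain ⟨N, χ, hbad⟩ := hGRH
    obtain ⟨M, hM, ψ, ρ, -, hρ, hρ1, h0⟩ := exists_zero_of_not_GRHchi hbad
    refine ⟨(ρ.re - 1 / 2) / 4, by linarith, fun h hmono htop ho => ⟨?_, fun hex => ?_⟩⟩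
    · exact posLowerDensity_of_zero hρ hρ1 h0
        (fun q t hq hq0 ht => norm_partialSum_le_of_Gvar hq hq0 ψ ht) hmono htop ho
    · exact absurd hex hnp
end
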